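/- arXiv:1907.02075 — 7 statements merged into one kernel-verified Lean document; each statement's English description precedes it below -/
import Mathlib

section
/- Let p be a prime and D ≥ 0 an integer. If Q is a 2q × 2q symplectic matrix over R_D (i.e., Q† λ_q Q = λ_q), then there exists a unit c ∈ R_D^× such that det Q = c · (star c)^{−1}; equivalently, det Q is a monomial x₁^{e₁}⋯x_D^{e_D} with coefficient 1 in which every exponent e_j is even. -/
/-! Statement 0: the determinant of any symplectic matrix `Q` over the Laurent
polynomial ring `R_D = 𝔽_p[x₁^±, …, x_D^±]` equals `c * (star c)⁻¹` for some unit `c`. -/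

noncomputable section

/-- The Laurent polynomial ring in `D` variables over `F`. -/
abbrev LPoly (F : Type) [Field F] (D : ℕ) : Type := AddMonoidAlgebra F (Fin D →₀ ℤ)

/-- The involution `x_j ↦ x_j⁻¹`, induced by negation of exponents. -/
def lstar (F : Type) [Field F] (D : ℕ) : LPoly F D ≃ₐ[F] LPoly F D :=
  AddMonoidAlgebra.domCongr F F (AddEquiv.neg (Fin D →₀ ℤ))

/-- Conjugate transpose: transpose followed by entrywise `star`. -/
def dag {F : Type} [Field F] {D : ℕ} {m n : Type} (M : Matrix m n (LPoly F D)) :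
    Matrix n m (LPoly F D) := fun i j => lstar F D (M j i)

/-- The standard symplectic form `λ = [[0, I],[−I, 0]]`. -/
def lam (F : Type) [Field F] (D : ℕ) (ι : Type) [DecidableEq ι] :
    Matrix (ι ⊕ ι) (ι ⊕ ι) (LPoly F D) :=
  Matrix.fromBlocks 0 1 (-1) 0

/-- If `A` has two unique sums and `R` has no zero divisors, the only invertible elements of `R[A]`
are monomials. -/
theorem AddMonoidAlgebra.exists_eq_single_of_mul_eq_one {R A : Type*} [Semiring R]
    [NoZeroDivisors R] [Nontrivial R] [AddMonoid A] [TwoUniqueSums A]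
    {f g : AddMonoidAlgebra R A} (h : f * g = 1) : ∃ a r, f = single a r := by
  classical
  have hsupp : ∀ x : A × A, x ∈ f.coeff.support ×ˢ g.coeff.support →
      UniqueAdd f.coeff.support g.coeff.support x.1 x.2 → x.1 + x.2 = 0 := by
    intro x hx hu
    by_contra hne
    have hmul := AddMonoidAlgebra.coeff_mul_add_of_uniqueAdd (f := f) (g := g) hu
    rw [h, AddMonoidAlgebra.one_def, AddMonoidAlgebra.coeff_single,
      Finsupp.single_eq_of_ne hne] at hmul
    simp only [Finset.mem_product, Finsupp.mem_support_iff] at hx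
    exact mul_ne_zero hx.1 hx.2 hmul.symm
  have hcard : ¬ 1 < f.coeff.support.card * g.coeff.support.card := by
    intro hlt
    obtain ⟨x, hx, y, hy, hxy, hux, huy⟩ := TwoUniqueSums.uniqueAdd_of_one_lt_card hlt
    have hy' := Finset.mem_product.1 hy
    obtain ⟨h₁, h₂⟩ := hux hy'.1 hy'.2 ((hsupp y hy huy).trans (hsupp x hx hux).symm)
    exact hxy (Prod.ext h₁.symm h₂.symm)
  have hg : g.coeff.support.card ≠ 0 := by
    intro h0
    have hg0 : g = 0 := by
      ext a
      simp [Finsupp.support_eq_empty.1 (Finset.card_eq_zero.1 h0)]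
    rw [hg0, mul_zero] at h
    exact zero_ne_one h
  have hf : f.coeff.support.card ≤ 1 :=
    (Nat.le_mul_of_pos_right _ (Nat.pos_of_ne_zero hg)).trans (not_lt.1 hcard)
  have : Nonempty A := ⟨0⟩
  obtain ⟨a, ha⟩ := Finsupp.card_support_le_one.1 hf
  refine ⟨a, f.coeff a, ?_⟩
  ext b
  rw [AddMonoidAlgebra.coeff_single, ← ha]

theorem lam_eq_neg_J (F : Type) [Field F] (D : ℕ) (ι : Type) [DecidableEq ι] :
    lam F D ι = -Matrix.J ι (LPoly F D) := by
  simp [lam, Matrix.J, Matrix.fromBlocks_neg]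

/-- A ring homomorphism to a commutative ring that identifies each element with its image under
`lstar` sends symplectic matrices to matrices of determinant one. -/
theorem map_det_eq_one_of_map_lstar {F : Type} [Field F] {D : ℕ} {ι : Type} [Fintype ι]
    [DecidableEq ι] {S : Type*} [CommRing S] (φ : LPoly F D →+* S)
    (hφ : ∀ x, φ (lstar F D x) = φ x) {Q : Matrix (ι ⊕ ι) (ι ⊕ ι) (LPoly F D)}
    (hQ : dag Q * lam F D ι * Q = lam F D ι) : φ Q.det = 1 := by
  have hdag : (dag Q).map φ = (Q.map φ).transpose := by
    ext i j
    exact hφ _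
  have hlam : (lam F D ι).map φ = -Matrix.J ι S := by
    rw [lam_eq_neg_J, ← RingHom.mapMatrix_apply, map_neg, RingHom.mapMatrix_apply, Matrix.map_J]
  have h := congrArg (fun M => M.map φ) hQ
  simp only [Matrix.map_mul, hdag, hlam, mul_neg, neg_mul, neg_inj] at h
  rw [RingHom.map_det]
  exact SymplecticGroup.det_eq_one (SymplecticGroup.mem_iff'.2 h)

/-- The determinant `d` of a symplectic matrix satisfies `lstar d * d = 1`. -/
theorem lstar_det_mul_det {F : Type} [Field F] {D : ℕ} {ι : Type} [Fintype ι]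
    [DecidableEq ι] {Q : Matrix (ι ⊕ ι) (ι ⊕ ι) (LPoly F D)}
    (hQ : dag Q * lam F D ι * Q = lam F D ι) : lstar F D Q.det * Q.det = 1 := by
  have hdag : (dag Q).det = lstar F D Q.det := by
    rw [AlgEquiv.map_det, ← Matrix.det_transpose]
    rfl
  have hlam : IsUnit (lam F D ι).det := by
    rw [lam_eq_neg_J, Matrix.det_neg]
    exact ((isUnit_one.neg).pow _).mul (Matrix.isUnit_det_J ι _)
  have h := congrArg Matrix.det hQ
  rw [Matrix.det_mul, Matrix.det_mul, hdag] at h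
  refine hlam.mul_left_cancel ?_
  rw [mul_one]
  linear_combination h

/-- Reduction of exponents modulo two. -/
def exponentMod2 (D : ℕ) : (Fin D →₀ ℤ) →+ (Fin D →₀ ZMod 2) :=
  Finsupp.mapRange.addMonoidHom (Int.castAddHom (ZMod 2))

theorem exponentMod2_neg {D : ℕ} (a : Fin D →₀ ℤ) : exponentMod2 D (-a) = exponentMod2 D a := by
  ext i
  simp [exponentMod2, ZMod.neg_eq_self_mod_two]

theorem exists_add_self_of_exponentMod2_eq_zero {D : ℕ} {a : Fin D →₀ ℤ}
    (ha : exponentMod2 D a = 0) : ∃ b, a = b + b := by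
  refine ⟨a.mapRange (· / 2) (by simp), ?_⟩
  ext i
  have hi : ((a i : ℤ) : ZMod 2) = 0 := by simpa [exponentMod2] using DFunLike.congr_fun ha i
  have := (ZMod.intCast_zmod_eq_zero_iff_dvd (a i) 2).1 hi
  simp only [Finsupp.add_apply, Finsupp.mapRange_apply]
  omega

theorem map_exponentMod2_lstar (F : Type) [Field F] (D : ℕ) (x : LPoly F D) :
    AddMonoidAlgebra.mapDomainRingHom F (exponentMod2 D) (lstar F D x) =
      AddMonoidAlgebra.mapDomainRingHom F (exponentMod2 D) x := by
  induction x using AddMonoidAlgebra.induction_linear with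
  | zero => simp
  | add x y hx hy => simp only [map_add, hx, hy]
  | single a r => simp [lstar, exponentMod2_neg]

theorem det_symplectic_eq_unit_mul_star_unit_inv
    (p : ℕ) [Fact p.Prime] (D : ℕ) (q : ℕ) (hq : 0 < q)
    (Q : Matrix (Fin q ⊕ Fin q) (Fin q ⊕ Fin q) (LPoly (ZMod p) D))
    (hQ : dag Q * lam (ZMod p) D (Fin q) * Q = lam (ZMod p) D (Fin q)) :
    ∃ c : (LPoly (ZMod p) D)ˣ,
      Q.det * lstar (ZMod p) D (c : LPoly (ZMod p) D) = (c : LPoly (ZMod p) D) := by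
  have : TwoUniqueSums (Fin D →₀ ℤ) :=
    TwoUniqueSums.of_injective_addHom (Finsupp.coeFnAddHom (M := ℤ) (ι := Fin D)).toAddHom
      DFunLike.coe_injective inferInstance
  obtain ⟨a, r, hdet⟩ := AddMonoidAlgebra.exists_eq_single_of_mul_eq_one
    ((mul_comm _ _).trans (lstar_det_mul_det hQ))
  have h := map_det_eq_one_of_map_lstar _ (map_exponentMod2_lstar (ZMod p) D) hQ
  rw [hdet, AddMonoidAlgebra.mapDomainRingHom_apply, AddMonoidAlgebra.mapDomain_single,
    AddMonoidAlgebra.one_def] at h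
  have h' := congrArg AddMonoidAlgebra.coeff h
  rw [AddMonoidAlgebra.coeff_single, AddMonoidAlgebra.coeff_single, Finsupp.single_eq_single_iff]
    at h'
  obtain ⟨ha, rfl⟩ := h'.resolve_right fun h0 => one_ne_zero h0.2
  obtain ⟨b, rfl⟩ := exists_add_self_of_exponentMod2_eq_zero ha
  refine ⟨⟨.single b 1, .single (-b) 1, ?_, ?_⟩, ?_⟩
  · simp [AddMonoidAlgebra.single_mul_single, AddMonoidAlgebra.one_def]
  · simp [AddMonoidAlgebra.single_mul_single, AddMonoidAlgebra.one_def]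
  · simp [hdet, lstar, AddMonoidAlgebra.single_mul_single]
end
end

section
/- Let F be a field, D ≥ 1 and q ≥ 1. Let A and B be 2q × 2q matrices over R_{D−1} = F[x₁^{±1},…,x_{D−1}^{±1}] such that the matrix Q = A + x_D·B (with entries viewed in R_D via the canonical inclusion) is symplectic over R_D. Then, over R_{D−1}: (a) rank A + rank B = 2q and both rank A and rank B are even; (b) the determinantal ideals I_{rank A}(A) and I_{rank B}(B) are the unit ideal of R_{D−1}; (c) the kernel of the R_{D−1}-linear map R_{D−1}^{2q} → R_{D−1}^{2q} given by the matrix A†λ_q equals the image (column span) of the map given by B, and the kernel of the map given by B†λ_q equals the image of the map given by A. -/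
noncomputable section

/-- The canonical inclusion of the Laurent polynomial ring in the first `d` variables
into the one in `d+1` variables. -/
def incl (F : Type) [Field F] (d : ℕ) : LPoly F d →+* LPoly F (d + 1) :=
  AddMonoidAlgebra.mapDomainRingHom F
    (Finsupp.mapDomain.addMonoidHom (Fin.castSucc : Fin d → Fin (d + 1)))

/-- The last variable `x_D` of `R_D` (`D = d+1`). -/
def lastVar (F : Type) [Field F] (d : ℕ) : LPoly F (d + 1) :=
  AddMonoidAlgebra.single (Finsupp.single (Fin.last d) (1 : ℤ)) (1 : F)

/-- The `k`-th determinantal ideal of a matrix: the ideal generated by its `k × k` minors. -/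
def detIdeal {R : Type} [CommRing R] {m n : Type} [Fintype m] [Fintype n]
    (M : Matrix m n R) (k : ℕ) : Ideal R :=
  Ideal.span { d | ∃ (f : Fin k → m) (g : Fin k → n),
    Function.Injective f ∧ Function.Injective g ∧ d = (M.submatrix f g).det }

/-- The rank of a matrix over an integral domain: the largest `k` whose determinantal
ideal is nonzero. -/
def matRank {R : Type} [CommRing R] {m n : Type} [Fintype m] [Fintype n]
    (M : Matrix m n R) : ℕ :=
  sSup { k | detIdeal M k ≠ ⊥ }

open Module Matrix

theorem Matrix.exists_injective_submatrix_det_ne_zero {K m n : Type} [Field K] [Fintype m]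
    [Fintype n] (M : Matrix m n K) {k : ℕ} (hk : k ≤ M.rank) :
    ∃ (f : Fin k → m) (g : Fin k → n), Function.Injective f ∧ Function.Injective g ∧
      (M.submatrix f g).det ≠ 0 := by
  classical
  have aux : ∀ {a b : Type} [Fintype a] [Fintype b] (N : Matrix a b K), k ≤ N.rank →
      ∃ f : Fin k → a, Function.Injective f ∧ LinearIndependent K (N.submatrix f id).row := by
    intro a b _ _ N hN
    obtain ⟨κ, f, hf, hspan, hli⟩ := exists_linearIndependent' K N.row
    have : Fintype κ := Fintype.ofInjective f hf
    have hcard : k ≤ Fintype.card κ := by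
      rw [N.rank_eq_finrank_span_row, ← hspan] at hN
      rwa [linearIndependent_iff_card_eq_finrank_span.mp hli]
    let e : Fin k ↪ κ := (Fin.castLEEmb hcard).trans (Fintype.equivFin κ).symm.toEmbedding
    exact ⟨f ∘ e, hf.comp e.injective, hli.comp e e.injective⟩
  obtain ⟨f, hf, hfli⟩ := aux M hk
  have hrank : (M.submatrix f id)ᵀ.rank = k := by
    rw [rank_transpose, hfli.rank_matrix, Fintype.card_fin]
  obtain ⟨g, hg, hgli⟩ := aux (M.submatrix f id)ᵀ hrank.ge
  refine ⟨f, g, hf, hg, ?_⟩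
  have hunit : IsUnit ((M.submatrix f id)ᵀ.submatrix g id) :=
    linearIndependent_rows_iff_isUnit.mp hgli
  rw [isUnit_iff_isUnit_det, ← det_transpose] at hunit
  exact hunit.ne_zero

theorem le_rank_map_iff_not_detIdeal_le_ker {R K m n : Type} [CommRing R] [Field K] [Fintype m]
    [Fintype n] (φ : R →+* K) (M : Matrix m n R) (k : ℕ) :
    k ≤ (M.map φ).rank ↔ ¬ detIdeal M k ≤ RingHom.ker φ := by
  have hdet (f : Fin k → m) (g : Fin k → n) :
      φ (M.submatrix f g).det = ((M.map φ).submatrix f g).det := by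
    rw [RingHom.map_det]; rfl
  constructor
  · intro hk hle
    obtain ⟨f, g, hf, hg, hne⟩ := (M.map φ).exists_injective_submatrix_det_ne_zero hk
    rw [← hdet] at hne
    exact hne (RingHom.mem_ker.mp (hle (Ideal.subset_span ⟨f, g, hf, hg, rfl⟩)))
  · intro h
    contrapose! h
    refine Ideal.span_le.mpr ?_
    rintro _ ⟨f, g, -, -, rfl⟩
    rw [SetLike.mem_coe, RingHom.mem_ker, hdet]
    by_contra hne
    have hle := rank_submatrix_le (M.map φ) f g
    rw [Matrix.rank_of_det_ne_zero hne, Fintype.card_fin] at hle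
    exact h.not_ge hle

theorem matRank_eq_rank_map {R K m n : Type} [CommRing R] [Field K] [Fintype m]
    [Fintype n] (φ : R →+* K) (hφ : Function.Injective φ) (M : Matrix m n R) :
    matRank M = (M.map φ).rank := by
  have : {k | detIdeal M k ≠ ⊥} = Set.Iic (M.map φ).rank := by
    ext k
    rw [Set.mem_Iic, le_rank_map_iff_not_detIdeal_le_ker,
      (RingHom.injective_iff_ker_eq_bot φ).mp hφ, le_bot_iff]
    rfl
  rw [matRank, this, csSup_Iic]

theorem rank_map_le_matRank {R K m n : Type} [CommRing R] [IsDomain R] [Field K] [Fintype m]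
    [Fintype n] (φ : R →+* K) (M : Matrix m n R) :
    (M.map φ).rank ≤ matRank M := by
  rw [matRank_eq_rank_map _ (IsFractionRing.injective R (FractionRing R)),
    le_rank_map_iff_not_detIdeal_le_ker,
    (RingHom.injective_iff_ker_eq_bot _).mp (IsFractionRing.injective R (FractionRing R))]
  exact fun h => (le_rank_map_iff_not_detIdeal_le_ker φ M _).mp le_rfl (h.trans bot_le)

/-- Two pairs of matrices whose products are complementary orthogonal idempotents, as arises
from the coefficients of an invertible linear matrix polynomial. -/
structure IsComplementaryPair {R n : Type} [CommRing R] [Fintype n] [DecidableEq n]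
    (A B A' B' : Matrix n n R) : Prop where
  left_sum : A' * A + B' * B = 1
  right_sum : A * A' + B * B' = 1
  left_zero : A' * B = 0
  left_zero' : B' * A = 0
  right_zero : A * B' = 0
  right_zero' : B * A' = 0

namespace IsComplementaryPair

variable {R n : Type} [CommRing R] [Fintype n] [DecidableEq n] {A B A' B' : Matrix n n R}

theorem swap (h : IsComplementaryPair A B A' B') : IsComplementaryPair B A B' A' where
  left_sum := by rw [add_comm, h.left_sum]
  right_sum := by rw [add_comm, h.right_sum]
  left_zero := h.left_zero'
  left_zero' := h.left_zero
  right_zero := h.right_zero'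
  right_zero' := h.right_zero

theorem map {S : Type} [CommRing S] (h : IsComplementaryPair A B A' B') (φ : R →+* S) :
    IsComplementaryPair (A.map φ) (B.map φ) (A'.map φ) (B'.map φ) where
  left_sum := by simpa [Matrix.map_add] using congr_arg φ.mapMatrix h.left_sum
  right_sum := by simpa [Matrix.map_add] using congr_arg φ.mapMatrix h.right_sum
  left_zero := by simpa using congr_arg φ.mapMatrix h.left_zero
  left_zero' := by simpa using congr_arg φ.mapMatrix h.left_zero'
  right_zero := by simpa using congr_arg φ.mapMatrix h.right_zero
  right_zero' := by simpa using congr_arg φ.mapMatrix h.right_zero'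

theorem mul_mul_self (h : IsComplementaryPair A B A' B') : A * (A' * A) = A := by
  have := congr_arg (A * ·) h.left_sum
  simpa [mul_add, ← mul_assoc, h.right_zero] using this

theorem ker_eq_range (h : IsComplementaryPair A B A' B') :
    LinearMap.ker A'.mulVecLin = LinearMap.range B.mulVecLin := by
  ext v
  rw [LinearMap.mem_ker, LinearMap.mem_range]
  constructor
  · intro hv
    rw [mulVecLin_apply] at hv
    refine ⟨B' *ᵥ v, ?_⟩
    have := congr_arg (· *ᵥ v) h.right_sum
    simpa [add_mulVec, ← mulVec_mulVec, hv] using this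
  · rintro ⟨w, rfl⟩
    simp [h.left_zero]

theorem rank_add_rank {K : Type} [Field K] {A B A' B' : Matrix n n K}
    (h : IsComplementaryPair A B A' B') : A.rank + B.rank = Fintype.card n := by
  apply le_antisymm
  · have hA : A.rank ≤ A'.rank := by
      conv_lhs => rw [← h.mul_mul_self]
      exact (rank_mul_le_right _ _).trans (rank_mul_le_left _ _)
    have := rank_add_rank_le_card_of_mul_eq_zero h.right_zero'
    lia
  · have htop : LinearMap.range A.mulVecLin ⊔ LinearMap.range B.mulVecLin = ⊤ := by
      refine eq_top_iff.mpr fun v _ => Submodule.mem_sup.mpr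
        ⟨_, ⟨A' *ᵥ v, rfl⟩, _, ⟨B' *ᵥ v, rfl⟩, ?_⟩
      simpa [add_mulVec, ← mulVec_mulVec] using congr_arg (· *ᵥ v) h.right_sum
    have := Submodule.finrank_add_le_finrank_add_finrank
      (LinearMap.range A.mulVecLin) (LinearMap.range B.mulVecLin)
    rwa [htop, finrank_top, finrank_fintype_fun_eq_card] at this

variable [IsDomain R]

theorem matRank_add_matRank (h : IsComplementaryPair A B A' B') :
    matRank A + matRank B = Fintype.card n := by
  have hinj := IsFractionRing.injective R (FractionRing R)
  rw [matRank_eq_rank_map _ hinj, matRank_eq_rank_map _ hinj]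
  exact (h.map (algebraMap R (FractionRing R))).rank_add_rank

theorem rank_map_eq_matRank (h : IsComplementaryPair A B A' B') {K : Type} [Field K]
    (φ : R →+* K) : (A.map φ).rank = matRank A := by
  have := h.matRank_add_matRank
  have := (h.map φ).rank_add_rank
  have := rank_map_le_matRank φ A
  have := rank_map_le_matRank φ B
  lia

theorem detIdeal_matRank (h : IsComplementaryPair A B A' B') :
    detIdeal A (matRank A) = ⊤ := by
  by_contra! hne
  obtain ⟨m, hm, hle⟩ := Ideal.exists_le_maximal _ hne
  let _ : Field (R ⧸ m) := Ideal.Quotient.field m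
  refine (le_rank_map_iff_not_detIdeal_le_ker (Ideal.Quotient.mk m) A _).mp
    (h.rank_map_eq_matRank _).ge ?_
  rwa [Ideal.mk_ker]

end IsComplementaryPair

theorem LinearMap.BilinForm.IsAlt.exists_orthogonal_eq_self {K V : Type} [Field K]
    [AddCommGroup V] [Module K V] [FiniteDimensional K V] {β : LinearMap.BilinForm K V}
    (hβ : β.IsAlt) : ∃ L : Submodule K V, β.orthogonal L = L := by
  obtain ⟨L, hL⟩ : ∃ L : Submodule K V, Maximal (fun L => L ≤ β.orthogonal L) L :=
    exists_maximal_of_wellFoundedGT _ ⟨⊥, bot_le⟩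
  refine ⟨L, le_antisymm (fun v hv => ?_) hL.prop⟩
  have hiso : L ⊔ K ∙ v ≤ β.orthogonal (L ⊔ K ∙ v) := by
    intro x hx
    rw [LinearMap.BilinForm.mem_orthogonal_iff]
    intro y hy
    obtain ⟨l, hl, _, hs, rfl⟩ := Submodule.mem_sup.mp hx
    obtain ⟨l', hl', _, ht, rfl⟩ := Submodule.mem_sup.mp hy
    obtain ⟨s, rfl⟩ := Submodule.mem_span_singleton.mp hs
    obtain ⟨t, rfl⟩ := Submodule.mem_span_singleton.mp ht
    have h1 : β l' l = 0 := hL.prop hl l' hl'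
    have h2 : β l' v = 0 := hv l' hl'
    have h3 : β v l = 0 := hβ.isRefl _ _ (hv l hl)
    have h4 : β v v = 0 := hβ v
    simp [h1, h2, h3, h4]
  exact hL.le_of_ge hiso le_sup_left
    (Submodule.mem_sup_right (Submodule.mem_span_singleton_self v))

theorem Matrix.even_rank_of_alternating {K n : Type} [Field K] [Fintype n]
    (M : Matrix n n K) (hM : ∀ v, v ⬝ᵥ M *ᵥ v = 0) : Even M.rank := by
  classical
  have hβ : (Matrix.toBilin' M).IsAlt := fun v => by
    rw [Matrix.toBilin'_apply']; exact hM v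
  obtain ⟨L, hL⟩ := hβ.exists_orthogonal_eq_self
  have hker : (Matrix.toBilin' M).orthogonal ⊤ = LinearMap.ker M.mulVecLin := by
    ext v
    simp only [LinearMap.BilinForm.mem_orthogonal_iff, Submodule.mem_top, forall_const,
      Matrix.toBilin'_apply', LinearMap.mem_ker, mulVecLin_apply]
    simp_rw [dotProduct_comm _ (M *ᵥ v)]
    exact dotProduct_eq_zero_iff
  have hle : (Matrix.toBilin' M).orthogonal ⊤ ≤ L := by
    rw [← hL]
    exact LinearMap.BilinForm.orthogonal_le le_top
  have h1 := LinearMap.BilinForm.finrank_add_finrank_orthogonal hβ.isRefl L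
  rw [hL, inf_eq_right.mpr hle, hker] at h1
  have h2 := LinearMap.finrank_range_add_finrank_ker M.mulVecLin
  rw [← Matrix.rank] at h2
  exact ⟨finrank K (n → K) - finrank K L, by lia⟩

section Coefficients

variable {F : Type} [Field F] {d : ℕ}

theorem coeff_single_last_mul_incl (a : LPoly F d) (j k : ℤ) (m : Fin d →₀ ℤ) :
    (AddMonoidAlgebra.single (Finsupp.single (Fin.last d) j) 1 * incl F d a).coeff
      (Finsupp.mapDomain Fin.castSucc m + Finsupp.single (Fin.last d) k) =
    if k = j then a.coeff m else 0 := by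
  have hincl : (incl F d a).coeff =
      Finsupp.mapDomain (Finsupp.mapDomain Fin.castSucc) a.coeff := rfl
  have hinj := Finsupp.mapDomain_injective (M := ℤ) (Fin.castSucc_injective d)
  rw [AddMonoidAlgebra.coeff_single_mul_apply, one_mul, hincl]
  split_ifs with h
  · subst h
    rw [add_comm (Finsupp.mapDomain _ m), neg_add_cancel_left, Finsupp.mapDomain_apply hinj]
  · refine Finsupp.mapDomain_of_notMem_range _ _ ?_
    rintro ⟨m', hm'⟩
    have := DFunLike.congr_fun hm' (Fin.last d)
    have hlast (m : Fin d →₀ ℤ) : Finsupp.mapDomain Fin.castSucc m (Fin.last d) = 0 :=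
      Finsupp.mapDomain_of_notMem_range _ _ (by simp)
    simp [hlast] at this
    lia

/-- The inverse `x_D⁻¹` of the last variable. -/
def lastVarInv (F : Type) [Field F] (d : ℕ) : LPoly F (d + 1) :=
  AddMonoidAlgebra.single (Finsupp.single (Fin.last d) (-1 : ℤ)) (1 : F)

theorem lastVarInv_mul_lastVar : lastVarInv F d * lastVar F d = 1 := by
  rw [lastVarInv, lastVar, AddMonoidAlgebra.single_mul_single, ← Finsupp.single_add]
  simp [AddMonoidAlgebra.one_def]

theorem eq_and_eq_zero_of_incl_add_eq_incl {a b c e : LPoly F d}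
    (h : incl F d a + lastVar F d * incl F d b + lastVarInv F d * incl F d c = incl F d e) :
    a = e ∧ b = 0 ∧ c = 0 := by
  have key (m : Fin d →₀ ℤ) (k : ℤ) :
      (if k = 0 then a.coeff m else 0) + (if k = 1 then b.coeff m else 0) +
        (if k = -1 then c.coeff m else 0) = if k = 0 then e.coeff m else 0 := by
    have hone : (1 : LPoly F (d + 1)) =
        AddMonoidAlgebra.single (Finsupp.single (Fin.last d) 0) 1 := by
      simp [AddMonoidAlgebra.one_def]
    rw [← one_mul (incl F d a), ← one_mul (incl F d e), hone] at h
    have := congr_arg (fun p => p.coeff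
      (Finsupp.mapDomain Fin.castSucc m + Finsupp.single (Fin.last d) k)) h
    simpa only [AddMonoidAlgebra.coeff_add, Finsupp.add_apply, lastVar, lastVarInv,
      coeff_single_last_mul_incl] using this
  refine ⟨?_, ?_, ?_⟩ <;> ext m
  · simpa using key m 0
  · simpa using key m 1
  · simpa using key m (-1)

theorem lstar_incl (a : LPoly F d) : lstar F (d + 1) (incl F d a) = incl F d (lstar F d a) := by
  induction a using AddMonoidAlgebra.induction_linear with
  | zero => simp
  | add a b ha hb => simp [ha, hb]
  | single m r =>
    have hneg := map_neg (Finsupp.mapDomain.addMonoidHom (M := ℤ) (Fin.castSucc (n := d))) m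
    simpa [lstar, incl] using congr_arg (AddMonoidAlgebra.single · r) hneg.symm

theorem lstar_lastVar : lstar F (d + 1) (lastVar F d) = lastVarInv F d := by
  simp [lstar, lastVar, lastVarInv]

theorem dag_map_incl {m n : Type} (M : Matrix m n (LPoly F d)) :
    dag (M.map (incl F d)) = (dag M).map (incl F d) := by
  ext1 i j
  exact lstar_incl _

theorem lam_map_incl (ι : Type) [DecidableEq ι] :
    (lam F d ι).map (incl F d) = lam F (d + 1) ι := by
  simp [lam, Matrix.fromBlocks_map, Matrix.map_neg]

theorem lam_mul_lam (ι : Type) [Fintype ι] [DecidableEq ι] : lam F d ι * lam F d ι = -1 := by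
  simp [lam, Matrix.fromBlocks_multiply, ← Matrix.fromBlocks_one, Matrix.fromBlocks_neg]

/-- The symplectic adjoint `λ⁻¹ M† λ`. -/
def sympAdj {ι : Type} [Fintype ι] [DecidableEq ι] (M : Matrix (ι ⊕ ι) (ι ⊕ ι) (LPoly F d)) :
    Matrix (ι ⊕ ι) (ι ⊕ ι) (LPoly F d) :=
  -(lam F d ι * dag M * lam F d ι)

variable {ι : Type} [Fintype ι] [DecidableEq ι]

theorem eq_and_eq_zero_of_map_incl_add_eq_map_incl {m n : Type} {X Y Z E : Matrix m n (LPoly F d)}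
    (h : X.map (incl F d) + lastVar F d • Y.map (incl F d) + lastVarInv F d • Z.map (incl F d) =
      E.map (incl F d)) : X = E ∧ Y = 0 ∧ Z = 0 := by
  have key i j := eq_and_eq_zero_of_incl_add_eq_incl (congr_fun₂ h i j)
  exact ⟨ext fun i j => (key i j).1, ext fun i j => (key i j).2.1, ext fun i j => (key i j).2.2⟩

theorem sympAdj_pencil (A B : Matrix (ι ⊕ ι) (ι ⊕ ι) (LPoly F d)) :
    sympAdj (A.map (incl F d) + lastVar F d • B.map (incl F d)) =
      (sympAdj A).map (incl F d) + lastVarInv F d • (sympAdj B).map (incl F d) := by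
  have hdag : dag (A.map (incl F d) + lastVar F d • B.map (incl F d)) =
      (dag A).map (incl F d) + lastVarInv F d • (dag B).map (incl F d) := by
    rw [← dag_map_incl, ← dag_map_incl, ← lstar_lastVar]
    ext1 i j
    simp [dag]
  have hmap (M : Matrix (ι ⊕ ι) (ι ⊕ ι) (LPoly F d)) : (sympAdj M).map (incl F d) =
      -(lam F (d + 1) ι * (dag M).map (incl F d) * lam F (d + 1) ι) := by
    rw [sympAdj, ← lam_map_incl, ← Matrix.map_mul, ← Matrix.map_mul]
    ext1 i j
    simp only [Matrix.neg_apply, map_apply, map_neg]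
  rw [hmap, hmap, sympAdj, hdag]
  simp only [mul_add, add_mul, Matrix.mul_smul, Matrix.smul_mul, neg_add, smul_neg]

theorem isComplementaryPair_sympAdj {A B : Matrix (ι ⊕ ι) (ι ⊕ ι) (LPoly F d)}
    (hQ : dag (A.map (incl F d) + lastVar F d • B.map (incl F d)) *
        lam F (d + 1) ι * (A.map (incl F d) + lastVar F d • B.map (incl F d)) =
        lam F (d + 1) ι) :
    IsComplementaryPair A B (sympAdj A) (sympAdj B) := by
  have hleft : sympAdj (A.map (incl F d) + lastVar F d • B.map (incl F d)) *
      (A.map (incl F d) + lastVar F d • B.map (incl F d)) = 1 := by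
    rw [sympAdj, neg_mul, mul_assoc, mul_assoc, ← mul_assoc (dag _), hQ, lam_mul_lam, neg_neg]
  have hright := mul_eq_one_comm.mp hleft
  rw [sympAdj_pencil] at hleft hright
  have hinv := lastVarInv_mul_lastVar (F := F) (d := d)
  have hinv' := (mul_comm _ _).trans hinv
  have hone : (1 : Matrix (ι ⊕ ι) (ι ⊕ ι) (LPoly F d)).map (incl F d) = 1 := by simp
  obtain ⟨h1, h2, h3⟩ := eq_and_eq_zero_of_map_incl_add_eq_map_incl (F := F) (d := d)
    (X := sympAdj A * A + sympAdj B * B) (Y := sympAdj A * B) (Z := sympAdj B * A) (E := 1) <| by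
      rw [hone, ← hleft]
      simp only [Matrix.map_add _ (map_add _), Matrix.map_mul, mul_add, add_mul, Matrix.mul_smul,
        Matrix.smul_mul, smul_smul, hinv', one_smul]
      abel
  obtain ⟨h4, h5, h6⟩ := eq_and_eq_zero_of_map_incl_add_eq_map_incl (F := F) (d := d)
    (X := A * sympAdj A + B * sympAdj B) (Y := B * sympAdj A) (Z := A * sympAdj B) (E := 1) <| by
      rw [hone, ← hright]
      simp only [Matrix.map_add _ (map_add _), Matrix.map_mul, mul_add, add_mul, Matrix.mul_smul,
        Matrix.smul_mul, smul_smul, hinv, one_smul]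
      abel
  exact ⟨h1, h4, h2, h3, h6, h5⟩

theorem ker_sympAdj (A : Matrix (ι ⊕ ι) (ι ⊕ ι) (LPoly F d)) :
    LinearMap.ker (sympAdj A).mulVecLin = LinearMap.ker (dag A * lam F d ι).mulVecLin := by
  have h : dag A * lam F d ι = lam F d ι * sympAdj A := by
    rw [sympAdj, mul_neg, mul_assoc, ← mul_assoc, lam_mul_lam, neg_mul, one_mul, neg_neg]
  have h' : sympAdj A = -(lam F d ι * (dag A * lam F d ι)) := by
    rw [sympAdj, mul_assoc]
  ext v
  simp only [LinearMap.mem_ker, mulVecLin_apply]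
  constructor <;> intro hv
  · rw [h, ← mulVec_mulVec, hv, mulVec_zero]
  · rw [h', neg_mulVec, ← mulVec_mulVec, hv, mulVec_zero, neg_zero]

/-- The augmentation `x_j ↦ 1`. -/
def augmentation (F : Type) [Field F] (d : ℕ) : LPoly F d →ₐ[F] F :=
  AddMonoidAlgebra.lift F F (Fin d →₀ ℤ) 1

theorem augmentation_lstar (a : LPoly F d) :
    augmentation F d (lstar F d a) = augmentation F d a := by
  induction a using AddMonoidAlgebra.induction_linear with
  | zero => simp
  | add a b ha hb => simp [ha, hb]
  | single m r => simp [lstar, augmentation]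

theorem dotProduct_fromBlocks_mulVec_self (v : ι ⊕ ι → F) :
    v ⬝ᵥ (Matrix.fromBlocks 0 1 (-1) 0 : Matrix (ι ⊕ ι) (ι ⊕ ι) F) *ᵥ v = 0 := by
  rw [Matrix.fromBlocks_mulVec]
  simp [dotProduct, Fintype.sum_sum_type, neg_mulVec, mul_comm]

theorem IsComplementaryPair.even_matRank {A B : Matrix (ι ⊕ ι) (ι ⊕ ι) (LPoly F d)}
    (h : IsComplementaryPair A B (sympAdj A) (sympAdj B)) : Even (matRank A) := by
  let ε : LPoly F d →+* F := augmentation F d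
  let J : Matrix (ι ⊕ ι) (ι ⊕ ι) F := Matrix.fromBlocks 0 1 (-1) 0
  have hJ : (lam F d ι).map ε = J := by
    simp [lam, J, Matrix.fromBlocks_map, Matrix.map_neg]
  have hdag : (dag A).map ε = (A.map ε)ᵀ := by
    ext1 i j
    exact augmentation_lstar _
  have hadj : (sympAdj A).map ε = -(J * (A.map ε)ᵀ * J) := by
    rw [← hJ, ← hdag, ← Matrix.map_mul, ← Matrix.map_mul, sympAdj]
    ext1 i j
    simp only [Matrix.neg_apply, map_apply, map_neg]
  have hM : A.map ε * -J * ((A.map ε)ᵀ * J * A.map ε) = A.map ε := by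
    conv_rhs => rw [← (h.map ε).mul_mul_self, hadj]
    noncomm_ring
  have hrank : ((A.map ε)ᵀ * J * A.map ε).rank = (A.map ε).rank := by
    refine le_antisymm (rank_mul_le_right _ _) ?_
    conv_lhs => rw [← hM]
    exact rank_mul_le_right _ _
  rw [← h.rank_map_eq_matRank ε, ← hrank]
  refine Matrix.even_rank_of_alternating _ fun v => ?_
  rw [← mulVec_mulVec, ← mulVec_mulVec, dotProduct_mulVec, vecMul_transpose]
  exact dotProduct_fromBlocks_mulVec_self _

end Coefficients

/-- if `Q = A + x_D·B` is symplectic over `R_D` with `A, B` over `R_{D−1}`,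
then rank A + rank B = 2q with both ranks even, the corresponding determinantal ideals
are unit, and `ker(A†λ) = im B`, `ker(B†λ) = im A` over `R_{D−1}`. -/
theorem boundary_algebra_rank_and_exactness
    (F : Type) [Field F] (d : ℕ) (q : ℕ) (hq : 0 < q)
    (A B : Matrix (Fin q ⊕ Fin q) (Fin q ⊕ Fin q) (LPoly F d))
    (hQ : dag (A.map (incl F d) + lastVar F d • B.map (incl F d)) *
        lam F (d + 1) (Fin q) * (A.map (incl F d) + lastVar F d • B.map (incl F d)) =
        lam F (d + 1) (Fin q)) :
    (matRank A + matRank B = 2 * q ∧ Even (matRank A) ∧ Even (matRank B)) ∧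
    (detIdeal A (matRank A) = ⊤ ∧ detIdeal B (matRank B) = ⊤) ∧
    (LinearMap.ker (Matrix.mulVecLin (dag A * lam F d (Fin q))) =
        LinearMap.range (Matrix.mulVecLin B) ∧
      LinearMap.ker (Matrix.mulVecLin (dag B * lam F d (Fin q))) =
        LinearMap.range (Matrix.mulVecLin A)) := by
  have h := isComplementaryPair_sympAdj hQ
  refine ⟨⟨?_, h.even_matRank, h.swap.even_matRank⟩,
    ⟨h.detIdeal_matRank, h.swap.detIdeal_matRank⟩, ?_, ?_⟩
  · rw [h.matRank_add_matRank, Fintype.card_sum, Fintype.card_fin, two_mul]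
  · rw [← ker_sympAdj, h.ker_eq_range]
  · rw [← ker_sympAdj, h.swap.ker_eq_range]
end
end

section
/- Let F be any field, D ≥ 0, and let M be an n × m matrix over R_D = F[x₁^{±1},…,x_D^{±1}] with r = rank M. If the determinantal ideal I_r(M) is the unit ideal of R_D (equivalently, the smallest nonvanishing determinantal ideal of M is unit), then there exist an invertible n × n matrix E and an invertible m × m matrix E' over R_D such that E·M·E' = [[I_r, 0],[0, 0]] (the block matrix with the r × r identity in the top-left corner and zeros elsewhere). -/
noncomputable section

namespace QuillenSuslin

open Matrix

section Splitting

variable {R S ι κ : Type} [CommRing R] [CommRing S]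

/-- A square matrix `e` splits freely if it factors as `e = a * b` with `b * a = 1`:
such an `e` is idempotent and its image is free. -/
def SplitsFreely [Fintype ι] (e : Matrix ι ι R) : Prop :=
  ∃ (r : ℕ) (a : Matrix ι (Fin r) R) (b : Matrix (Fin r) ι R), a * b = e ∧ b * a = 1

/-- Every idempotent matrix over `R` has a free image; equivalently, all finitely generated
projective modules over `R` are free. -/
def HasFreeIdempotents (R : Type) [CommRing R] : Prop :=
  ∀ (n : ℕ) (e : Matrix (Fin n) (Fin n) R), e * e = e → SplitsFreely e

lemma SplitsFreely.map [Fintype ι] {e : Matrix ι ι R} (h : SplitsFreely e) (f : R →+* S) :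
    SplitsFreely (e.map f) := by
  obtain ⟨r, a, b, rfl, hba⟩ := h
  refine ⟨r, a.map f, b.map f, by rw [Matrix.map_mul], ?_⟩
  rw [← Matrix.map_mul, hba, Matrix.map_one _ f.map_zero f.map_one]

lemma SplitsFreely.of_factor [Fintype ι] [Fintype κ] [DecidableEq κ] {e : Matrix ι ι R}
    (a : Matrix ι κ R) (b : Matrix κ ι R) (hab : a * b = e) (hba : b * a = 1) :
    SplitsFreely e := by
  let f := Fintype.equivFin κ
  refine ⟨Fintype.card κ, a.submatrix id f.symm, b.submatrix f.symm id, ?_, ?_⟩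
  · rw [Matrix.submatrix_mul_equiv, hab, submatrix_id_id]
  · rw [← Matrix.submatrix_mul _ _ _ _ _ Function.bijective_id, hba, submatrix_one_equiv]

lemma SplitsFreely.of_eq_mul [Fintype ι] [Fintype κ] {e : Matrix ι ι R} {e' : Matrix κ κ R}
    (h : SplitsFreely e') (p : Matrix ι κ R) (q : Matrix κ ι R) (hqp : q * p * e' = e')
    (he : e = p * e' * q) : SplitsFreely e := by
  obtain ⟨r, a, b, rfl, hba⟩ := h
  have ha : q * (p * a) = a := by
    calc q * (p * a) = q * p * (a * b) * a := by simp only [Matrix.mul_assoc, hba, Matrix.mul_one]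
      _ = a := by rw [hqp, Matrix.mul_assoc, hba, Matrix.mul_one]
  refine ⟨r, p * a, b * q, ?_, ?_⟩
  · rw [he]; simp only [Matrix.mul_assoc]
  · rw [Matrix.mul_assoc, ha, hba]

lemma SplitsFreely.of_conj [Fintype ι] [DecidableEq ι] {e e' u v : Matrix ι ι R}
    (h : SplitsFreely e') (huv : u * v = 1) (he : e * u = u * e') : SplitsFreely e := by
  refine h.of_eq_mul u v (by rw [mul_eq_one_comm.1 huv, Matrix.one_mul]) ?_
  rw [← he, Matrix.mul_assoc, huv, Matrix.mul_one]

lemma SplitsFreely.of_fromBlocks [Fintype ι] [Fintype κ] [DecidableEq ι] {e : Matrix ι ι R}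
    (h : SplitsFreely (fromBlocks e 0 0 (0 : Matrix κ κ R))) : SplitsFreely e := by
  refine h.of_eq_mul (fromCols 1 0) (fromRows 1 0) ?_ ?_
  · rw [fromRows_mul_fromCols, fromBlocks_multiply]; simp
  · simp [fromCols_mul_fromBlocks, fromCols_mul_fromRows]

lemma HasFreeIdempotents.splitsFreely [Fintype ι] [DecidableEq ι] (hR : HasFreeIdempotents R)
    {e : Matrix ι ι R} (he : e * e = e) : SplitsFreely e := by
  let f := Fintype.equivFin ι
  have h : SplitsFreely (e.submatrix f.symm f.symm) :=
    hR _ _ (by rw [Matrix.submatrix_mul_equiv, he])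
  refine h.of_eq_mul ((1 : Matrix ι ι R).submatrix id f.symm)
    ((1 : Matrix ι ι R).submatrix f.symm id) ?_ ?_
  · rw [← Matrix.submatrix_mul _ _ _ _ _ Function.bijective_id, Matrix.one_mul,
      Matrix.submatrix_mul_equiv, Matrix.one_mul]
  · rw [Matrix.submatrix_mul_equiv, Matrix.submatrix_mul_equiv]; simp

lemma HasFreeIdempotents.of_retract (hS : HasFreeIdempotents S) (f : R →+* S) (g : S →+* R)
    (h : g.comp f = RingHom.id R) : HasFreeIdempotents R := by
  intro n e he
  have := (hS n (e.map f) (by rw [← Matrix.map_mul, he])).map g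
  rwa [Matrix.map_map, ← RingHom.coe_comp, h, RingHom.coe_id, Matrix.map_id] at this

/-- The diagonal idempotent selected by `p`. -/
def diagIdem (R : Type) [CommRing R] [DecidableEq ι] (p : ι → Bool) : Matrix ι ι R :=
  diagonal fun i => if p i then 1 else 0

lemma diagIdem_mul_self [Fintype ι] [DecidableEq ι] (p : ι → Bool) :
    diagIdem R p * diagIdem R p = diagIdem R p := by
  rw [diagIdem, diagonal_mul_diagonal]
  congr 1; ext i; by_cases h : p i <;> simp [h]

lemma one_sub_diagIdem [DecidableEq ι] (p : ι → Bool) :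
    1 - diagIdem R p = diagIdem R fun i => !p i := by
  rw [diagIdem, ← diagonal_one, diagonal_sub, diagIdem]
  congr 1; ext i; by_cases h : p i <;> simp [h]

lemma fromBlocks_diagIdem [DecidableEq ι] [DecidableEq κ] (p : ι → Bool) :
    fromBlocks (diagIdem R p) 0 0 (0 : Matrix κ κ R) =
      diagIdem R (Sum.elim p fun _ => false) := by
  have h0 : (0 : Matrix κ κ R) = diagonal fun _ => 0 := by ext i j; simp [diagonal_apply]
  rw [h0, diagIdem, fromBlocks_diagonal, diagIdem]
  congr 1; ext i
  cases i with
  | inl i => rfl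
  | inr i => simp

lemma splitsFreely_diagIdem [Fintype ι] [DecidableEq ι] (p : ι → Bool) :
    SplitsFreely (diagIdem R p) := by
  refine .of_factor (κ := {i // p i = true}) ((1 : Matrix ι ι R).submatrix id Subtype.val)
    ((1 : Matrix ι ι R).submatrix Subtype.val id) ?_ ?_
  · ext i j
    simp only [mul_apply, submatrix_apply, id, diagIdem, one_apply, diagonal_apply]
    by_cases h : p i
    · rw [Finset.sum_eq_single ⟨i, h⟩] <;> grind
    · rw [Finset.sum_eq_zero] <;> grind
  · rw [← Matrix.submatrix_mul _ _ _ _ _ Function.bijective_id, Matrix.one_mul,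
      submatrix_one _ Subtype.val_injective]

variable {r r' : ℕ}

/-- The square matrix with column blocks `a` and `a'`. -/
def joinCols (φ : Fin r ⊕ Fin r' ≃ ι) (a : Matrix ι (Fin r) R) (a' : Matrix ι (Fin r') R) :
    Matrix ι ι R :=
  (fromCols a a').submatrix id φ.symm

/-- The square matrix with row blocks `b` and `b'`. -/
def joinRows (φ : Fin r ⊕ Fin r' ≃ ι) (b : Matrix (Fin r) ι R) (b' : Matrix (Fin r') ι R) :
    Matrix ι ι R :=
  (fromRows b b').submatrix φ.symm id

lemma joinCols_map (φ : Fin r ⊕ Fin r' ≃ ι) (a : Matrix ι (Fin r) R) (a' : Matrix ι (Fin r') R)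
    (f : R →+* S) : (joinCols φ a a').map f = joinCols φ (a.map f) (a'.map f) := by
  ext i j
  simp only [joinCols, map_apply, submatrix_apply, id]
  cases φ.symm j <;> simp

variable [Fintype ι] [DecidableEq ι]

lemma mul_eq_zero_of_splitting {a : Matrix ι (Fin r) R} {b : Matrix (Fin r) ι R}
    {a' : Matrix ι (Fin r') R} {b' : Matrix (Fin r') ι R} (h : a * b + a' * b' = 1)
    (hba : b * a = 1) (hba' : b' * a' = 1) : b * a' = 0 := by
  have : b * (a * b + a' * b') * a' = b * a' + b * a' := by
    rw [Matrix.mul_add, Matrix.add_mul, ← Matrix.mul_assoc, hba, Matrix.one_mul,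
      Matrix.mul_assoc, Matrix.mul_assoc, hba', Matrix.mul_one]
  rw [h, Matrix.mul_one] at this
  simpa using this

lemma fromRows_mul_fromCols_of_splitting {a : Matrix ι (Fin r) R} {b : Matrix (Fin r) ι R}
    {a' : Matrix ι (Fin r') R} {b' : Matrix (Fin r') ι R} (h : a * b + a' * b' = 1)
    (hba : b * a = 1) (hba' : b' * a' = 1) : fromRows b b' * fromCols a a' = 1 := by
  rw [fromRows_mul_fromCols, hba, hba', mul_eq_zero_of_splitting h hba hba',
    mul_eq_zero_of_splitting (by rwa [add_comm]) hba' hba, fromBlocks_one]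

lemma exists_equiv_of_splitting [Nontrivial R] {a : Matrix ι (Fin r) R} {b : Matrix (Fin r) ι R}
    {a' : Matrix ι (Fin r') R} {b' : Matrix (Fin r') ι R} (h : a * b + a' * b' = 1)
    (hba : b * a = 1) (hba' : b' * a' = 1) : Nonempty (Fin r ⊕ Fin r' ≃ ι) := by
  have h1 : fromCols a a' * fromRows b b' = 1 := by rw [fromCols_mul_fromRows, h]
  have h2 := fromRows_mul_fromCols_of_splitting h hba hba'
  exact ⟨Fintype.equivOfCardEq (card_eq_of_linearEquiv R (Matrix.toLin'OfInv h2 h1))⟩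

lemma joinCols_mul_joinRows (φ : Fin r ⊕ Fin r' ≃ ι) {a : Matrix ι (Fin r) R}
    {b : Matrix (Fin r) ι R} {a' : Matrix ι (Fin r') R} {b' : Matrix (Fin r') ι R}
    (h : a * b + a' * b' = 1) : joinCols φ a a' * joinRows φ b b' = 1 := by
  rw [joinCols, joinRows, Matrix.submatrix_mul_equiv, fromCols_mul_fromRows, h, submatrix_id_id]

lemma mul_joinCols (φ : Fin r ⊕ Fin r' ≃ ι) {a : Matrix ι (Fin r) R}
    {b : Matrix (Fin r) ι R} {a' : Matrix ι (Fin r') R} {b' : Matrix (Fin r') ι R}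
    (h : a * b + a' * b' = 1) (hba : b * a = 1) (hba' : b' * a' = 1) :
    a * b * joinCols φ a a' = joinCols φ a a' * diagIdem R fun i => (φ.symm i).isLeft := by
  have h1 : a * b * fromCols a a' = fromCols a 0 := by
    rw [mul_fromCols, Matrix.mul_assoc, hba, Matrix.mul_assoc,
      mul_eq_zero_of_splitting h hba hba', Matrix.mul_one, Matrix.mul_zero]
  have h2 : a * b * joinCols φ a a' = (a * b * fromCols a a').submatrix id φ.symm := by
    rw [joinCols, Matrix.submatrix_mul _ _ id id _ Function.bijective_id, submatrix_id_id]
  rw [h2, h1]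
  ext i j
  obtain ⟨k, rfl⟩ := φ.surjective j
  simp only [joinCols, diagIdem, mul_diagonal, submatrix_apply, id, Equiv.symm_apply_apply]
  cases k <;> simp

lemma exists_conj_diagIdem [Nontrivial R] {e : Matrix ι ι R} (h : SplitsFreely e)
    (h' : SplitsFreely (1 - e)) :
    ∃ (p : ι → Bool) (u v : Matrix ι ι R), u * v = 1 ∧ e * u = u * diagIdem R p := by
  obtain ⟨r, a, b, rfl, hba⟩ := h
  obtain ⟨r', a', b', h1, hba'⟩ := h'
  have h : a * b + a' * b' = 1 := by rw [h1]; abel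
  obtain ⟨φ⟩ := exists_equiv_of_splitting h hba hba'
  exact ⟨_, _, _, joinCols_mul_joinRows φ h, mul_joinCols φ h hba hba'⟩

lemma one_sub_mul_self {e : Matrix ι ι R} (h : e * e = e) : (1 - e) * (1 - e) = 1 - e := by
  simp [Matrix.sub_mul, Matrix.mul_sub, h]

lemma one_sub_conj {e u d : Matrix ι ι R} (h : e * u = u * d) :
    (1 - e) * u = u * (1 - d) := by
  rw [Matrix.sub_mul, h, Matrix.mul_sub, Matrix.one_mul, Matrix.mul_one]

end Splitting

lemma hasFreeIdempotents_of_isPrincipalIdealRing (R : Type) [CommRing R] [IsDomain R]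
    [IsPrincipalIdealRing R] : HasFreeIdempotents R := by
  intro n e he
  let N := LinearMap.range (toLin' e)
  let b := Module.finBasis R N
  let f : (Fin n → R) →ₗ[R] N := (toLin' e).rangeRestrict
  let g : N →ₗ[R] (Fin n → R) := N.subtype
  have hgf : g ∘ₗ f = toLin' e := LinearMap.subtype_comp_codRestrict _ _ _
  have hfg : f ∘ₗ g = LinearMap.id := by
    ext ⟨x, y, rfl⟩ : 2
    change toLin' e (toLin' e y) = toLin' e y
    rw [← LinearMap.comp_apply, ← toLin'_mul, he]
  refine ⟨_, LinearMap.toMatrix b (Pi.basisFun R (Fin n)) g,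
    LinearMap.toMatrix (Pi.basisFun R (Fin n)) b f, ?_, ?_⟩
  · rw [← LinearMap.toMatrix_comp, hgf, ← toLin_eq_toLin', LinearMap.toMatrix_toLin]
  · rw [← LinearMap.toMatrix_comp, hfg, LinearMap.toMatrix_id]

section Patching

open Matrix Polynomial

variable {A B ι : Type} [CommRing A] [CommRing B]

/-- The substitution `X ↦ X + c * Y`, where `Y` is the outer variable. -/
def shiftHom (c : A) : A[X] →+* A[X][X] :=
  eval₂RingHom (C.comp C) (C X + C (C c) * X)

/-- The substitution `Y ↦ a * Y` in the outer variable. -/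
def scaleHom (a : A) : A[X][X] →+* A[X][X] :=
  eval₂RingHom C (C (C a) * X)

lemma scaleHom_comp_shiftHom (a c : A) : (scaleHom a).comp (shiftHom c) = shiftHom (a * c) := by
  refine Polynomial.ringHom_ext (fun r => by simp [scaleHom, shiftHom]) ?_
  simp [scaleHom, shiftHom]
  ring

lemma scaleHom_comp_C (a : A) : (scaleHom a).comp C = C := by
  ext <;> simp [scaleHom]

lemma coeff_scaleHom (a : A) (q : A[X][X]) (i : ℕ) :
    (scaleHom a q).coeff i = C (a ^ i) * q.coeff i := by
  induction q using Polynomial.induction_on' with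
  | add p q hp hq => simp [hp, hq, mul_add]
  | monomial n p =>
    have : scaleHom a (monomial n p) = C (p * C (a ^ n)) * X ^ n := by
      simp [scaleHom, mul_pow, mul_assoc]
    rw [this, coeff_C_mul_X_pow, coeff_monomial]
    by_cases h : i = n
    · subst h; simp [mul_comm]
    · simp [h, Ne.symm h]

lemma map_comp_shiftHom (f : A →+* B) (c : A) :
    (mapRingHom (mapRingHom f)).comp (shiftHom c) = (shiftHom (f c)).comp (mapRingHom f) := by
  ext <;> simp [shiftHom]

lemma exists_scaleHom_mem_range (S : Submonoid A) [Algebra A B] [IsLocalization S B]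
    (q : B[X][X]) (hq : q.coeff 0 ∈ (mapRingHom (algebraMap A B)).range) :
    ∃ s ∈ S, ∀ s', s ∣ s' →
      scaleHom (algebraMap A B s') q ∈ (mapRingHom (mapRingHom (algebraMap A B))).range := by
  classical
  obtain ⟨⟨s, hs⟩, h⟩ := IsLocalization.exist_integer_multiples_of_finset S
    (q.support.biUnion fun i => (q.coeff i).support.image (q.coeff i).coeff)
  refine ⟨s, hs, ?_⟩
  rintro _ ⟨d, rfl⟩
  rw [RingHom.mem_range, ← RingHom.mem_rangeS, ← Polynomial.lifts, lifts_iff_coeff_lifts]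
  intro i
  rw [coeff_scaleHom]
  rcases i with - | i
  · simpa using hq
  rw [← RingHom.coe_rangeS, SetLike.mem_coe, ← Polynomial.lifts, lifts_iff_coeff_lifts]
  intro j
  rw [coeff_C_mul]
  by_cases h0 : (q.coeff (i + 1)).coeff j = 0
  · exact ⟨0, by simp [h0]⟩
  obtain ⟨z, hz⟩ := h ((q.coeff (i + 1)).coeff j) (by
    simp only [Finset.mem_biUnion, mem_support_iff, Finset.mem_image]
    refine ⟨i + 1, fun h' => h0 (by simp [h']), j, h0, rfl⟩)
  refine ⟨s ^ i * d ^ (i + 1) * z, ?_⟩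
  rw [map_mul, hz, Algebra.smul_def]
  simp only [map_mul, map_pow]
  ring

lemma exists_scaleHom_lift [Fintype ι] [DecidableEq ι] (S : Submonoid A) [Algebra A B]
    [IsLocalization S B] (q : Matrix ι ι B[X][X]) (hq : q.map (evalRingHom 0) = 1) :
    ∃ s ∈ S, ∀ s', s ∣ s' → ∃ q' : Matrix ι ι A[X][X],
      q'.map (mapRingHom (mapRingHom (algebraMap A B))) =
        q.map (scaleHom (algebraMap A B s')) := by
  have h : ∀ i j, ∃ s ∈ S, ∀ s', s ∣ s' → scaleHom (algebraMap A B s') (q i j) ∈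
      (mapRingHom (mapRingHom (algebraMap A B))).range := by
    intro i j
    refine exists_scaleHom_mem_range S _ ?_
    have h1 : (q i j).coeff 0 = (1 : Matrix ι ι B[X]) i j := by
      rw [← hq]; simp [coeff_zero_eq_eval_zero]
    rw [h1, one_apply]
    split_ifs
    exacts [one_mem _, zero_mem _]
  choose s hs h using h
  refine ⟨∏ i, ∏ j, s i j, prod_mem fun i _ => prod_mem fun j _ => hs i j, fun s' hs' => ?_⟩
  have h2 : ∀ i j, ∃ z, mapRingHom (mapRingHom (algebraMap A B)) z =
      scaleHom (algebraMap A B s') (q i j) := fun i j =>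
    h i j s' (((Finset.dvd_prod_of_mem _ (Finset.mem_univ j)).trans
      (Finset.dvd_prod_of_mem (fun i => ∏ j, s i j) (Finset.mem_univ i))).trans hs')
  choose q' hq' using h2
  exact ⟨Matrix.of q', by ext1 i j; exact hq' i j⟩

variable [Fintype ι] [DecidableEq ι]

/-- `e(X + c * Y)` and `e(X)` are conjugate over `A[X][Y]`. -/
def ShiftConj (e : Matrix ι ι A[X]) (c : A) : Prop :=
  ∃ τ τ' : Matrix ι ι A[X][X], τ * τ' = 1 ∧ e.map (shiftHom c) * τ = τ * e.map (C : A[X] →+* _)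

lemma map_map_ringHom {R S T κ κ' : Type} [CommRing R] [CommRing S] [CommRing T]
    (M : Matrix κ κ' R) (f : R →+* S) (g : S →+* T) : (M.map f).map g = M.map (g.comp f) := rfl

lemma ShiftConj.mul_left {e : Matrix ι ι A[X]} {c : A} (h : ShiftConj e c) (a : A) :
    ShiftConj e (a * c) := by
  obtain ⟨τ, τ', h1, h2⟩ := h
  refine ⟨τ.map (scaleHom a), τ'.map (scaleHom a), ?_, ?_⟩
  · rw [← Matrix.map_mul, h1, Matrix.map_one _ (map_zero _) (map_one _)]
  · have := congrArg (fun M : Matrix ι ι A[X][X] => M.map (scaleHom a)) h2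
    simpa only [Matrix.map_mul, map_map_ringHom, scaleHom_comp_shiftHom, scaleHom_comp_C] using this

lemma ShiftConj.add {e : Matrix ι ι A[X]} {c c' : A} (h : ShiftConj e c) (h' : ShiftConj e c') :
    ShiftConj e (c + c') := by
  obtain ⟨τ, τ', h1, h2⟩ := h
  obtain ⟨θ, θ', h3, h4⟩ := h'
  let g : A[X][X] →+* A[X][X] := eval₂RingHom (shiftHom c') X
  have hg : g.comp (shiftHom c) = shiftHom (c + c') := by
    refine Polynomial.ringHom_ext (fun r => by simp [g, shiftHom]) ?_
    simp [g, shiftHom]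
    ring
  have hg' : g.comp C = shiftHom c' := by
    ext <;> simp [g]
  have h5 := congrArg (fun M : Matrix ι ι A[X][X] => M.map g) h2
  simp only [Matrix.map_mul, map_map_ringHom, hg, hg'] at h5
  have h6 : τ.map g * τ'.map g = 1 := by
    rw [← Matrix.map_mul, h1, Matrix.map_one _ (map_zero _) (map_one _)]
  refine ⟨τ.map g * θ, θ' * τ'.map g, ?_, ?_⟩
  · rw [Matrix.mul_assoc, ← Matrix.mul_assoc θ, h3, Matrix.one_mul, h6]
  · rw [← Matrix.mul_assoc, h5, Matrix.mul_assoc, h4, Matrix.mul_assoc]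

lemma exists_shiftConj_of_localization [IsDomain A] (S : Submonoid A) (hS : S ≤ nonZeroDivisors A)
    [Algebra A B] [IsLocalization S B] (e : Matrix ι ι A[X]) {σ σ' : Matrix ι ι B[X]}
    {c : Matrix ι ι B} (hσ : σ * σ' = 1)
    (he : e.map (mapRingHom (algebraMap A B)) * σ = σ * c.map (C : B →+* B[X])) :
    ∃ s ∈ S, ShiftConj e s := by
  let G := mapRingHom (mapRingHom (algebraMap A B))
  have hG : Function.Injective G :=
    map_injective _ (map_injective _ (IsLocalization.injective B hS))
  have hGm : Function.Injective fun M : Matrix ι ι A[X][X] => M.map G :=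
    Matrix.map_injective hG
  let E := e.map (mapRingHom (algebraMap A B))
  have hσ' := mul_eq_one_comm.1 hσ
  have he' : σ' * E = c.map (C : B →+* B[X]) * σ' := by
    calc σ' * E = σ' * (E * σ) * σ' := by
          rw [Matrix.mul_assoc, Matrix.mul_assoc E, hσ, Matrix.mul_one]
      _ = _ := by rw [he, ← Matrix.mul_assoc, hσ', Matrix.one_mul]
  let s1 : B[X] →+* B[X][X] := shiftHom 1
  let s0 : B[X] →+* B[X][X] := C
  have hs10 : s1.comp C = s0.comp C := by ext; simp [s1, s0, shiftHom]
  have hmap1 : ∀ {R R' : Type} [CommRing R] [CommRing R'] (f : R →+* R'),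
      (1 : Matrix ι ι R).map f = 1 := fun f => Matrix.map_one _ (map_zero f) (map_one f)
  have hz1 : (evalRingHom 0).comp s1 = RingHom.id B[X] := by ext <;> simp [s1, shiftHom]
  have hz0 : (evalRingHom 0).comp s0 = RingHom.id B[X] := by ext <;> simp [s0]
  let θ := σ.map s1 * σ'.map s0
  let θ' := σ.map s0 * σ'.map s1
  have hθθ' : θ * θ' = 1 := by
    simp only [θ, θ']
    rw [Matrix.mul_assoc, ← Matrix.mul_assoc (σ'.map s0), ← Matrix.map_mul, hσ', hmap1,
      Matrix.one_mul, ← Matrix.map_mul, hσ, hmap1]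
  have hEθ : E.map s1 * θ = θ * E.map s0 := by
    simp only [θ]
    rw [← Matrix.mul_assoc, ← Matrix.map_mul, he, Matrix.map_mul, map_map_ringHom, hs10,
      Matrix.mul_assoc, Matrix.mul_assoc, ← Matrix.map_mul, he', Matrix.map_mul, map_map_ringHom]
  have hid : ∀ M : Matrix ι ι B[X], M.map (RingHom.id B[X]) = M := fun M => by ext; simp
  have hθ0 : θ.map (evalRingHom 0) = 1 := by
    simp only [θ, Matrix.map_mul, map_map_ringHom, hz1, hz0, hid, hσ]
  have hθ0' : θ'.map (evalRingHom 0) = 1 := by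
    simp only [θ', Matrix.map_mul, map_map_ringHom, hz1, hz0, hid, hσ]
  obtain ⟨s, hs, h⟩ := exists_scaleHom_lift S θ hθ0
  obtain ⟨t, ht, h'⟩ := exists_scaleHom_lift S θ' hθ0'
  obtain ⟨τ, hτ⟩ := h (s * t) (dvd_mul_right _ _)
  obtain ⟨τ', hτ'⟩ := h' (s * t) (dvd_mul_left _ _)
  refine ⟨s * t, mul_mem hs ht, τ, τ', hGm ?_, hGm ?_⟩
  · change (τ * τ').map G = (1 : Matrix ι ι A[X][X]).map G
    rw [Matrix.map_mul, hτ, hτ', ← Matrix.map_mul, hθθ', hmap1, hmap1]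
  · change (e.map (shiftHom (s * t)) * τ).map G = (τ * e.map (C : A[X] →+* _)).map G
    have h3 := congrArg (fun M : Matrix ι ι B[X][X] =>
      M.map (scaleHom (algebraMap A B (s * t)))) hEθ
    simp only [Matrix.map_mul, map_map_ringHom, E, s1, s0, scaleHom_comp_C, ← RingHom.comp_assoc,
      scaleHom_comp_shiftHom, mul_one] at h3
    have hC : G.comp C = (C : B[X] →+* B[X][X]).comp (mapRingHom (algebraMap A B)) := by
      ext <;> simp [G]
    rw [Matrix.map_mul, Matrix.map_mul, hτ, map_map_ringHom, map_map_ringHom, hC,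
      map_comp_shiftHom]
    exact h3

/-- Local-global principle: a matrix over `A[X]` that is conjugate to a constant matrix over
`A_m[X]` for every maximal ideal `m` is conjugate over `A[X]` to its value at zero. -/
theorem exists_conj_eval_zero_of_forall_isMaximal [IsDomain A] (e : Matrix ι ι A[X])
    (h : ∀ (m : Ideal A) [m.IsMaximal], ∃ (σ σ' : Matrix ι ι (Localization.AtPrime m)[X])
      (c : Matrix ι ι (Localization.AtPrime m)), σ * σ' = 1 ∧
        e.map (mapRingHom (algebraMap A (Localization.AtPrime m))) * σ = σ * c.map (C : _ →+* _)) :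
    ∃ τ τ' : Matrix ι ι A[X], τ * τ' = 1 ∧
      e * τ = τ * (e.map (evalRingHom 0)).map (C : A →+* A[X]) := by
  let J : Ideal A :=
    { carrier := {c | ShiftConj e c}
      add_mem' := ShiftConj.add
      zero_mem' := by
        refine ⟨1, 1, mul_one 1, ?_⟩
        have : shiftHom (0 : A) = C := by ext <;> simp [shiftHom]
        rw [this, mul_one, one_mul]
      smul_mem' := fun a c hc => hc.mul_left a }
  have hJ : J = ⊤ := by
    by_contra hJ
    obtain ⟨m, hm, hJm⟩ := Ideal.exists_le_maximal J hJ
    obtain ⟨σ, σ', c, h1, h2⟩ := h m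
    obtain ⟨s, hs, hse⟩ := exists_shiftConj_of_localization m.primeCompl
      m.primeCompl_le_nonZeroDivisors e h1 h2
    exact hs (hJm hse)
  obtain ⟨τ, τ', h1, h2⟩ : ShiftConj e 1 := (Ideal.eq_top_iff_one J).1 hJ
  let g : A[X][X] →+* A[X] := eval₂RingHom (C.comp (evalRingHom 0)) X
  have hg : g.comp (shiftHom 1) = RingHom.id _ := by ext <;> simp [g, shiftHom]
  have hg' : g.comp C = C.comp (evalRingHom 0) := by ext <;> simp [g]
  refine ⟨τ.map g, τ'.map g, ?_, ?_⟩
  · rw [← Matrix.map_mul, h1, Matrix.map_one _ (map_zero _) (map_one _)]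
  · have := congrArg (fun M : Matrix ι ι A[X][X] => M.map g) h2
    simp only [Matrix.map_mul, map_map_ringHom, hg, hg'] at this
    rw [map_map_ringHom, ← this]
    congr 1

end Patching

section MonicLocalization

open Matrix Polynomial IsLocalRing

variable (A : Type) [CommRing A]

/-- The monic polynomials. -/
def monics : Submonoid A[X] where
  carrier := {p | p.Monic}
  one_mem' := monic_one
  mul_mem' := Monic.mul

/-- The localization of `A[X]` at the monic polynomials. -/
abbrev MonicLoc : Type := Localization (monics A)

lemma monicLoc_injective : Function.Injective (algebraMap A[X] (MonicLoc A)) :=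
  IsLocalization.injective _ (M := monics A) fun _ h => Monic.mem_nonZeroDivisors h

variable {A}

lemma Monic.isUnit_monicLoc {g : A[X]} (hg : g.Monic) :
    IsUnit (algebraMap A[X] (MonicLoc A) g) :=
  IsLocalization.map_units (MonicLoc A) (⟨g, hg⟩ : monics A)

lemma monicLoc_surj (x : MonicLoc A) :
    ∃ a g : A[X], g.Monic ∧ x * algebraMap _ _ g = algebraMap _ _ a := by
  obtain ⟨⟨a, g, hg⟩, h⟩ := IsLocalization.surj (monics A) x
  exact ⟨a, g, hg, h⟩

variable (A) [Nontrivial A]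

/-- The fractions `a / g` with `g` monic and `deg a < deg g`: those vanishing at infinity. -/
def vanishingAtInfty : Submodule A (MonicLoc A) where
  carrier := {x | ∃ a g : A[X], g.Monic ∧ a.degree < g.degree ∧
    x * algebraMap _ _ g = algebraMap _ _ a}
  zero_mem' := ⟨0, 1, monic_one, by simp, by simp⟩
  add_mem' := by
    rintro x y ⟨a, g, hg, ha, hx⟩ ⟨b, h, hh, hb, hy⟩
    refine ⟨a * h + b * g, g * h, hg.mul hh, ?_, ?_⟩
    · refine (degree_add_le _ _).trans_lt (max_lt ?_ ?_)
      · rw [hh.degree_mul, hh.degree_mul]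
        exact WithBot.add_lt_add_right (degree_ne_bot.2 hh.ne_zero) ha
      · rw [hg.degree_mul, mul_comm g h, hg.degree_mul]
        exact WithBot.add_lt_add_right (degree_ne_bot.2 hg.ne_zero) hb
    · simp only [map_add, map_mul, ← hx, ← hy]; ring
  smul_mem' := by
    rintro c x ⟨a, g, hg, ha, hx⟩
    refine ⟨c • a, g, hg, (degree_smul_le c a).trans_lt ha, ?_⟩
    rw [smul_mul_assoc, hx, Algebra.smul_def, Algebra.smul_def, map_mul,
      ← IsScalarTower.algebraMap_apply]

/-- The fractions `a / g` with `g` monic and `deg a ≤ deg g`: those finite at infinity. -/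
def regularAtInfty : Subring (MonicLoc A) where
  carrier := {x | ∃ a g : A[X], g.Monic ∧ a.degree ≤ g.degree ∧
    x * algebraMap _ _ g = algebraMap _ _ a}
  zero_mem' := ⟨0, 1, monic_one, by simp, by simp⟩
  one_mem' := ⟨1, 1, monic_one, le_rfl, by simp⟩
  add_mem' := by
    rintro x y ⟨a, g, hg, ha, hx⟩ ⟨b, h, hh, hb, hy⟩
    refine ⟨a * h + b * g, g * h, hg.mul hh, ?_, ?_⟩
    · refine (degree_add_le _ _).trans (max_le ?_ ?_)
      · rw [hh.degree_mul, hh.degree_mul]; gcongr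
      · rw [hg.degree_mul, mul_comm g h, hg.degree_mul]; gcongr
    · simp only [map_add, map_mul, ← hx, ← hy]; ring
  neg_mem' := by
    rintro x ⟨a, g, hg, ha, hx⟩
    exact ⟨-a, g, hg, by rwa [degree_neg], by rw [map_neg]; linear_combination -hx⟩
  mul_mem' := by
    rintro x y ⟨a, g, hg, ha, hx⟩ ⟨b, h, hh, hb, hy⟩
    refine ⟨a * b, g * h, hg.mul hh, ?_, ?_⟩
    · rw [hh.degree_mul]
      exact (degree_mul_le _ _).trans (add_le_add ha hb)
    · simp only [map_mul, ← hx, ← hy]; ring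

variable {A}

lemma regularAtInfty_of_vanishingAtInfty {x : MonicLoc A} (hx : x ∈ vanishingAtInfty A) :
    x ∈ regularAtInfty A := by
  obtain ⟨a, g, hg, ha, hx⟩ := hx
  exact ⟨a, g, hg, ha.le, hx⟩

lemma vanishingAtInfty_mul {x y : MonicLoc A} (hx : x ∈ regularAtInfty A)
    (hy : y ∈ vanishingAtInfty A) : x * y ∈ vanishingAtInfty A := by
  obtain ⟨a, g, hg, ha, hx⟩ := hx
  obtain ⟨b, h, hh, hb, hy⟩ := hy
  refine ⟨a * b, g * h, hg.mul hh, ?_, ?_⟩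
  · rw [hh.degree_mul]
    refine (degree_mul_le _ _).trans_lt ?_
    calc a.degree + b.degree ≤ g.degree + b.degree := by gcongr
      _ < _ := WithBot.add_lt_add_left (degree_ne_bot.2 hg.ne_zero) hb
  · simp only [map_mul, ← hx, ← hy]; ring

lemma eq_C_of_mem_regularAtInfty {p : A[X]}
    (hp : algebraMap A[X] (MonicLoc A) p ∈ regularAtInfty A) : p = C (p.coeff 0) := by
  obtain ⟨a, g, hg, ha, h⟩ := hp
  rw [← map_mul] at h
  rw [← monicLoc_injective A h, hg.degree_mul] at ha
  refine eq_C_of_degree_le_zero ?_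
  rw [degree_eq_natDegree hg.ne_zero] at ha
  by_cases h0 : p = 0
  · simp [h0]
  · rw [degree_eq_natDegree h0] at ha ⊢
    norm_cast at ha ⊢
    lia

lemma exists_add_vanishingAtInfty (x : MonicLoc A) :
    ∃ p : A[X], ∃ j ∈ vanishingAtInfty A, x = algebraMap _ _ p + j := by
  obtain ⟨a, g, hg, h⟩ := monicLoc_surj x
  refine ⟨a /ₘ g, x - algebraMap _ _ (a /ₘ g), ⟨a %ₘ g, g, hg, degree_modByMonic_lt _ hg, ?_⟩,
    by ring⟩
  rw [sub_mul, h, ← map_mul, ← map_sub]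
  congr 1
  linear_combination -modByMonic_add_div a g

/-- The ideal of `regularAtInfty A` of elements vanishing at infinity. -/
def inftyIdeal (A : Type) [CommRing A] [Nontrivial A] : Ideal (regularAtInfty A) where
  carrier := {b | (b : MonicLoc A) ∈ vanishingAtInfty A}
  zero_mem' := (vanishingAtInfty A).zero_mem
  add_mem' := fun hx hy => (vanishingAtInfty A).add_mem hx hy
  smul_mem' := fun c _ hx => vanishingAtInfty_mul c.2 hx

lemma mem_inftyIdeal {b : regularAtInfty A} :
    b ∈ inftyIdeal A ↔ (b : MonicLoc A) ∈ vanishingAtInfty A := Iff.rfl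

lemma isUnit_of_sub_one_mem_inftyIdeal {b : regularAtInfty A} (hb : b - 1 ∈ inftyIdeal A) :
    IsUnit b := by
  obtain ⟨a, g, hg, ha, h⟩ := mem_inftyIdeal.1 hb
  have hga : (g + a).Monic := hg.add_of_left ha
  obtain ⟨y, hy⟩ := (Monic.isUnit_monicLoc hga).exists_right_inv
  have hyB : algebraMap A[X] (MonicLoc A) g * y ∈ regularAtInfty A := by
    refine ⟨g, g + a, hga, ?_, ?_⟩
    · rw [degree_add_eq_left_of_degree_lt ha]
    · rw [mul_assoc, mul_comm y, hy, mul_one]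
  refine IsUnit.of_mul_eq_one ⟨_, hyB⟩ (Subtype.ext ?_)
  change (b : MonicLoc A) * (_ * y) = 1
  have h1 : (b : MonicLoc A) * algebraMap A[X] (MonicLoc A) g = algebraMap A[X] _ (g + a) := by
    rw [map_add, ← h]
    change _ = _ + ((b : MonicLoc A) - 1) * _
    ring
  rw [← mul_assoc, h1, hy]

lemma exists_inverse_one_sub {ι : Type} [Fintype ι] [DecidableEq ι] (j : Matrix ι ι (MonicLoc A))
    (hj : ∀ i k, j i k ∈ vanishingAtInfty A) :
    ∃ Y : Matrix ι ι (MonicLoc A), (∀ i k, Y i k ∈ regularAtInfty A) ∧ (1 - j) * Y = 1 := by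
  let j' : Matrix ι ι (regularAtInfty A) :=
    Matrix.of fun i k => ⟨j i k, regularAtInfty_of_vanishingAtInfty (hj i k)⟩
  have hdet : IsUnit (1 - j').det := by
    refine isUnit_of_sub_one_mem_inftyIdeal ?_
    rw [← Ideal.Quotient.eq_zero_iff_mem, map_sub, map_one, RingHom.map_det, RingHom.mapMatrix_apply]
    have : (1 - j').map (Ideal.Quotient.mk (inftyIdeal A)) = 1 := by
      ext i k
      have h0 : Ideal.Quotient.mk (inftyIdeal A) (j' i k) = 0 :=
        Ideal.Quotient.eq_zero_iff_mem.2 (mem_inftyIdeal.2 (hj i k))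
      rw [map_apply, Matrix.sub_apply, map_sub, h0, sub_zero, one_apply, one_apply]
      split_ifs
      exacts [map_one _, map_zero _]
    rw [this, det_one, sub_self]
  refine ⟨(1 - j')⁻¹.map (regularAtInfty A).subtype, fun i k => ((1 - j')⁻¹ i k).2, ?_⟩
  have h1 := congrArg (fun M => M.map (regularAtInfty A).subtype) (Matrix.mul_nonsing_inv _ hdet)
  simp only [Matrix.map_mul, Matrix.map_one _ (map_zero _) (map_one _)] at h1
  refine Eq.trans ?_ h1
  congr 1
  ext i k
  rw [Matrix.sub_apply, map_apply, Matrix.sub_apply, map_sub, one_apply, one_apply]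
  congr 1
  split_ifs
  exacts [(map_one _).symm, (map_zero _).symm]

end MonicLocalization

section LocalHorrocks

open Matrix Polynomial IsLocalRing

variable {A : Type} [CommRing A] [IsLocalRing A]

lemma eq_top_of_sup_maximalIdeal_smul {Y : Type} [AddCommGroup Y] [Module A Y]
    {N N' : Submodule A Y} (hN' : N'.FG) (h1 : N ⊔ N' = ⊤) (h2 : N ⊔ maximalIdeal A • ⊤ = ⊤) :
    N = ⊤ := by
  have h3 : N' ≤ N := by
    refine Submodule.le_of_le_smul_of_le_jacobson_bot hN' (maximalIdeal_le_jacobson ⊥) ?_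
    calc N' ≤ N ⊔ maximalIdeal A • (N ⊔ N') := by rw [h1, h2]; exact le_top
      _ = N ⊔ maximalIdeal A • N ⊔ maximalIdeal A • N' := by rw [Submodule.smul_sup, sup_assoc]
      _ ≤ _ := sup_le_sup_right (sup_le le_rfl Submodule.smul_le_right) _
  rw [← h1, sup_eq_left.2 h3]

/-- Reduction of polynomials modulo the maximal ideal. -/
abbrev polyResidue (A : Type) [CommRing A] [IsLocalRing A] : A[X] →+* (ResidueField A)[X] :=
  mapRingHom (residue A)

lemma polyResidue_surjective : Function.Surjective (polyResidue A) :=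
  Polynomial.map_surjective _ residue_surjective

/-- Rational functions over the residue field. -/
abbrev ResidueFunctionField (A : Type) [CommRing A] [IsLocalRing A] : Type :=
  FractionRing (ResidueField A)[X]

/-- Reduction modulo the maximal ideal of `A`, on the localization at monic polynomials. -/
def monicLocResidue (A : Type) [CommRing A] [IsLocalRing A] :
    MonicLoc A →+* ResidueFunctionField A :=
  IsLocalization.lift (M := monics A) (g := (algebraMap _ _).comp (polyResidue A)) fun g => by
    refine IsUnit.mk0 _ ?_
    rw [RingHom.comp_apply, Ne, FaithfulSMul.algebraMap_eq_zero_iff]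
    exact (Monic.map (residue A) g.2).ne_zero

lemma monicLocResidue_algebraMap (p : A[X]) :
    monicLocResidue A (algebraMap _ _ p) = algebraMap _ _ (polyResidue A p) :=
  IsLocalization.lift_eq _ _

lemma mem_smul_top_of_polyResidue_eq_zero {p : A[X]} (hp : polyResidue A p = 0) :
    p ∈ maximalIdeal A • (⊤ : Submodule A A[X]) := by
  rw [p.as_sum_support_C_mul_X_pow]
  refine Submodule.sum_mem _ fun i _ => ?_
  rw [← smul_eq_C_mul]
  refine Submodule.smul_mem_smul ?_ trivial
  rw [← residue_eq_zero_iff, ← coeff_map]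
  exact (congrArg (fun q => q.coeff i) hp).trans (coeff_zero i)

lemma polyResidue_eq_zero_of_mem_smul_top {p : A[X]}
    (hp : p ∈ maximalIdeal A • (⊤ : Submodule A A[X])) : polyResidue A p = 0 := by
  refine Submodule.smul_induction_on hp (fun a ha q _ => ?_) fun x y hx hy => ?_
  · rw [smul_eq_C_mul, map_mul, coe_mapRingHom, map_C, (residue_eq_zero_iff a).2 ha, C_0, zero_mul]
  · rw [map_add, hx, hy, add_zero]

lemma mem_smul_top_of_monicLocResidue_eq_zero {x : MonicLoc A} (hx : monicLocResidue A x = 0) :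
    x ∈ maximalIdeal A • (⊤ : Submodule A (MonicLoc A)) := by
  obtain ⟨a, g, hg, h⟩ := monicLoc_surj x
  obtain ⟨y, hy⟩ := (Monic.isUnit_monicLoc hg).exists_right_inv
  have ha : polyResidue A a = 0 := by
    have := congrArg (monicLocResidue A) h
    rw [map_mul, hx, zero_mul, monicLocResidue_algebraMap] at this
    exact (FaithfulSMul.algebraMap_eq_zero_iff _ _).1 this.symm
  let f : A[X] →ₗ[A] MonicLoc A := (LinearMap.toSpanSingleton A[X] (MonicLoc A) y).restrictScalars A
  have hf : f a = x := by
    change a • y = x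
    rw [Algebra.smul_def, ← h, mul_assoc, hy, mul_one]
  rw [← hf]
  have := Submodule.mem_map_of_mem (f := f) (mem_smul_top_of_polyResidue_eq_zero ha)
  rw [Submodule.map_smul''] at this
  exact Submodule.smul_mono le_rfl le_top this

lemma pi_mem_smul_top {R Y ι : Type} [CommRing R] [AddCommGroup Y] [Module R Y] [Fintype ι]
    [DecidableEq ι] {I : Ideal R} {y : ι → Y}
    (hy : ∀ i, y i ∈ I • (⊤ : Submodule R Y)) : y ∈ I • (⊤ : Submodule R (ι → Y)) := by
  rw [← Finset.univ_sum_single y]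
  refine Submodule.sum_mem _ fun i _ => ?_
  have := Submodule.mem_map_of_mem (f := LinearMap.single R (fun _ : ι => Y) i) (hy i)
  rw [Submodule.map_smul''] at this
  exact Submodule.smul_mono le_rfl le_top this

lemma apply_mem_smul_top {R Y ι : Type} [CommRing R] [AddCommGroup Y] [Module R Y] {I : Ideal R}
    {y : ι → Y} (hy : y ∈ I • (⊤ : Submodule R (ι → Y))) (i : ι) :
    y i ∈ I • (⊤ : Submodule R Y) := by
  have := Submodule.mem_map_of_mem (f := LinearMap.proj (R := R) (φ := fun _ : ι => Y) i) hy
  rw [Submodule.map_smul''] at this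
  exact Submodule.smul_mono le_rfl le_top this

lemma degreeLT_fg (R : Type) [CommRing R] (d : ℕ) : (degreeLT R d).FG := by
  have : Module.Finite R (degreeLT R d) := Module.Finite.equiv (degreeLTEquiv R d).symm
  exact Module.Finite.iff_fg.1 this

lemma isUnit_of_dvd_monic {δ g : A[X]} (hδ : IsUnit (polyResidue A δ)) (hg : g.Monic)
    (h : δ ∣ g) : IsUnit δ := by
  have key : (Ideal.span {δ}).restrictScalars A = ⊤ := by
    refine eq_top_of_sup_maximalIdeal_smul (degreeLT_fg A g.natDegree) ?_ ?_
    · refine eq_top_iff.2 fun p _ => ?_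
      rw [← modByMonic_add_div p g, add_comm]
      refine Submodule.add_mem_sup ?_ ?_
      · exact Ideal.mem_span_singleton.2 (h.mul_right _)
      · rw [mem_degreeLT, ← degree_eq_natDegree hg.ne_zero]
        exact degree_modByMonic_lt _ hg
    · obtain ⟨c, hc⟩ := hδ.exists_right_inv
      obtain ⟨c, rfl⟩ := polyResidue_surjective c
      refine eq_top_iff.2 fun p _ => ?_
      have hp : p = δ * (c * p) + (1 - δ * c) * p := by ring
      rw [hp]
      refine Submodule.add_mem_sup ?_ (mem_smul_top_of_polyResidue_eq_zero ?_)
      · exact Ideal.mem_span_singleton.2 (Dvd.intro _ rfl)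
      · rw [map_mul, map_sub, map_mul, hc, map_one, sub_self, zero_mul]
  rw [← Ideal.span_singleton_eq_top]
  exact (Submodule.restrictScalars_eq_top_iff _ _ _).1 key

lemma exists_isUnit_monicLocResidue_eq {z : ResidueFunctionField A} (hz : z ≠ 0) :
    ∃ t : MonicLoc A, IsUnit t ∧ monicLocResidue A t = z := by
  have poly (a : (ResidueField A)[X]) (ha : a ≠ 0) :
      ∃ t : MonicLoc A, IsUnit t ∧ monicLocResidue A t = algebraMap _ _ a := by
    have hl : a.leadingCoeff ≠ 0 := leadingCoeff_ne_zero.2 ha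
    obtain ⟨c, hc⟩ := residue_surjective (R := A) a.leadingCoeff
    have hcu : IsUnit c := by
      rw [← residue_ne_zero_iff_isUnit, hc]; exact hl
    have hlift : a * C a.leadingCoeff⁻¹ ∈ lifts (residue A) := by
      rw [mem_lifts]
      obtain ⟨q, hq⟩ := polyResidue_surjective (A := A) (a * C a.leadingCoeff⁻¹)
      exact ⟨q, hq⟩
    obtain ⟨g, hg, -, hgm⟩ := lifts_and_natDegree_eq_and_monic hlift
      (monic_mul_leadingCoeff_inv ha)
    refine ⟨algebraMap _ _ (C c * g), ?_, ?_⟩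
    · rw [map_mul]
      exact ((isUnit_C.2 hcu).map _).mul (Monic.isUnit_monicLoc hgm)
    · rw [monicLocResidue_algebraMap, map_mul, coe_mapRingHom, map_C, hg, hc, mul_comm, mul_assoc,
        ← C_mul, inv_mul_cancel₀ hl, C_1, mul_one]
  obtain ⟨a, b, hb, rfl⟩ := IsFractionRing.div_surjective (A := (ResidueField A)[X]) z
  have ha : a ≠ 0 := by rintro rfl; simp at hz
  obtain ⟨t, ht, hta⟩ := poly a ha
  obtain ⟨s, hs, hsb⟩ := poly b (nonZeroDivisors.ne_zero hb)
  obtain ⟨s', hs'⟩ := hs.exists_right_inv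
  refine ⟨t * s', ht.mul (IsUnit.of_mul_eq_one s (by rw [mul_comm, hs'])), ?_⟩
  have h1 := congrArg (monicLocResidue A) hs'
  rw [map_mul, hsb, map_one] at h1
  rw [map_mul, hta, eq_inv_of_mul_eq_one_right h1, div_eq_mul_inv]

variable {ι : Type} [Fintype ι] [DecidableEq ι]

lemma exists_invertible_map_monicLocResidue (h : Matrix ι ι (ResidueFunctionField A))
    (hh : h.det ≠ 0) :
    ∃ H H' : Matrix ι ι (MonicLoc A), H * H' = 1 ∧ H.map (monicLocResidue A) = h := by
  refine Matrix.diagonal_transvection_induction_of_det_ne_zero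
    (fun h => ∃ H H' : Matrix ι ι (MonicLoc A), H * H' = 1 ∧ H.map (monicLocResidue A) = h) h hh
    (fun D hD => ?_) (fun t => ?_) ?_
  · rw [det_diagonal, Finset.prod_ne_zero_iff] at hD
    choose t ht htD using fun i => exists_isUnit_monicLocResidue_eq (hD i (Finset.mem_univ i))
    choose t' ht' using fun i => (ht i).exists_right_inv
    refine ⟨diagonal t, diagonal t', ?_, ?_⟩
    · rw [diagonal_mul_diagonal, ← diagonal_one]; congr 1; ext i; exact ht' i
    · rw [diagonal_map (map_zero _)]; congr 1; ext i; exact htD i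
  · obtain ⟨c, hc⟩ : ∃ c, monicLocResidue A c = t.c := by
      by_cases h0 : t.c = 0
      · exact ⟨0, by rw [h0, map_zero]⟩
      · obtain ⟨c, -, hc⟩ := exists_isUnit_monicLocResidue_eq h0
        exact ⟨c, hc⟩
    refine ⟨transvection t.i t.j c, transvection t.i t.j (-c), ?_, ?_⟩
    · rw [transvection_mul_transvection_same _ _ t.hij, add_neg_cancel, transvection_zero]
    · ext i j
      simp only [TransvectionStruct.toMatrix, transvection, map_apply, Matrix.add_apply, map_add,
        ← hc, single_apply, one_apply]
      congr 1 <;> split_ifs <;> simp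
  · rintro _ _ - - ⟨H, H', hH, rfl⟩ ⟨G, G', hG, rfl⟩
    refine ⟨H * G, G' * H', ?_, by rw [Matrix.map_mul]⟩
    rw [Matrix.mul_assoc, ← Matrix.mul_assoc G, hG, Matrix.one_mul, hH]

end LocalHorrocks

section MatrixFactorization

open Matrix Polynomial IsLocalRing

variable {A : Type} [CommRing A] {ι : Type}

/-- The inclusion of polynomial vectors. -/
def polyVec (A : Type) [CommRing A] (ι : Type) : (ι → A[X]) →ₗ[A] (ι → MonicLoc A) :=
  ((Algebra.linearMap A[X] (MonicLoc A)).restrictScalars A).compLeft ι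

lemma polyVec_apply (p : ι → A[X]) (i : ι) : polyVec A ι p i = algebraMap _ _ (p i) := rfl

variable [Fintype ι]

lemma map_mulVec_polyVec (W : Matrix ι ι A[X]) (p : ι → A[X]) :
    W.map (algebraMap A[X] (MonicLoc A)) *ᵥ polyVec A ι p = polyVec A ι (W *ᵥ p) := by
  ext i
  exact ((algebraMap A[X] (MonicLoc A)).map_mulVec W p i).symm

/-- Multiplication by `u`, as an `A`-linear map. -/
def mulVecMap (u : Matrix ι ι (MonicLoc A)) : (ι → MonicLoc A) →ₗ[A] (ι → MonicLoc A) :=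
  (mulVecLin u).restrictScalars A

lemma exists_monic_mul_eq_map (u : Matrix ι ι (MonicLoc A)) :
    ∃ g : A[X], g.Monic ∧ ∃ w : Matrix ι ι A[X],
      algebraMap A[X] (MonicLoc A) g • u = w.map (algebraMap _ _) := by
  obtain ⟨⟨g, hg⟩, h⟩ := IsLocalization.exist_integer_multiples_of_finite (monics A)
    fun x : ι × ι => u x.1 x.2
  choose w hw using h
  refine ⟨g, hg, Matrix.of fun i j => w (i, j), ?_⟩
  ext i j
  rw [Matrix.smul_apply, map_apply, of_apply, hw, smul_eq_mul, Algebra.smul_def]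

variable [IsLocalRing A] [DecidableEq ι]

/-- Polynomial vectors and `u` times the vectors vanishing at infinity span everything. -/
lemma range_polyVec_sup_map_eq_top (u u' : Matrix ι ι (MonicLoc A)) (huu' : u * u' = 1)
    (W : Matrix ι ι A[X])
    (hW : u.map (monicLocResidue A) = (W.map (polyResidue A)).map (algebraMap _ _)) :
    LinearMap.range (polyVec A ι) ⊔
      (Submodule.pi Set.univ fun _ : ι => vanishingAtInfty A).map (mulVecMap u) = ⊤ := by
  obtain ⟨g, hg, w, hw⟩ := exists_monic_mul_eq_map u
  set P := polyVec A ι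
  set N' := (Submodule.pi Set.univ fun _ : ι => vanishingAtInfty A).map (mulVecMap u)
  have decomp (y : ι → MonicLoc A) : ∃ p, ∃ z ∈ N', y = u *ᵥ P p + z := by
    choose p j hj h using fun i => exists_add_vanishingAtInfty ((u' *ᵥ y) i)
    refine ⟨p, u *ᵥ j, Submodule.mem_map_of_mem (by simpa [Submodule.mem_pi] using hj), ?_⟩
    have : u' *ᵥ y = P p + j := funext h
    rw [← mulVec_add, ← this, mulVec_mulVec, huu', one_mulVec]
  let F := (Submodule.pi Set.univ fun _ : ι => degreeLT A g.natDegree).map (mulVecMap u ∘ₗ P)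
  refine eq_top_of_sup_maximalIdeal_smul (N' := F)
    ((Submodule.fg_pi fun _ => degreeLT_fg A _).map _) ?_ ?_ <;>
  refine eq_top_iff.2 fun y _ => ?_ <;>
  obtain ⟨p, z, hz, rfl⟩ := decomp y
  · have hp : p = (fun i => g * (p i /ₘ g)) + fun i => p i %ₘ g := by
      ext1 i; rw [Pi.add_apply, add_comm, modByMonic_add_div]
    rw [hp, map_add, mulVec_add, add_right_comm]
    refine Submodule.add_mem_sup (Submodule.add_mem_sup ⟨w *ᵥ fun i => p i /ₘ g, ?_⟩ hz) ?_
    · rw [← map_mulVec_polyVec, ← hw, smul_mulVec, ← mulVec_smul]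
      congr 1
      ext i
      simp [P, polyVec_apply]
    · refine ⟨_, ?_, rfl⟩
      simp only [Submodule.mem_pi, SetLike.mem_coe, mem_degreeLT]
      intro i _
      rw [← degree_eq_natDegree hg.ne_zero]
      exact degree_modByMonic_lt _ hg
  · have hp : u *ᵥ P p + z = (P (W *ᵥ p) + z) + (u - W.map (algebraMap _ _)) *ᵥ P p := by
      rw [sub_mulVec, map_mulVec_polyVec]; abel
    rw [hp]
    refine Submodule.add_mem_sup (Submodule.add_mem_sup ⟨_, rfl⟩ hz) (pi_mem_smul_top fun i => ?_)
    refine mem_smul_top_of_monicLocResidue_eq_zero ?_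
    rw [RingHom.map_mulVec]
    have : (u - W.map (algebraMap A[X] (MonicLoc A))).map (monicLocResidue A) = 0 := by
      ext i j
      have := congrFun (congrFun hW i) j
      simp only [map_apply] at this
      simp [monicLocResidue_algebraMap, this]
    rw [this, zero_mulVec, Pi.zero_apply]

lemma exists_mul_one_sub_eq_map (u u' : Matrix ι ι (MonicLoc A)) (huu' : u * u' = 1)
    (W : Matrix ι ι A[X])
    (hW : u.map (monicLocResidue A) = (W.map (polyResidue A)).map (algebraMap _ _)) :
    ∃ (v : Matrix ι ι A[X]) (j : Matrix ι ι (MonicLoc A)), (∀ i k, j i k ∈ vanishingAtInfty A) ∧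
      v.map (polyResidue A) = W.map (polyResidue A) ∧
      u * (1 - j) = v.map (algebraMap _ _) := by
  have htop := range_polyVec_sup_map_eq_top u u' huu' W hW
  have col (k : ι) : ∃ p : ι → A[X], (∀ i, polyResidue A (p i) = 0) ∧
      ∃ j : ι → MonicLoc A, (∀ i, j i ∈ vanishingAtInfty A) ∧
        (u - W.map (algebraMap _ _)).col k = polyVec A ι p + u *ᵥ j := by
    have hk : (u - W.map (algebraMap _ _)).col k ∈
        maximalIdeal A • (⊤ : Submodule A (ι → MonicLoc A)) := by
      refine pi_mem_smul_top fun i => mem_smul_top_of_monicLocResidue_eq_zero ?_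
      have := congrFun (congrFun hW i) k
      simp only [map_apply] at this
      simp [monicLocResidue_algebraMap, this]
    rw [← htop, Submodule.smul_sup, LinearMap.range_eq_map, ← Submodule.map_smul'',
      ← Submodule.map_smul''] at hk
    obtain ⟨_, ⟨p, hp, rfl⟩, _, ⟨j, hj, rfl⟩, h⟩ := Submodule.mem_sup.1 hk
    refine ⟨p, fun i => polyResidue_eq_zero_of_mem_smul_top (apply_mem_smul_top hp i), j,
      fun i => ?_, h.symm⟩
    exact (Submodule.mem_pi.1 (Submodule.smul_le_right hj)) i trivial
  choose p hp j hj h using col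
  refine ⟨W + Matrix.of fun i k => p k i, Matrix.of fun i k => j k i, fun i k => hj k i, ?_, ?_⟩
  · ext1 i k
    have := hp k i
    rw [coe_mapRingHom] at this
    simp [this]
  · ext i k
    have h1 := congrFun (h k) i
    have h2 : (u * Matrix.of fun i k => j k i) i k = (u *ᵥ j k) i := rfl
    rw [Matrix.mul_sub, Matrix.mul_one, Matrix.sub_apply, h2, map_apply, Matrix.add_apply, map_add,
      of_apply]
    simp only [col_apply, Matrix.sub_apply, map_apply, Pi.add_apply, polyVec_apply] at h1
    linear_combination h1

lemma exists_factorization (u u' : Matrix ι ι (MonicLoc A)) (huu' : u * u' = 1)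
    (W : Matrix ι ι A[X]) (hWu : IsUnit (W.map (polyResidue A)).det)
    (hW : u.map (monicLocResidue A) = (W.map (polyResidue A)).map (algebraMap _ _)) :
    ∃ (v v' : Matrix ι ι A[X]) (X Y : Matrix ι ι (MonicLoc A)), v * v' = 1 ∧ X * Y = 1 ∧
      (∀ i k, X i k ∈ regularAtInfty A) ∧ (∀ i k, Y i k ∈ regularAtInfty A) ∧
      u * X = v.map (algebraMap _ _) := by
  obtain ⟨v, j, hj, hvW, huv⟩ := exists_mul_one_sub_eq_map u u' huu' W hW
  obtain ⟨Y, hY, hjY⟩ := exists_inverse_one_sub j hj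
  have hinv : v.map (algebraMap _ _) * (Y * u') = 1 := by
    rw [← huv, Matrix.mul_assoc, ← Matrix.mul_assoc _ Y, hjY, Matrix.one_mul, huu']
  have hdet : IsUnit v.det := by
    obtain ⟨a, g, hg, h⟩ := monicLoc_surj (Y * u').det
    refine isUnit_of_dvd_monic (g := g) ?_ hg ⟨a, monicLoc_injective A ?_⟩
    · rwa [RingHom.map_det, RingHom.mapMatrix_apply, hvW]
    · have h1 := congrArg Matrix.det hinv
      rw [det_mul, det_one, ← RingHom.mapMatrix_apply, ← RingHom.map_det] at h1
      rw [map_mul, ← h, ← mul_assoc, h1, one_mul]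
  refine ⟨v, v⁻¹, 1 - j, Y, Matrix.mul_nonsing_inv _ hdet, hjY, fun i k => ?_, hY, huv⟩
  rw [Matrix.sub_apply]
  refine (regularAtInfty A).sub_mem ?_ (regularAtInfty_of_vanishingAtInfty (hj i k))
  rw [one_apply]
  split_ifs
  exacts [(regularAtInfty A).one_mem, (regularAtInfty A).zero_mem]

end MatrixFactorization

section LocalConjugation

open Matrix Polynomial IsLocalRing

lemma mul_apply_mem {R l m n : Type} [CommRing R] [Fintype m] {S : Subring R} {M : Matrix l m R}
    {N : Matrix m n R} (hM : ∀ i k, M i k ∈ S) (hN : ∀ i k, N i k ∈ S) (i : l) (k : n) :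
    (M * N) i k ∈ S := by
  rw [mul_apply]
  exact S.sum_mem fun j _ => S.mul_mem (hM i j) (hN j k)

variable {A : Type} [CommRing A] [IsLocalRing A] {ι : Type} [Fintype ι]

/-- A splitting over `MonicLoc A` can be changed so as to lift a given splitting over
the residue field. -/
lemma exists_splitting_lift {r s : ℕ} (a : Matrix ι (Fin r) (MonicLoc A))
    (b : Matrix (Fin r) ι (MonicLoc A)) (hba : b * a = 1)
    (a₂ : Matrix ι (Fin s) (ResidueField A)[X]) (b₂ : Matrix (Fin s) ι (ResidueField A)[X])
    (hba₂ : b₂ * a₂ = 1)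
    (h : (a * b).map (monicLocResidue A) = (a₂ * b₂).map (algebraMap _ _)) :
    ∃ (a₃ : Matrix ι (Fin s) (MonicLoc A)) (b₃ : Matrix (Fin s) ι (MonicLoc A)),
      a₃ * b₃ = a * b ∧ b₃ * a₃ = 1 ∧ a₃.map (monicLocResidue A) = a₂.map (algebraMap _ _) := by
  let ρ := monicLocResidue A
  let κ := algebraMap (ResidueField A)[X] (ResidueFunctionField A)
  have hba' : b.map ρ * a.map ρ = 1 := by
    rw [← Matrix.map_mul, hba, Matrix.map_one _ (map_zero _) (map_one _)]
  have hba₂' : b₂.map κ * a₂.map κ = 1 := by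
    rw [← Matrix.map_mul, hba₂, Matrix.map_one _ (map_zero _) (map_one _)]
  have hab : a.map ρ * b.map ρ = a₂.map κ * b₂.map κ := by
    rw [← Matrix.map_mul, ← Matrix.map_mul]; exact h
  have h1 : (b.map ρ * a₂.map κ) * (b₂.map κ * a.map ρ) = 1 := by
    rw [Matrix.mul_assoc, ← Matrix.mul_assoc (a₂.map κ), ← hab, Matrix.mul_assoc, hba',
      Matrix.mul_one, hba']
  have h2 : (b₂.map κ * a.map ρ) * (b.map ρ * a₂.map κ) = 1 := by
    rw [Matrix.mul_assoc, ← Matrix.mul_assoc (a.map ρ), hab, Matrix.mul_assoc, hba₂',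
      Matrix.mul_one, hba₂']
  obtain rfl : s = r := by
    simpa using card_eq_of_linearEquiv (ResidueFunctionField A) (Matrix.toLin'OfInv h2 h1)
  obtain ⟨H, H', hH, hHρ⟩ := exists_invertible_map_monicLocResidue (A := A)
    (b.map ρ * a₂.map κ) (fun h0 => by
      have := congrArg Matrix.det h1
      rw [det_mul, h0, zero_mul, det_one] at this
      exact zero_ne_one this)
  refine ⟨a * H, H' * b, ?_, ?_, ?_⟩
  · rw [Matrix.mul_assoc, ← Matrix.mul_assoc H, hH, Matrix.one_mul]
  · rw [Matrix.mul_assoc, ← Matrix.mul_assoc b, hba, Matrix.one_mul, mul_eq_one_comm.1 hH]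
  · rw [Matrix.map_mul, hHρ, ← Matrix.mul_assoc]
    change a.map ρ * b.map ρ * a₂.map κ = a₂.map κ
    rw [hab, Matrix.mul_assoc, hba₂', Matrix.mul_one]

variable [DecidableEq ι]

/-- Horrocks' theorem for idempotent matrices over a local ring. -/
theorem exists_conj_const_of_splitsFreely_monicLoc (e : Matrix ι ι A[X])
    (he : SplitsFreely (e.map (algebraMap A[X] (MonicLoc A))))
    (he' : SplitsFreely ((1 - e).map (algebraMap A[X] (MonicLoc A)))) :
    ∃ (v v' : Matrix ι ι A[X]) (c : Matrix ι ι A),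
      v * v' = 1 ∧ e * v = v * c.map (C : A →+* A[X]) := by
  have hidem : e * e = e := by
    obtain ⟨r, a, b, hab, hba⟩ := he
    apply Matrix.map_injective (monicLoc_injective A)
    change (e * e).map (algebraMap A[X] (MonicLoc A)) = e.map (algebraMap A[X] (MonicLoc A))
    rw [Matrix.map_mul, ← hab, Matrix.mul_assoc, ← Matrix.mul_assoc b, hba, Matrix.one_mul]
  have hres (f : Matrix ι ι A[X]) :
      (f.map (algebraMap A[X] (MonicLoc A))).map (monicLocResidue A) =
        (f.map (polyResidue A)).map (algebraMap _ _) := by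
    ext i j; simp only [map_apply, monicLocResidue_algebraMap]
  have hsplit (f : Matrix ι ι A[X]) (hf : f * f = f) : SplitsFreely (f.map (polyResidue A)) :=
    (hasFreeIdempotents_of_isPrincipalIdealRing _).splitsFreely (by rw [← Matrix.map_mul, hf])
  obtain ⟨r, a₂, b₂, hab₂, hba₂⟩ := hsplit e hidem
  obtain ⟨r', a₂', b₂', hab₂', hba₂'⟩ := hsplit (1 - e) (one_sub_mul_self hidem)
  have hsum₂ : a₂ * b₂ + a₂' * b₂' = 1 := by
    rw [hab₂, hab₂', ← Matrix.map_add _ (map_add _), add_sub_cancel,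
      Matrix.map_one _ (map_zero _) (map_one _)]
  obtain ⟨φ⟩ := exists_equiv_of_splitting hsum₂ hba₂ hba₂'
  obtain ⟨_, a, b, hab, hba⟩ := he
  obtain ⟨a, b, hab₃, hba, ha⟩ := exists_splitting_lift a b hba a₂ b₂ hba₂
    (by rw [hab, hab₂, hres])
  rw [hab] at hab₃
  obtain ⟨_, a', b', hab', hba'⟩ := he'
  obtain ⟨a', b', hab₃', hba', ha'⟩ := exists_splitting_lift a' b' hba' a₂' b₂' hba₂'
    (by rw [hab', hab₂', hres])
  rw [hab'] at hab₃'
  have hsum : a * b + a' * b' = 1 := by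
    rw [hab₃, hab₃', ← Matrix.map_add _ (map_add _), add_sub_cancel,
      Matrix.map_one _ (map_zero _) (map_one _)]
  choose lift hlift using polyResidue_surjective (A := A)
  have hWmap : ((joinCols φ a₂ a₂').map lift).map (polyResidue A) = joinCols φ a₂ a₂' := by
    ext1 i j; exact hlift _
  obtain ⟨v, v', X, Y, hv, hXY, hX, hY, huX⟩ := exists_factorization (joinCols φ a a')
    (joinRows φ b b') (joinCols_mul_joinRows φ hsum) ((joinCols φ a₂ a₂').map lift)
    (by
      rw [hWmap]
      have := congrArg Matrix.det (joinCols_mul_joinRows φ hsum₂)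
      rw [det_mul, det_one] at this
      exact IsUnit.of_mul_eq_one _ this)
    (by rw [hWmap, joinCols_map, joinCols_map, ha, ha'])
  set u := joinCols φ a a'
  set d := diagIdem (MonicLoc A) fun i => (φ.symm i).isLeft
  have heu : e.map (algebraMap _ _) * u = u * d := by
    rw [← hab₃]; exact mul_joinCols φ hsum hba hba'
  have huv : u = v.map (algebraMap _ _) * Y := by
    rw [← huX, Matrix.mul_assoc, hXY, Matrix.mul_one]
  have hconj : (v' * e * v).map (algebraMap A[X] (MonicLoc A)) = Y * d * X := by
    have h1 : v'.map (algebraMap A[X] (MonicLoc A)) * u = Y := by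
      rw [huv, ← Matrix.mul_assoc, ← Matrix.map_mul, mul_eq_one_comm.1 hv,
        Matrix.map_one _ (map_zero _) (map_one _), Matrix.one_mul]
    rw [Matrix.map_mul, Matrix.map_mul, ← huX, Matrix.mul_assoc, ← Matrix.mul_assoc _ u X, heu,
      Matrix.mul_assoc, ← Matrix.mul_assoc _ u, h1, Matrix.mul_assoc]
  refine ⟨v, v', (v' * e * v).map fun p => p.coeff 0, hv, ?_⟩
  have hc : ((v' * e * v).map fun p => p.coeff 0).map (C : A →+* A[X]) = v' * e * v := by
    ext1 i k
    have : algebraMap A[X] (MonicLoc A) ((v' * e * v) i k) = (Y * d * X) i k := by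
      rw [← hconj]; rfl
    refine (eq_C_of_mem_regularAtInfty (p := (v' * e * v) i k) ?_).symm
    rw [this]
    refine mul_apply_mem (mul_apply_mem hY fun i k => ?_) hX i k
    simp only [d, diagIdem, diagonal_apply]
    split_ifs
    exacts [(regularAtInfty A).one_mem, (regularAtInfty A).zero_mem, (regularAtInfty A).zero_mem]
  rw [hc, ← Matrix.mul_assoc, ← Matrix.mul_assoc, hv, Matrix.one_mul]

end LocalConjugation

section Gluing

open Matrix

variable {E : Type} [CommRing E]

/-- Elements `g` that, for every `N`, factor as a unit of `S₀` times a unit of `S₁` congruent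
to `1` modulo `x ^ N`; `g'` is the inverse of `g`. -/
def FactorsNearOne {𝓜 : Type} [Ring 𝓜] [Algebra E 𝓜] (x : E) (S₀ S₁ : Subring 𝓜)
    (g g' : 𝓜) : Prop :=
  ∀ N : ℕ, ∃ α ∈ S₀, ∃ α' ∈ S₀, α * α' = 1 ∧ α' * α = 1 ∧
    (∃ c ∈ S₁, α' * g = 1 + x ^ N • c) ∧ ∃ c ∈ S₁, g' * α = 1 + x ^ N • c

section Ring

variable {𝓜 : Type} [Ring 𝓜] [Algebra E 𝓜] {x : E} {S₀ S₁ : Subring 𝓜}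

lemma factorsNearOne_of_mem {g g' : 𝓜} (hg : g ∈ S₀) (hg' : g' ∈ S₀) (h : g * g' = 1)
    (h' : g' * g = 1) : FactorsNearOne x S₀ S₁ g g' := fun _ =>
  ⟨g, hg, g', hg', h, h', ⟨0, S₁.zero_mem, by simp [h']⟩, 0, S₁.zero_mem, by simp [h']⟩

lemma FactorsNearOne.mul (hx : ∀ y ∈ S₁, x • y ∈ S₁) (h2 : ∀ y : 𝓜, ∃ k : ℕ, x ^ k • y ∈ S₁)
    {g g' h h' : 𝓜} (hg : FactorsNearOne x S₀ S₁ g g') (hh : FactorsNearOne x S₀ S₁ h h') :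
    FactorsNearOne x S₀ S₁ (g * h) (h' * g') := by
  intro N
  have hxN (N : ℕ) (y : 𝓜) (hy : y ∈ S₁) : x ^ N • y ∈ S₁ := by
    induction N with
    | zero => simpa using hy
    | succ N ih => rw [pow_succ', mul_smul]; exact hx _ ih
  obtain ⟨β, hβ, β', hβ', hββ, hββ', ⟨c, hc, hβh⟩, c', hc', hβh'⟩ := hh N
  obtain ⟨k, hk⟩ := h2 β
  obtain ⟨l, hl⟩ := h2 β'
  obtain ⟨α, hα, α', hα', hαα, hαα', ⟨d, hd, hαg⟩, d', hd', hαg'⟩ := hg (N + (k + l))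
  refine ⟨α * β, S₀.mul_mem hα hβ, β' * α', S₀.mul_mem hβ' hα', ?_, ?_, ?_, ?_⟩
  · rw [mul_assoc, ← mul_assoc β, hββ, one_mul, hαα]
  · rw [mul_assoc, ← mul_assoc α', hαα', one_mul, hββ']
  · refine ⟨c + (x ^ l • β') * d * (x ^ k • β) * (1 + x ^ N • c), S₁.add_mem hc
      (S₁.mul_mem (S₁.mul_mem (S₁.mul_mem hl hd) hk) (S₁.add_mem S₁.one_mem (hxN _ _ hc))), ?_⟩
    have hh : h = β * (1 + x ^ N • c) := by rw [← hβh, ← mul_assoc, hββ, one_mul]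
    calc β' * α' * (g * h) = β' * (α' * g) * h := by simp only [mul_assoc]
      _ = β' * h + (x ^ (N + (k + l)) • (β' * d * h)) := by
        rw [hαg, mul_add, add_mul, mul_one, mul_smul_comm, smul_mul_assoc]
      _ = _ := by
        rw [hβh, smul_add, add_assoc, hh]
        simp only [smul_mul_assoc, mul_smul_comm, smul_smul, mul_assoc]
        congr 4
        ring
  · refine ⟨c' + (1 + x ^ N • c') * (x ^ l • β') * d' * (x ^ k • β), S₁.add_mem hc'
      (S₁.mul_mem (S₁.mul_mem (S₁.mul_mem (S₁.add_mem S₁.one_mem (hxN _ _ hc')) hl) hd') hk), ?_⟩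
    have hh : h' = (1 + x ^ N • c') * β' := by rw [← hβh', mul_assoc, hββ, mul_one]
    calc h' * g' * (α * β) = h' * (g' * α) * β := by simp only [mul_assoc]
      _ = h' * β + (x ^ (N + (k + l)) • (h' * d' * β)) := by
        rw [hαg', mul_add, add_mul, mul_one, mul_smul_comm, smul_mul_assoc]
      _ = _ := by
        rw [hβh', smul_add, add_assoc, hh]
        simp only [smul_mul_assoc, mul_smul_comm, smul_smul, mul_assoc]
        congr 4
        ring

end Ring

variable {ι : Type} [Fintype ι] [DecidableEq ι]

/-- The matrices over `ι` with entries in a subring. -/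
abbrev matrixSubring (S : Subring E) (ι : Type) [Fintype ι] [DecidableEq ι] :
    Subring (Matrix ι ι E) := S.matrix

lemma fromBlocks_mem_matrixSubring {S : Subring E} {a b c d : Matrix ι ι E}
    (ha : a ∈ matrixSubring S ι) (hb : b ∈ matrixSubring S ι) (hc : c ∈ matrixSubring S ι)
    (hd : d ∈ matrixSubring S ι) : fromBlocks a b c d ∈ matrixSubring S (ι ⊕ ι) := by
  rintro (i | i) (j | j)
  exacts [ha i j, hb i j, hc i j, hd i j]

variable {S₀ S₁ : Subring E} {x : E}

lemma factorsNearOne_fromBlocks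
    (h1 : ∀ y (N : ℕ), ∃ b ∈ S₀, ∃ c ∈ S₁, y = b + x ^ N * c) (X : Matrix ι ι E) :
    FactorsNearOne x (matrixSubring S₀ (ι ⊕ ι)) (matrixSubring S₁ (ι ⊕ ι))
      (fromBlocks 1 X 0 1) (fromBlocks 1 (-X) 0 1) := by
  intro N
  choose b hb c hc h using fun i j => h1 (X i j) N
  have hX : X = Matrix.of b + x ^ N • Matrix.of c := by ext i j; exact h i j
  have hb' : Matrix.of b ∈ matrixSubring S₀ ι := hb
  have hc' : Matrix.of c ∈ matrixSubring S₁ ι := hc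
  refine ⟨fromBlocks 1 (Matrix.of b) 0 1, ?_, fromBlocks 1 (-Matrix.of b) 0 1, ?_, ?_, ?_,
    ⟨fromBlocks 0 (Matrix.of c) 0 0, ?_, ?_⟩, fromBlocks 0 (-Matrix.of c) 0 0, ?_, ?_⟩
  · exact fromBlocks_mem_matrixSubring (one_mem _) hb' (zero_mem _) (one_mem _)
  · exact fromBlocks_mem_matrixSubring (one_mem _) (neg_mem hb') (zero_mem _) (one_mem _)
  · simp [fromBlocks_multiply]
  · simp [fromBlocks_multiply]
  · exact fromBlocks_mem_matrixSubring (zero_mem _) hc' (zero_mem _) (zero_mem _)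
  · simp [fromBlocks_multiply, hX, ← fromBlocks_one, fromBlocks_smul, fromBlocks_add]
  · exact fromBlocks_mem_matrixSubring (zero_mem _) (neg_mem hc') (zero_mem _) (zero_mem _)
  · simp [fromBlocks_multiply, hX, ← fromBlocks_one, fromBlocks_smul, fromBlocks_add]

/-- If `E` is covered by `S₀` and `S₁` in the sense that they generate it `x`-adically, every
invertible matrix over `E` factors stably into invertible matrices over `S₀` and `S₁`. -/
theorem exists_factorization_of_gluing (hx : x ∈ S₁)
    (h1 : ∀ y (N : ℕ), ∃ b ∈ S₀, ∃ c ∈ S₁, y = b + x ^ N * c)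
    (h2 : ∀ y, ∃ k : ℕ, x ^ k * y ∈ S₁) {u u' : Matrix ι ι E} (huu' : u * u' = 1) :
    ∃ α ∈ matrixSubring S₀ (ι ⊕ ι), ∃ α' ∈ matrixSubring S₀ (ι ⊕ ι),
      ∃ β ∈ matrixSubring S₁ (ι ⊕ ι), ∃ β' ∈ matrixSubring S₁ (ι ⊕ ι),
        α * α' = 1 ∧ β * β' = 1 ∧ fromBlocks u 0 0 u' = α * β := by
  have hu'u : u' * u = 1 := mul_eq_one_comm.1 huu'
  let J : Matrix (ι ⊕ ι) (ι ⊕ ι) E := fromBlocks 0 (-1) 1 0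
  let J' : Matrix (ι ⊕ ι) (ι ⊕ ι) E := fromBlocks 0 1 (-1) 0
  have hpow (k : ℕ) : x ^ k ∈ S₁ := S₁.pow_mem hx k
  have hx' : ∀ y ∈ matrixSubring S₁ (ι ⊕ ι), x • y ∈ matrixSubring S₁ (ι ⊕ ι) :=
    fun y hy i j => S₁.mul_mem hx (hy i j)
  have h2' : ∀ y : Matrix (ι ⊕ ι) (ι ⊕ ι) E, ∃ k : ℕ, x ^ k • y ∈ matrixSubring S₁ (ι ⊕ ι) := by
    intro y
    choose k hk using fun p : (ι ⊕ ι) × (ι ⊕ ι) => h2 (y p.1 p.2)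
    refine ⟨∑ p, k p, fun i j => ?_⟩
    rw [← Finset.add_sum_erase _ _ (Finset.mem_univ (i, j)), Matrix.smul_apply, smul_eq_mul,
      pow_add, mul_comm (x ^ k (i, j)), mul_assoc]
    exact S₁.mul_mem (hpow _) (hk (i, j))
  have hJJ : J * J' = 1 := by simp [J, J', fromBlocks_multiply]
  have hJJ' : J' * J = 1 := mul_eq_one_comm.1 hJJ
  have hJmem : J ∈ matrixSubring S₀ (ι ⊕ ι) :=
    fromBlocks_mem_matrixSubring (zero_mem _) (neg_mem (one_mem _)) (one_mem _) (zero_mem _)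
  have hJmem' : J' ∈ matrixSubring S₀ (ι ⊕ ι) :=
    fromBlocks_mem_matrixSubring (zero_mem _) (one_mem _) (neg_mem (one_mem _)) (zero_mem _)
  have hJ := factorsNearOne_of_mem (x := x) (S₁ := matrixSubring S₁ (ι ⊕ ι))
    hJmem hJmem' hJJ hJJ'
  have hJ' := factorsNearOne_of_mem (x := x) (S₁ := matrixSubring S₁ (ι ⊕ ι))
    hJmem' hJmem hJJ' hJJ
  have hU := factorsNearOne_fromBlocks (ι := ι) h1
  have key := (((hU u).mul hx' h2' (((hJ.mul hx' h2' (hU u')).mul hx' h2' hJ'))).mul hx' h2'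
    (hU u)).mul hx' h2' hJ
  obtain ⟨α, hα, α', hα', hαα, hαα', ⟨c, hc, hg⟩, c', hc', hg'⟩ := key 0
  rw [pow_zero, one_smul] at hg hg'
  refine ⟨α, hα, α', hα', 1 + c, add_mem (one_mem _) hc, 1 + c', add_mem (one_mem _) hc', hαα,
    ?_, ?_⟩
  · rw [← hg, ← hg', Matrix.mul_assoc, ← Matrix.mul_assoc _ _ α]
    refine Eq.trans (congrArg (fun z => α' * (z * α)) ?_) ((congrArg _ (Matrix.one_mul α)).trans hαα')
    simp [fromBlocks_multiply, J, J', huu', hu'u]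
  · rw [← hg, ← Matrix.mul_assoc, hαα, Matrix.one_mul]
    simp [fromBlocks_multiply, J, J', huu', hu'u]

end Gluing

section ScalarLocalization

open Matrix Polynomial

variable (F A : Type) [Field F] [CommRing A] [Algebra F A]

/-- Extension of scalars for polynomials. -/
abbrev scalarPoly : F[X] →+* A[X] := mapRingHom (algebraMap F A)

/-- The nonzero polynomials with coefficients in `F`. -/
abbrev scalarPolys : Submonoid A[X] := (nonZeroDivisors F[X]).map (scalarPoly F A)

/-- The localization of `A[X]` at the nonzero polynomials with coefficients in `F`. -/
abbrev ScalarLoc : Type := Localization (scalarPolys F A)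

variable {F A}

lemma isUnit_scalarLoc {f : F[X]} (hf : f ≠ 0) :
    IsUnit (algebraMap A[X] (ScalarLoc F A) (scalarPoly F A f)) :=
  IsLocalization.map_units _ (⟨_, f, mem_nonZeroDivisors_of_ne_zero hf, rfl⟩ : scalarPolys F A)

lemma scalarLoc_surj (y : ScalarLoc F A) : ∃ f : F[X], f ≠ 0 ∧ ∃ p : A[X],
    algebraMap _ (ScalarLoc F A) (scalarPoly F A f) * y = algebraMap _ _ p := by
  obtain ⟨⟨p, _, f, hf, rfl⟩, h⟩ := IsLocalization.surj (scalarPolys F A) y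
  exact ⟨f, nonZeroDivisors.ne_zero hf, p, by rw [mul_comm]; exact h⟩

variable (F A)

/-- The image of the variable, as a unit. -/
def scalarLocX : (ScalarLoc F A)ˣ :=
  IsUnit.unit (a := algebraMap A[X] (ScalarLoc F A) X)
    (by simpa using isUnit_scalarLoc (F := F) (A := A) X_ne_zero)

lemma val_scalarLocX : (scalarLocX F A : ScalarLoc F A) = algebraMap A[X] _ X := rfl

/-- The canonical map from Laurent polynomials. -/
def laurentToScalarLoc : LaurentPolynomial A →+* ScalarLoc F A :=
  LaurentPolynomial.eval₂ ((algebraMap A[X] _).comp C) (scalarLocX F A)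

variable {F A}

lemma laurentToScalarLoc_toLaurent (p : A[X]) :
    laurentToScalarLoc F A (toLaurent p) = algebraMap _ _ p := by
  rw [laurentToScalarLoc, LaurentPolynomial.eval₂_toLaurent, val_scalarLocX]
  exact (hom_eval₂ p C (algebraMap A[X] (ScalarLoc F A)) X).symm.trans (by rw [eval₂_C_X])

lemma mem_range_laurentToScalarLoc {y : ScalarLoc F A} :
    y ∈ (laurentToScalarLoc F A).range ↔
      ∃ (k : ℕ) (p : A[X]), algebraMap A[X] _ X ^ k * y = algebraMap _ _ p := by
  constructor
  · rintro ⟨l, rfl⟩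
    obtain ⟨k, p, hp⟩ := LaurentPolynomial.exists_T_pow l
    refine ⟨k, p, ?_⟩
    rw [← laurentToScalarLoc_toLaurent p, hp, map_mul, mul_comm, laurentToScalarLoc,
      LaurentPolynomial.eval₂_T_n, val_scalarLocX]
  · rintro ⟨k, p, hp⟩
    refine ⟨toLaurent p * LaurentPolynomial.T (-k), ?_⟩
    rw [map_mul, laurentToScalarLoc_toLaurent, ← hp, laurentToScalarLoc,
      LaurentPolynomial.eval₂_T_neg_n, ← val_scalarLocX, mul_right_comm, ← mul_pow,
      Units.mul_inv, one_pow, one_mul]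

variable (F A) in
/-- Fractions whose denominator does not vanish at zero. -/
def regularAtZero : Subring (ScalarLoc F A) where
  carrier := {y | ∃ f : F[X], f.coeff 0 ≠ 0 ∧ ∃ p : A[X],
    algebraMap _ (ScalarLoc F A) (scalarPoly F A f) * y = algebraMap _ _ p}
  zero_mem' := ⟨1, by simp, 0, by simp⟩
  one_mem' := ⟨1, by simp, 1, by simp⟩
  add_mem' := by
    rintro y z ⟨f, hf, p, hy⟩ ⟨g, hg, q, hz⟩
    refine ⟨f * g, by rw [mul_coeff_zero]; exact mul_ne_zero hf hg,
      p * scalarPoly F A g + q * scalarPoly F A f, ?_⟩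
    simp only [map_add, map_mul, ← hy, ← hz]; ring
  neg_mem' := by
    rintro y ⟨f, hf, p, hy⟩
    exact ⟨f, hf, -p, by rw [map_neg, ← hy]; ring⟩
  mul_mem' := by
    rintro y z ⟨f, hf, p, hy⟩ ⟨g, hg, q, hz⟩
    refine ⟨f * g, by rw [mul_coeff_zero]; exact mul_ne_zero hf hg, p * q, ?_⟩
    simp only [map_mul, ← hy, ← hz]; ring

lemma algebraMap_mem_regularAtZero (p : A[X]) :
    algebraMap A[X] (ScalarLoc F A) p ∈ regularAtZero F A := ⟨1, by simp, p, by simp⟩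

lemma exists_bezout_X_pow {f : F[X]} (hf : f.coeff 0 ≠ 0) (k : ℕ) :
    ∃ a b : A[X], a * X ^ k + b * scalarPoly F A f = 1 := by
  have : IsCoprime (X ^ k) f := by
    refine IsCoprime.pow_left ?_
    rw [Prime.coprime_iff_not_dvd prime_X, X_dvd_iff]
    exact hf
  obtain ⟨a, b, h⟩ := this
  refine ⟨scalarPoly F A a, scalarPoly F A b, ?_⟩
  have := congrArg (scalarPoly F A) h
  rw [map_add, map_mul, map_mul, map_pow, map_one] at this
  rw [← this, coe_mapRingHom, map_X]

lemma exists_X_pow_mul {f : F[X]} (hf : f ≠ 0) :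
    ∃ (k : ℕ) (g : F[X]), g.coeff 0 ≠ 0 ∧ f = X ^ k * g := by
  obtain ⟨g, hg, h⟩ := exists_eq_pow_rootMultiplicity_mul_and_not_dvd f hf 0
  rw [C_0, sub_zero] at hg h
  exact ⟨_, g, fun h0 => h (X_dvd_iff.2 h0), hg⟩

lemma exists_pow_mul_mem_regularAtZero (y : ScalarLoc F A) :
    ∃ k : ℕ, algebraMap A[X] _ X ^ k * y ∈ regularAtZero F A := by
  obtain ⟨f, hf, p, hy⟩ := scalarLoc_surj y
  obtain ⟨k, g, hg, rfl⟩ := exists_X_pow_mul hf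
  refine ⟨k, g, hg, p, ?_⟩
  rw [← hy, map_mul, map_mul, map_pow, map_pow, coe_mapRingHom, map_X]
  ring

lemma exists_eq_add_pow_mul (y : ScalarLoc F A) (N : ℕ) :
    ∃ b ∈ (laurentToScalarLoc F A).range, ∃ c ∈ regularAtZero F A,
      y = b + algebraMap A[X] _ X ^ N * c := by
  obtain ⟨k, f, hf, p, hy⟩ := exists_pow_mul_mem_regularAtZero y
  obtain ⟨a, b, hab⟩ := exists_bezout_X_pow (A := A) hf (k + N)
  have h := congrArg (algebraMap A[X] (ScalarLoc F A)) hab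
  simp only [map_add, map_mul, map_pow, map_one] at h
  refine ⟨algebraMap _ _ (b * scalarPoly F A f) * y,
    mem_range_laurentToScalarLoc.2 ⟨k, b * p, ?_⟩,
    algebraMap _ _ a * (algebraMap A[X] _ X ^ k * y),
    (regularAtZero F A).mul_mem (algebraMap_mem_regularAtZero a) ⟨f, hf, p, hy⟩, ?_⟩
  · simp only [map_mul, ← hy]; ring
  · rw [map_mul]
    linear_combination -y * h

lemma exists_algebraMap_eq_of_mem {y : ScalarLoc F A} (h₀ : y ∈ (laurentToScalarLoc F A).range)
    (h₁ : y ∈ regularAtZero F A) : ∃ p : A[X], algebraMap _ _ p = y := by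
  obtain ⟨k, q, hq⟩ := mem_range_laurentToScalarLoc.1 h₀
  obtain ⟨f, hf, p, hp⟩ := h₁
  obtain ⟨a, b, hab⟩ := exists_bezout_X_pow (A := A) hf k
  have h := congrArg (algebraMap A[X] (ScalarLoc F A)) hab
  simp only [map_add, map_mul, map_pow, map_one] at h
  refine ⟨a * q + b * p, ?_⟩
  simp only [map_add, map_mul, ← hq, ← hp]
  linear_combination y * h

variable [IsDomain A]

lemma scalarPolys_le_nonZeroDivisors : scalarPolys F A ≤ nonZeroDivisors A[X] := by
  rintro _ ⟨f, hf, rfl⟩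
  refine mem_nonZeroDivisors_of_ne_zero ?_
  exact (Polynomial.map_ne_zero_iff (algebraMap F A).injective).2 (nonZeroDivisors.ne_zero hf)

lemma algebraMap_scalarLoc_injective : Function.Injective (algebraMap A[X] (ScalarLoc F A)) :=
  IsLocalization.injective _ (scalarPolys_le_nonZeroDivisors (F := F))

lemma laurentToScalarLoc_injective : Function.Injective (laurentToScalarLoc F A) := by
  rw [injective_iff_map_eq_zero]
  intro l hl
  obtain ⟨k, p, hp⟩ := LaurentPolynomial.exists_T_pow l
  have h := laurentToScalarLoc_toLaurent (F := F) p
  rw [hp, map_mul, hl, zero_mul, eq_comm,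
    map_eq_zero_iff _ (algebraMap_scalarLoc_injective (F := F))] at h
  rw [h, map_zero] at hp
  exact ((LaurentPolynomial.isUnit_T _).mul_left_eq_zero).1 hp.symm

end ScalarLocalization

section Induction

open Matrix Polynomial

variable {F A : Type} [Field F] [CommRing A] [Algebra F A]

/-- Nonzero polynomials over `F` are invertible where monic polynomials over `A` are. -/
def scalarLocToMonicLoc (A B : Type) [CommRing A] [CommRing B] [Algebra F A] [Nontrivial B]
    (f : A →+* B) : ScalarLoc F A →+* MonicLoc B :=
  IsLocalization.lift (M := scalarPolys F A)
    (g := (algebraMap B[X] (MonicLoc B)).comp (mapRingHom f)) fun y => by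
      obtain ⟨_, q, hq, rfl⟩ := y
      have hq0 : q ≠ 0 := nonZeroDivisors.ne_zero hq
      have hl : q.leadingCoeff ≠ 0 := leadingCoeff_ne_zero.2 hq0
      have : q = C q.leadingCoeff * (q * C q.leadingCoeff⁻¹) := by
        rw [mul_comm, mul_assoc, ← C_mul, inv_mul_cancel₀ hl, C_1, mul_one]
      have h2 := (((monic_mul_leadingCoeff_inv hq0).map (algebraMap F A)).map f)
      change IsUnit (algebraMap B[X] (MonicLoc B) ((q.map (algebraMap F A)).map f))
      rw [this, Polynomial.map_mul, Polynomial.map_mul, map_mul, map_C, map_C]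
      refine IsUnit.mul ?_ (Monic.isUnit_monicLoc h2)
      exact ((((IsUnit.mk0 _ hl).map (algebraMap F A)).map f).map C).map _

lemma scalarLocToMonicLoc_comp {B : Type} [CommRing B] [Nontrivial B] (f : A →+* B) :
    (scalarLocToMonicLoc (F := F) A B f).comp (algebraMap A[X] (ScalarLoc F A)) =
      (algebraMap B[X] (MonicLoc B)).comp (mapRingHom f) :=
  IsLocalization.lift_comp _

variable {ι : Type} [Fintype ι] [DecidableEq ι] [IsDomain A]

/-- An idempotent over `A[X]` splits freely if it does so, together with its complement, after
inverting the nonzero polynomials over a field. -/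
lemma splitsFreely_of_scalarLoc (hA : HasFreeIdempotents A) (e : Matrix ι ι A[X]) (hidem : e * e = e)
    (he : SplitsFreely (e.map (algebraMap A[X] (ScalarLoc F A))))
    (he' : SplitsFreely ((1 - e).map (algebraMap A[X] (ScalarLoc F A)))) : SplitsFreely e := by
  obtain ⟨τ, τ', hτ, h⟩ := exists_conj_eval_zero_of_forall_isMaximal e fun m _ => by
    let B := Localization.AtPrime m
    let f := algebraMap A B
    have hmap (d : Matrix ι ι A[X])
        (hd : SplitsFreely (d.map (algebraMap A[X] (ScalarLoc F A)))) :
        SplitsFreely ((d.map (mapRingHom f)).map (algebraMap B[X] (MonicLoc B))) := by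
      have := hd.map (scalarLocToMonicLoc A B f)
      rwa [map_map_ringHom, scalarLocToMonicLoc_comp, ← map_map_ringHom] at this
    obtain ⟨v, v', c, hv, h⟩ := exists_conj_const_of_splitsFreely_monicLoc
      (e.map (mapRingHom f)) (hmap e he) (by
        have := hmap _ he'
        rwa [Matrix.map_sub _ (map_sub _), Matrix.map_one _ (map_zero _) (map_one _)] at this)
    exact ⟨v, v', c, hv, h⟩
  refine SplitsFreely.of_conj (SplitsFreely.map (hA.splitsFreely ?_) C) hτ h
  rw [← Matrix.map_mul, hidem]

theorem hasFreeIdempotents_laurentPolynomial (hA : HasFreeIdempotents A)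
    (hE : ∀ (n : ℕ) (e : Matrix (Fin n) (Fin n) (LaurentPolynomial A)), e * e = e →
      SplitsFreely (e.map (laurentToScalarLoc F A))) :
    HasFreeIdempotents (LaurentPolynomial A) := by
  intro n e hidem
  let κ := laurentToScalarLoc F A
  have hκ : Function.Injective κ := laurentToScalarLoc_injective
  have hsub (h : Matrix (Fin n) (Fin n) (LaurentPolynomial A)) : (1 - h).map κ = 1 - h.map κ := by
    rw [Matrix.map_sub _ (map_sub _), Matrix.map_one _ (map_zero _) (map_one _)]
  have : Nontrivial (ScalarLoc F A) := hκ.nontrivial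
  obtain ⟨p, u, u', huu', heu⟩ := exists_conj_diagIdem (hE n e hidem) (by
    rw [← hsub]; exact hE n _ (one_sub_mul_self hidem))
  obtain ⟨α, hα, α', hα', β, hβ, β', hβ', hαα, hββ, hαβ⟩ := exists_factorization_of_gluing
    (algebraMap_mem_regularAtZero X) exists_eq_add_pow_mul exists_pow_mul_mem_regularAtZero huu'
  choose α₀ hα₀ using hα
  choose α₀' hα₀' using hα'
  have hα₀ : (Matrix.of α₀).map κ = α := by ext i j; exact hα₀ i j
  have hα₀' : (Matrix.of α₀').map κ = α' := by ext i j; exact hα₀' i j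
  set a := Matrix.of α₀
  set a' := Matrix.of α₀'
  have haa : a * a' = 1 := by
    apply Matrix.map_injective hκ
    change (a * a').map κ = (1 : Matrix _ _ _).map κ
    rw [Matrix.map_mul, hα₀, hα₀', hαα, Matrix.map_one _ (map_zero _) (map_one _)]
  set ê := fromBlocks e 0 0 (0 : Matrix (Fin n) (Fin n) (LaurentPolynomial A)) with hê
  set d := diagIdem (ScalarLoc F A) (Sum.elim p fun _ : Fin n => false) with hd
  have hdβ : ê.map κ * (α * β) = (α * β) * d := by
    rw [← hαβ, hd, ← fromBlocks_diagIdem, hê, fromBlocks_map, fromBlocks_multiply,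
      fromBlocks_multiply]
    simp [heu, κ]
  have hconj : α' * ê.map κ * α = β * d * β' := by
    calc α' * ê.map κ * α = α' * (ê.map κ * (α * β)) * β' := by
          simp only [Matrix.mul_assoc, hββ, Matrix.mul_one]
      _ = (α' * α) * β * d * β' := by rw [hdβ]; simp only [Matrix.mul_assoc]
      _ = _ := by rw [mul_eq_one_comm.1 hαα, Matrix.one_mul]
  have hmem₁ : β * d * β' ∈ matrixSubring (regularAtZero F A) (Fin n ⊕ Fin n) := by
    refine mul_mem (mul_mem hβ fun i j => ?_) hβ'
    change d i j ∈ regularAtZero F A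
    simp only [hd, diagIdem, diagonal_apply]
    split_ifs
    exacts [one_mem _, zero_mem _, zero_mem _]
  choose q hq using fun i j => exists_algebraMap_eq_of_mem (y := (β * d * β') i j)
    (by rw [← hconj, ← hα₀, ← hα₀', ← Matrix.map_mul, ← Matrix.map_mul]; exact ⟨_, rfl⟩)
    (hmem₁ i j)
  set e' := Matrix.of q
  have he' : e'.map (algebraMap A[X] (ScalarLoc F A)) = β * d * β' := by ext i j; exact hq i j
  have hβ'β : β' * β = 1 := mul_eq_one_comm.1 hββ
  have he'β : e'.map (algebraMap A[X] (ScalarLoc F A)) * β = β * d := by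
    rw [he', Matrix.mul_assoc, hβ'β, Matrix.mul_one]
  have hidem' : e' * e' = e' := by
    apply Matrix.map_injective (algebraMap_scalarLoc_injective (F := F))
    change (e' * e').map (algebraMap A[X] (ScalarLoc F A)) =
      e'.map (algebraMap A[X] (ScalarLoc F A))
    rw [Matrix.map_mul, he']
    calc β * d * β' * (β * d * β') = β * (d * (β' * β) * d) * β' := by
          simp only [Matrix.mul_assoc]
      _ = _ := by rw [hβ'β, Matrix.mul_one, hd, diagIdem_mul_self]
  have hsplit : SplitsFreely e' := by
    refine splitsFreely_of_scalarLoc (F := F) hA e' hidem' ?_ ?_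
    · exact (splitsFreely_diagIdem _).of_conj hββ he'β
    · rw [Matrix.map_sub _ (map_sub _), Matrix.map_one _ (map_zero _) (map_one _)]
      refine SplitsFreely.of_conj ?_ hββ (one_sub_conj he'β)
      rw [hd, one_sub_diagIdem]
      exact splitsFreely_diagIdem _
  refine SplitsFreely.of_fromBlocks (κ := Fin n)
    (SplitsFreely.of_conj (hsplit.map (toLaurent : A[X] →+* LaurentPolynomial A)) haa ?_)
  apply Matrix.map_injective hκ
  change (ê * a).map κ = (a * e'.map toLaurent).map κ
  have hcomp : κ.comp (toLaurent : A[X] →+* LaurentPolynomial A) = algebraMap _ _ :=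
    RingHom.ext laurentToScalarLoc_toLaurent
  rw [Matrix.map_mul, Matrix.map_mul, map_map_ringHom, hcomp, he', ← hconj, hα₀,
    ← Matrix.mul_assoc, ← Matrix.mul_assoc, hαα, Matrix.one_mul]

end Induction

section LaurentVariables

open AddMonoidAlgebra Polynomial

variable (F G : Type) [Field F] [AddCommMonoid G]

/-- Adjoining a Laurent variable, mapped to a new constant. -/
def laurentToFraction :
    LaurentPolynomial (AddMonoidAlgebra F G) →+* AddMonoidAlgebra (FractionRing F[X]) G :=
  LaurentPolynomial.eval₂
    (AddMonoidAlgebra.mapRingHom G (algebraMap F (FractionRing F[X])))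
    (Units.map (singleZeroRingHom : FractionRing F[X] →+* _).toMonoidHom
      (Units.mk0 (algebraMap F[X] (FractionRing F[X]) X) (by simp)))

/-- Rational functions in the coefficients, viewed as fractions with scalar denominators. -/
def fractionToScalarLoc :
    AddMonoidAlgebra (FractionRing F[X]) G →+* ScalarLoc F (AddMonoidAlgebra F G) :=
  AddMonoidAlgebra.liftNCRingHom
    (IsLocalization.lift (M := nonZeroDivisors F[X])
      (g := (algebraMap _ (ScalarLoc F (AddMonoidAlgebra F G))).comp
        (scalarPoly F (AddMonoidAlgebra F G)))
      fun y => isUnit_scalarLoc (nonZeroDivisors.ne_zero y.2))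
    (((algebraMap _ (ScalarLoc F (AddMonoidAlgebra F G))).comp C).toMonoidHom.comp
      (AddMonoidAlgebra.of F G))
    fun _ _ => Commute.all _ _

lemma fractionToScalarLoc_single_zero (f : F[X]) :
    fractionToScalarLoc F G (single 0 (algebraMap F[X] _ f)) =
      algebraMap _ _ (scalarPoly F (AddMonoidAlgebra F G) f) := by
  rw [fractionToScalarLoc, liftNCRingHom_single, IsLocalization.lift_eq]
  simp [← AddMonoidAlgebra.one_def]

lemma fractionToScalarLoc_comp : (fractionToScalarLoc F G).comp (laurentToFraction F G) =
    laurentToScalarLoc F (AddMonoidAlgebra F G) := by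
  refine AddMonoidAlgebra.ringHom_ext (fun r => ?_) fun m => ?_
  · change fractionToScalarLoc F G (laurentToFraction F G (LaurentPolynomial.C r)) =
      laurentToScalarLoc F _ (LaurentPolynomial.C r)
    rw [laurentToFraction, laurentToScalarLoc, LaurentPolynomial.eval₂_C,
      LaurentPolynomial.eval₂_C]
    change ((fractionToScalarLoc F G).comp (mapRingHom G _)) r = _
    congr 1
    refine AddMonoidAlgebra.ringHom_ext (fun c => ?_) fun g => ?_
    · have h := fractionToScalarLoc_single_zero F G (C c)
      rw [RingHom.comp_apply, mapRingHom_single]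
      refine h.trans ?_
      simp
    · simp [fractionToScalarLoc]
  · change fractionToScalarLoc F G (laurentToFraction F G (LaurentPolynomial.T m)) =
      laurentToScalarLoc F _ (LaurentPolynomial.T m)
    rw [laurentToFraction, laurentToScalarLoc, LaurentPolynomial.eval₂_T,
      LaurentPolynomial.eval₂_T]
    rw [← MonoidHom.coe_coe, ← Units.coe_map, map_zpow]
    congr 2
    refine Units.ext ((fractionToScalarLoc_single_zero F G X).trans ?_)
    simp [val_scalarLocX]

end LaurentVariables

/-- Splitting off the first coordinate. -/
def finsuppFinSuccAddEquiv (D : ℕ) : (Fin (D + 1) →₀ ℤ) ≃+ ℤ × (Fin D →₀ ℤ) where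
  toFun g := (g 0, g.tail)
  invFun p := Finsupp.cons p.1 p.2
  left_inv g := Finsupp.cons_tail g
  right_inv p := by simp
  map_add' g h := by
    refine Prod.ext rfl (Finsupp.ext fun i => ?_)
    simp [Finsupp.tail_apply]

theorem hasFreeIdempotents_lPoly (D : ℕ) (F : Type) [Field F] :
    HasFreeIdempotents (AddMonoidAlgebra F (Fin D →₀ ℤ)) := by
  induction D generalizing F with
  | zero =>
    let e := AddMonoidAlgebra.uniqueRingEquiv (R := F) (Fin 0 →₀ ℤ)
    exact (hasFreeIdempotents_of_isPrincipalIdealRing F).of_retract e.toRingHom e.symm.toRingHom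
      (by ext x <;> simp)
  | succ D ih =>
    have h : HasFreeIdempotents (LaurentPolynomial (AddMonoidAlgebra F (Fin D →₀ ℤ))) :=
      hasFreeIdempotents_laurentPolynomial (F := F) (ih F) fun n e he => by
        rw [← fractionToScalarLoc_comp, ← map_map_ringHom]
        refine SplitsFreely.map (ih _ n _ ?_) _
        rw [← Matrix.map_mul, he]
    let e : AddMonoidAlgebra F (Fin (D + 1) →₀ ℤ) ≃+*
        LaurentPolynomial (AddMonoidAlgebra F (Fin D →₀ ℤ)) :=
      (AddMonoidAlgebra.domCongr F F (finsuppFinSuccAddEquiv D)).toRingEquiv.trans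
        AddMonoidAlgebra.curryRingEquiv
    exact h.of_retract e.toRingHom e.symm.toRingHom
      (RingHom.ext fun x => e.symm_apply_apply x)

section SmithForm

open Matrix

variable {R : Type} [CommRing R]

section Minors

variable {ι κ : Type}

lemma det_fromBlocks_mul_pow [Fintype ι] [DecidableEq ι] (A : Matrix ι ι R)
    (u : Matrix ι Unit R) (v : Matrix Unit ι R) (d : Matrix Unit Unit R) :
    A.adjugate.det * A.det * (fromBlocks A u v d).det =
      A.det ^ Fintype.card ι * (A.det • d - v * A.adjugate * u).det := by
  have h : fromBlocks A.adjugate 0 (-(v * A.adjugate)) (A.det • 1) * fromBlocks A u v d =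
      fromBlocks (A.det • 1) (A.adjugate * u) 0 (A.det • d - v * A.adjugate * u) := by
    rw [fromBlocks_multiply]
    congr 1
    · simp [adjugate_mul]
    · simp
    · simp [Matrix.mul_assoc, adjugate_mul]
    · simp [sub_eq_neg_add]
  have h := congrArg det h
  rw [det_mul, det_fromBlocks_zero₁₂, det_fromBlocks_zero₂₁, det_smul, det_smul] at h
  simpa using h

lemma mul_adjugate_mul_eq_det_smul [IsDomain R] {r : ℕ} (M : Matrix ι κ R) (f : Fin r → ι)
    (g : Fin r → κ) (hd : (M.submatrix f g).det ≠ 0)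
    (h : ∀ (i : ι) (j : κ),
      (M.submatrix (Sum.elim f fun _ : Unit => i) (Sum.elim g fun _ : Unit => j)).det = 0) :
    M.submatrix id g * (M.submatrix f g).adjugate * M.submatrix f id =
      (M.submatrix f g).det • M := by
  ext i j
  set A := M.submatrix f g with hA
  have h1 := det_fromBlocks_mul_pow A (M.submatrix f fun _ : Unit => j)
    (M.submatrix (fun _ : Unit => i) g) (M.submatrix (fun _ => i) fun _ => j)
  have h2 : fromBlocks A (M.submatrix f fun _ : Unit => j)
      (M.submatrix (fun _ : Unit => i) g) (M.submatrix (fun _ => i) fun _ => j) =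
      M.submatrix (Sum.elim f fun _ : Unit => i) (Sum.elim g fun _ : Unit => j) := by
    ext (_ | _) (_ | _) <;> rfl
  rw [h2, h, mul_zero, eq_comm, mul_eq_zero_iff_left (pow_ne_zero _ hd), det_unique] at h1
  exact (sub_eq_zero.1 h1).symm

lemma det_mul_eq_zero_of_submatrix [Fintype ι] [Fintype κ] [DecidableEq κ] (P : Matrix κ ι R)
    (B : Matrix ι κ R) (h : ∀ f : κ → ι, (B.submatrix f id).det = 0) : (P * B).det = 0 := by
  have h1 : P * B = fun i => ∑ k, P i k • B k := by
    ext i j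
    simp [mul_apply, Finset.sum_apply]
  rw [h1]
  refine ((detRowAlternating (n := κ) (R := R)).toMultilinearMap.map_sum
    fun i k => P i k • B k).trans (Finset.sum_eq_zero fun f _ => ?_)
  rw [MultilinearMap.map_smul_univ]
  exact (congrArg _ (h f)).trans (smul_zero _)

lemma det_mul_mul_eq_zero [Fintype ι] [Fintype κ] {r : ℕ} (P : Matrix (Fin r) ι R)
    (M : Matrix ι κ R) (Q : Matrix κ (Fin r) R)
    (h : ∀ (f : Fin r → ι) (g : Fin r → κ), (M.submatrix f g).det = 0) :
    (P * M * Q).det = 0 := by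
  rw [Matrix.mul_assoc]
  refine det_mul_eq_zero_of_submatrix _ _ fun f => ?_
  rw [Matrix.submatrix_mul _ _ _ id _ Function.bijective_id, submatrix_id_id, ← det_transpose,
    transpose_mul]
  refine det_mul_eq_zero_of_submatrix _ _ fun g => ?_
  rw [← det_transpose]
  exact h f g

end Minors

section DeterminantalIdeal

variable {ι κ : Type} [Fintype ι] [Fintype κ] {M : Matrix ι κ R} {k : ℕ}

lemma detIdeal_eq_bot_iff : detIdeal M k = ⊥ ↔
    ∀ (f : Fin k → ι) (g : Fin k → κ), (M.submatrix f g).det = 0 := by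
  rw [detIdeal, Ideal.span_eq_bot]
  refine ⟨fun h f g => ?_, ?_⟩
  · by_cases hf : Function.Injective f
    · by_cases hg : Function.Injective g
      · exact h _ ⟨f, g, hf, hg, rfl⟩
      · obtain ⟨i, j, hij, hne⟩ := Function.not_injective_iff.1 hg
        exact det_zero_of_column_eq hne fun l => by simp [hij]
    · obtain ⟨i, j, hij, hne⟩ := Function.not_injective_iff.1 hf
      exact det_zero_of_row_eq hne (by ext l; simp [hij])
  · rintro h _ ⟨f, g, -, -, rfl⟩
    exact h f g

lemma bddAbove_detIdeal_ne_bot : BddAbove {k | detIdeal M k ≠ ⊥} := by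
  refine ⟨Fintype.card ι, fun k hk => ?_⟩
  by_contra! hlt
  refine hk (Ideal.span_eq_bot.2 ?_)
  rintro _ ⟨f, -, hf, -, -⟩
  exact absurd (Fintype.card_le_of_injective f hf) (by simpa using hlt)

lemma le_matRank (h : detIdeal M k ≠ ⊥) : k ≤ matRank M :=
  le_csSup bddAbove_detIdeal_ne_bot h

lemma detIdeal_matRank_succ : detIdeal M (matRank M + 1) = ⊥ := by
  by_contra h
  exact absurd (le_matRank h) (by omega)

/-- A matrix whose smallest nonvanishing determinantal ideal is the unit ideal has a
generalized inverse. -/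
lemma exists_mul_mul_eq_self [IsDomain R] [DecidableEq ι] [DecidableEq κ]
    (hk : detIdeal M k = ⊤) (hk' : detIdeal M (k + 1) = ⊥) :
    ∃ N : Matrix κ ι R, M * N * M = M := by
  suffices ∀ d ∈ detIdeal M k, ∃ N : Matrix κ ι R, M * N * M = d • M by
    simpa using this 1 (by simp [hk])
  intro d hd
  induction hd using Submodule.span_induction with
  | mem d hd =>
    obtain ⟨f, g, -, -, rfl⟩ := hd
    by_cases h0 : (M.submatrix f g).det = 0
    · exact ⟨0, by simp [h0]⟩
    refine ⟨(1 : Matrix κ κ R).submatrix id g * (M.submatrix f g).adjugate *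
      (1 : Matrix ι ι R).submatrix f id, ?_⟩
    rw [← mul_adjugate_mul_eq_det_smul M f g h0 fun i j => ?_]
    · have h1 : M * (1 : Matrix κ κ R).submatrix id g = M.submatrix id g := by
        ext i j; simp [mul_apply, one_apply]
      have h2 : (1 : Matrix ι ι R).submatrix f id * M = M.submatrix f id := by
        ext i j; simp [mul_apply, one_apply]
      rw [← h1, ← h2]
      simp only [Matrix.mul_assoc]
    · let φ : Fin (k + 1) ≃ Fin k ⊕ Unit := Fintype.equivOfCardEq (by simp)
      rw [← det_submatrix_equiv_self φ, submatrix_submatrix]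
      exact detIdeal_eq_bot_iff.1 hk' _ _
  | zero => exact ⟨0, by simp⟩
  | add x y _ _ hx hy =>
    obtain ⟨N, hN⟩ := hx
    obtain ⟨N', hN'⟩ := hy
    exact ⟨N + N', by rw [Matrix.mul_add, Matrix.add_mul, hN, hN', add_smul]⟩
  | smul c x _ hx =>
    obtain ⟨N, hN⟩ := hx
    exact ⟨c • N, by rw [Matrix.mul_smul, Matrix.smul_mul, hN, smul_eq_mul, mul_smul]⟩

lemma matRank_eq_of_factorization [IsDomain R] {s : ℕ} (h0 : detIdeal M (matRank M) ≠ ⊥)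
    (a : Matrix ι (Fin s) R) (b : Matrix (Fin s) κ R) (hab : a * b = M)
    (p : Matrix (Fin s) ι R) (q : Matrix κ (Fin s) R) (h1 : p * M * q = 1) :
    matRank M = s := by
  refine le_antisymm ?_ (le_matRank fun h => ?_)
  · rw [Ne, detIdeal_eq_bot_iff] at h0
    push Not at h0
    obtain ⟨f, g, h⟩ := h0
    have hfac : M.submatrix f g = a.submatrix f id * b.submatrix id g := by
      rw [← Matrix.submatrix_mul _ _ _ _ _ Function.bijective_id, hab]
    have hinj : Function.Injective (toLin' (b.submatrix id g)) := by
      rw [injective_iff_map_eq_zero]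
      intro v hv
      by_contra hv0
      refine h (exists_mulVec_eq_zero_iff.1 ⟨v, hv0, ?_⟩)
      rw [toLin'_apply] at hv
      rw [hfac, ← mulVec_mulVec, hv, mulVec_zero]
    exact le_of_fin_injective R _ hinj
  · have := det_mul_mul_eq_zero p M q (detIdeal_eq_bot_iff.1 h)
    rw [h1, det_one] at this
    exact one_ne_zero this

end DeterminantalIdeal

theorem exists_smith_form [IsDomain R] (hR : HasFreeIdempotents R) {n m : ℕ}
    (M : Matrix (Fin n) (Fin m) R) (hM : detIdeal M (matRank M) = ⊤) :
    ∃ (E : Matrix (Fin n) (Fin n) R) (E' : Matrix (Fin m) (Fin m) R),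
      IsUnit E ∧ IsUnit E' ∧
      E * M * E' = Matrix.of (fun (i : Fin n) (j : Fin m) =>
        if (i : ℕ) = (j : ℕ) ∧ (i : ℕ) < matRank M then 1 else 0) := by
  obtain ⟨N, hN⟩ := exists_mul_mul_eq_self hM detIdeal_matRank_succ
  have hNM : N * M * (N * M) = N * M := by
    rw [Matrix.mul_assoc, ← Matrix.mul_assoc M, hN]
  have hMN : M * N * (M * N) = M * N := by rw [← Matrix.mul_assoc, hN]
  obtain ⟨s, a, b, hab, hba⟩ := hR _ _ hNM
  obtain ⟨t', c', d', hcd', hdc'⟩ := hR _ _ (one_sub_mul_self hNM)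
  obtain ⟨t, c, d, hcd, hdc⟩ := hR _ _ (one_sub_mul_self hMN)
  have hsplit' : a * b + c' * d' = 1 := by rw [hab, hcd']; abel
  have hsplit : M * a * (b * N) + c * d = 1 := by
    rw [hcd, ← Matrix.mul_assoc, Matrix.mul_assoc M, hab, ← Matrix.mul_assoc, hN]; abel
  have hbNMa : b * N * M * a = 1 := by
    rw [Matrix.mul_assoc b, ← hab, ← Matrix.mul_assoc, hba, Matrix.one_mul, hba]
  have hbNMa' : b * N * (M * a) = 1 := by rw [← Matrix.mul_assoc, hbNMa]
  have hMc : M * c' = 0 := by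
    rw [← hN, Matrix.mul_assoc M, ← hab, Matrix.mul_assoc, Matrix.mul_assoc,
      mul_eq_zero_of_splitting hsplit' hba hdc', Matrix.mul_zero, Matrix.mul_zero]
  have hdM : d * (M * a) = 0 :=
    mul_eq_zero_of_splitting (by rwa [add_comm]) hdc hbNMa'
  have hs : matRank M = s := matRank_eq_of_factorization (by rw [hM]; exact top_ne_bot) (M * a) b
    (by rw [Matrix.mul_assoc, hab, ← Matrix.mul_assoc, hN]) (b * N) a hbNMa
  rw [hs]
  clear hs hM
  obtain ⟨ψ⟩ := exists_equiv_of_splitting hsplit hbNMa' hdc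
  obtain ⟨ψ'⟩ := exists_equiv_of_splitting hsplit' hba hdc'
  obtain rfl : s + t = n := by simpa using Fintype.card_congr ψ
  obtain rfl : s + t' = m := by simpa using Fintype.card_congr ψ'
  refine ⟨joinRows finSumFinEquiv (b * N) d, joinCols finSumFinEquiv a c',
    .of_mul_eq_one_right _ (joinCols_mul_joinRows finSumFinEquiv hsplit),
    .of_mul_eq_one _ (joinCols_mul_joinRows finSumFinEquiv hsplit'), ?_⟩
  have h : fromRows (b * N) d * M * fromCols a c' = fromBlocks 1 0 0 0 := by
    rw [fromRows_mul, fromRows_mul_fromCols, hbNMa, Matrix.mul_assoc d, hdM, Matrix.mul_assoc,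
      Matrix.mul_assoc d, hMc, Matrix.mul_zero, Matrix.mul_zero]
  have h2 : joinRows finSumFinEquiv (b * N) d * M * joinCols finSumFinEquiv a c' =
      (fromRows (b * N) d * M * fromCols a c').submatrix finSumFinEquiv.symm
        finSumFinEquiv.symm := rfl
  rw [h2, h]
  ext i j
  obtain ⟨i, rfl⟩ := finSumFinEquiv.surjective i
  obtain ⟨j, rfl⟩ := finSumFinEquiv.surjective j
  rw [submatrix_apply, Equiv.symm_apply_apply, Equiv.symm_apply_apply]
  rcases i with i | i <;> rcases j with j | j
  · simp [one_apply, Fin.ext_iff]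
  · simp; omega
  · simp
  · simp

end SmithForm

end QuillenSuslin

/-- Quillen–Suslin–Swan: a matrix over a Laurent polynomial ring whose
smallest nonvanishing determinantal ideal is unit can be brought to the form
`[[I_r, 0],[0,0]]` by invertible row and column operations. -/
theorem smith_form_of_unit_determinantal_ideal
    (F : Type) [Field F] (D : ℕ) (n m : ℕ)
    (M : Matrix (Fin n) (Fin m) (LPoly F D))
    (hM : detIdeal M (matRank M) = ⊤) :
    ∃ (E : Matrix (Fin n) (Fin n) (LPoly F D)) (E' : Matrix (Fin m) (Fin m) (LPoly F D)),
      IsUnit E ∧ IsUnit E' ∧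
      E * M * E' = Matrix.of (fun (i : Fin n) (j : Fin m) =>
        if (i : ℕ) = (j : ℕ) ∧ (i : ℕ) < matRank M then 1 else 0) := by
  exact QuillenSuslin.exists_smith_form (QuillenSuslin.hasFreeIdempotents_lPoly D F) M hM
end
end

section
/- Let F be a field of characteristic different from 2, and let R be a commutative star ring that is an F-algebra such that star fixes the image of F elementwise. Let n be an even positive integer and suppose there exists an invertible n × n matrix P over F with Pᵀ·P = H_n, where H_n is the block-diagonal sum of n/2 copies of [[0,1],[1,0]] (this is the hypothesis that the n-fold sum of the form ⟨1⟩ is hyperbolic over F, as holds when the Witt group of F has exponent n). Then for every invertible m × m antihermitian matrix Ξ over R (Ξ† = −Ξ) there exists an invertible nm × nm matrix E over R such that E† · (I_n ⊗ Ξ) · E = λ_{nm/2}, where ⊗ denotes the Kronecker product and λ_k = [[0, I_k],[−I_k, 0]]. -/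
/-! Statement 9: if the `n`-fold sum of the form ⟨1⟩ is hyperbolic over a field `F` of
characteristic ≠ 2 (as when the Witt group of `F` has exponent `n`), then for any
commutative star `F`-algebra `R` with star fixing `F`, and any invertible antihermitian
`Ξ` over `R`, the form `I_n ⊗ Ξ` is congruent to the standard symplectic form. -/

noncomputable section

open scoped Kronecker

/-- The hyperbolic matrix `H_n`: block-diagonal sum of `n/2` copies of `[[0,1],[1,0]]`. -/
def hypMat (F : Type) [Field F] (n : ℕ) : Matrix (Fin n) (Fin n) F :=
  Matrix.of fun i j => if i ≠ j ∧ (i : ℕ) / 2 = (j : ℕ) / 2 then 1 else 0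

/-- The symplectic form `λ_{n·m/2}` on `Fin n × Fin m` (for `n` even), with the first
block consisting of the pairs `(i, a)` with `i < n/2`:  `[[0, I],[−I, 0]]`. -/
def lamPair (R : Type) [CommRing R] (n m : ℕ) : Matrix (Fin n × Fin m) (Fin n × Fin m) R :=
  Matrix.of fun p q =>
    if p.2 = q.2 ∧ (p.1 : ℕ) + n / 2 = (q.1 : ℕ) then 1
    else if p.2 = q.2 ∧ (q.1 : ℕ) + n / 2 = (p.1 : ℕ) then -1 else 0

open Matrix

/-- The diagonal idempotent projecting onto the first `n / 2` coordinates. -/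
def firstHalf (R : Type) [CommRing R] (n : ℕ) : Matrix (Fin n) (Fin n) R :=
  diagonal fun i => if (i : ℕ) < n / 2 then 1 else 0

/-- The diagonal idempotent projecting onto the last coordinates, from index `n / 2` on. -/
def secondHalf (R : Type) [CommRing R] (n : ℕ) : Matrix (Fin n) (Fin n) R :=
  diagonal fun i => if (i : ℕ) < n / 2 then 0 else 1

/-- The block matrix `[[0, I], [0, 0]]` with blocks of size `n / 2`. -/
def upperShift (R : Type) [CommRing R] (n : ℕ) : Matrix (Fin n) (Fin n) R :=
  of fun i j => if (i : ℕ) + n / 2 = j then 1 else 0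

/-- For even `n`, the permutation listing the even indices first and then the odd ones. -/
def evenOddPerm (n : ℕ) (hn : Even n) : Equiv.Perm (Fin n) :=
  Equiv.ofBijective
    (fun i => if h : (i : ℕ) < n / 2 then ⟨2 * i, by omega⟩
      else ⟨2 * (i - n / 2) + 1, by obtain ⟨k, rfl⟩ := hn; omega⟩)
    (Finite.injective_iff_bijective.mp fun i j hij => by
      apply Fin.ext
      split_ifs at hij <;> simp only [Fin.mk.injEq] at hij <;> omega)

theorem evenOddPerm_val (n : ℕ) (hn : Even n) (i : Fin n) :
    (evenOddPerm n hn i : ℕ) =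
      if (i : ℕ) < n / 2 then 2 * (i : ℕ) else 2 * ((i : ℕ) - n / 2) + 1 := by
  simp only [evenOddPerm, Equiv.ofBijective_apply]
  split_ifs <;> rfl

theorem hypMat_submatrix_evenOddPerm (F : Type) [Field F] (n : ℕ) (hn : Even n) :
    (hypMat F n).submatrix (evenOddPerm n hn) (evenOddPerm n hn) =
      upperShift F n + (upperShift F n)ᵀ := by
  ext i j
  have hi := i.isLt
  have hj := j.isLt
  simp only [hypMat, upperShift, submatrix_apply, of_apply, Matrix.add_apply, transpose_apply, ne_eq,
    Fin.ext_iff, evenOddPerm_val]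
  obtain ⟨k, rfl⟩ := hn
  have hk : (k + k) / 2 = k := by omega
  simp only [hk]
  by_cases h₁ : (i : ℕ) + k = j
  · have h₂ : ¬ (j : ℕ) + k = i := by omega
    rw [if_pos (by split_ifs <;> omega), if_pos h₁, if_neg h₂, add_zero]
  · by_cases h₂ : (j : ℕ) + k = i
    · rw [if_pos (by split_ifs <;> omega), if_neg h₁, if_pos h₂, zero_add]
    · rw [if_neg (by split_ifs <;> omega), if_neg h₁, if_neg h₂, add_zero]

section Halves

variable (R : Type) [CommRing R] (n : ℕ)

theorem firstHalf_add_secondHalf : firstHalf R n + secondHalf R n = 1 := by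
  rw [firstHalf, secondHalf, diagonal_add, ← diagonal_one]
  congr 1
  ext i
  split_ifs <;> simp

theorem firstHalf_mul_self : firstHalf R n * firstHalf R n = firstHalf R n := by
  simp only [firstHalf, diagonal_mul_diagonal]
  congr 1
  ext i
  split_ifs <;> simp

theorem secondHalf_mul_self : secondHalf R n * secondHalf R n = secondHalf R n := by
  simp only [secondHalf, diagonal_mul_diagonal]
  congr 1
  ext i
  split_ifs <;> simp

theorem firstHalf_mul_secondHalf : firstHalf R n * secondHalf R n = 0 := by
  ext i j
  simp only [firstHalf, secondHalf, diagonal_mul_diagonal, diagonal_apply, Matrix.zero_apply]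
  split_ifs <;> simp

theorem secondHalf_mul_firstHalf : secondHalf R n * firstHalf R n = 0 := by
  ext i j
  simp only [firstHalf, secondHalf, diagonal_mul_diagonal, diagonal_apply, Matrix.zero_apply]
  split_ifs <;> simp

theorem firstHalf_conjTranspose [StarRing R] : (firstHalf R n)ᴴ = firstHalf R n := by
  rw [firstHalf, diagonal_conjTranspose]
  congr 1
  ext i
  simp only [Pi.star_apply]
  split_ifs <;> simp

theorem secondHalf_conjTranspose [StarRing R] : (secondHalf R n)ᴴ = secondHalf R n := by
  rw [secondHalf, diagonal_conjTranspose]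
  congr 1
  ext i
  simp only [Pi.star_apply]
  split_ifs <;> simp

theorem firstHalf_mul_swap_mul_firstHalf :
    firstHalf R n * (upperShift R n + (upperShift R n)ᵀ) * firstHalf R n = 0 := by
  ext i j
  have := i.isLt
  have := j.isLt
  simp only [firstHalf, upperShift, mul_diagonal, diagonal_mul, Matrix.add_apply, transpose_apply,
    of_apply, Matrix.zero_apply]
  split_ifs <;> first | omega | simp

theorem secondHalf_mul_swap_mul_secondHalf (hn : Even n) :
    secondHalf R n * (upperShift R n + (upperShift R n)ᵀ) * secondHalf R n = 0 := by
  ext i j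
  have := i.isLt
  have := j.isLt
  obtain ⟨k, rfl⟩ := hn
  simp only [secondHalf, upperShift, mul_diagonal, diagonal_mul, Matrix.add_apply, transpose_apply,
    of_apply, Matrix.zero_apply]
  split_ifs <;> first | omega | simp

theorem firstHalf_mul_swap_mul_secondHalf (hn : Even n) :
    firstHalf R n * (upperShift R n + (upperShift R n)ᵀ) * secondHalf R n = upperShift R n := by
  ext i j
  have := i.isLt
  have := j.isLt
  obtain ⟨k, rfl⟩ := hn
  simp only [firstHalf, secondHalf, upperShift, mul_diagonal, diagonal_mul, Matrix.add_apply,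
    transpose_apply, of_apply]
  split_ifs <;> first | omega | simp

theorem secondHalf_mul_swap_mul_firstHalf (hn : Even n) :
    secondHalf R n * (upperShift R n + (upperShift R n)ᵀ) * firstHalf R n =
      (upperShift R n)ᵀ := by
  ext i j
  have := i.isLt
  have := j.isLt
  obtain ⟨k, rfl⟩ := hn
  simp only [firstHalf, secondHalf, upperShift, mul_diagonal, diagonal_mul, Matrix.add_apply,
    transpose_apply, of_apply]
  split_ifs <;> first | omega | simp

theorem lamPair_eq_kronecker (m : ℕ) (hpos : 0 < n) (hn : Even n) :
    lamPair R n m = upperShift R n ⊗ₖ (1 : Matrix (Fin m) (Fin m) R) -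
      (upperShift R n)ᵀ ⊗ₖ (1 : Matrix (Fin m) (Fin m) R) := by
  have hhalf : 0 < n / 2 := by obtain ⟨k, rfl⟩ := hn; omega
  ext ⟨i, a⟩ ⟨j, b⟩
  simp only [lamPair, upperShift, of_apply, Matrix.sub_apply, kroneckerMap_apply, transpose_apply,
    one_apply]
  by_cases hab : a = b
  · by_cases h₁ : (i : ℕ) + n / 2 = j
    · have h₂ : ¬ (j : ℕ) + n / 2 = i := by omega
      simp [hab, h₁, h₂]
    · by_cases h₂ : (j : ℕ) + n / 2 = i <;> simp [hab, h₁, h₂]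
  · simp [hab]

end Halves

section Congruence

variable {R : Type} [CommRing R] {m : ℕ}

theorem conjTranspose_inv_of_antihermitian [StarRing R] {Ξ : Matrix (Fin m) (Fin m) R}
    (hΞ : Ξᴴ = -Ξ) (hu : IsUnit Ξ) : (Ξ⁻¹)ᴴ = -Ξ⁻¹ := by
  rw [conjTranspose_nonsing_inv, hΞ]
  exact inv_eq_right_inv (by
    rw [neg_mul_neg, mul_nonsing_inv _ ((isUnit_iff_isUnit_det _).mp hu)])

/-- The block-diagonal matrix `diag(I, X)`, with `n / 2` blocks of each kind. -/
def halfBlock (n : ℕ) (X : Matrix (Fin m) (Fin m) R) :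
    Matrix (Fin n × Fin m) (Fin n × Fin m) R :=
  firstHalf R n ⊗ₖ (1 : Matrix (Fin m) (Fin m) R) + secondHalf R n ⊗ₖ X

theorem halfBlock_mul (n : ℕ) (X Y : Matrix (Fin m) (Fin m) R) :
    halfBlock n X * halfBlock n Y = halfBlock n (X * Y) := by
  simp only [halfBlock, add_mul, mul_add, ← mul_kronecker_mul, firstHalf_mul_self,
    secondHalf_mul_self, firstHalf_mul_secondHalf, secondHalf_mul_firstHalf, zero_kronecker,
    mul_one, add_zero, zero_add]

theorem halfBlock_one (n : ℕ) : halfBlock n (1 : Matrix (Fin m) (Fin m) R) = 1 := by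
  rw [halfBlock, ← add_kronecker, firstHalf_add_secondHalf, one_kronecker_one]

theorem isUnit_halfBlock (n : ℕ) {X : Matrix (Fin m) (Fin m) R} (hX : IsUnit X) :
    IsUnit (halfBlock n X) := by
  have hdet := (isUnit_iff_isUnit_det _).mp hX
  refine IsUnit.of_mul_eq_one (halfBlock n X⁻¹) ?_
  rw [halfBlock_mul, mul_nonsing_inv _ hdet, halfBlock_one]

theorem halfBlock_conjTranspose [StarRing R] (n : ℕ) (X : Matrix (Fin m) (Fin m) R) :
    (halfBlock n X)ᴴ = halfBlock n Xᴴ := by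
  simp only [halfBlock, conjTranspose_add, conjTranspose_kronecker, firstHalf_conjTranspose,
    secondHalf_conjTranspose, conjTranspose_one]

/-- Block scaling turns `[[0, Ξ], [Ξ, 0]]` into the standard symplectic form. -/
theorem halfBlock_congr_swap_kronecker [StarRing R] {n : ℕ} (hn : Even n) (hpos : 0 < n)
    {Ξ : Matrix (Fin m) (Fin m) R} (hΞ : Ξᴴ = -Ξ) (hu : IsUnit Ξ) :
    (halfBlock n Ξ⁻¹)ᴴ * ((upperShift R n + (upperShift R n)ᵀ) ⊗ₖ Ξ) * halfBlock n Ξ⁻¹ =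
      lamPair R n m := by
  have hdet := (isUnit_iff_isUnit_det _).mp hu
  have kronecker_neg_one : (upperShift R n)ᵀ ⊗ₖ (-1 : Matrix (Fin m) (Fin m) R) =
      -((upperShift R n)ᵀ ⊗ₖ (1 : Matrix (Fin m) (Fin m) R)) := by
    ext
    simp [kroneckerMap_apply]
  rw [halfBlock_conjTranspose, conjTranspose_inv_of_antihermitian hΞ hu,
    lamPair_eq_kronecker R n m hpos hn]
  simp only [halfBlock, add_mul _ _ (_ ⊗ₖ _), mul_add (_ ⊗ₖ _), add_mul (_ ⊗ₖ _),
    ← mul_kronecker_mul, firstHalf_mul_swap_mul_firstHalf,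
    secondHalf_mul_swap_mul_secondHalf R n hn, firstHalf_mul_swap_mul_secondHalf R n hn,
    secondHalf_mul_swap_mul_firstHalf R n hn, zero_kronecker, one_mul, mul_one, neg_mul,
    mul_nonsing_inv _ hdet, nonsing_inv_mul _ hdet, add_zero, zero_add, kronecker_neg_one, sub_eq_add_neg]

end Congruence

theorem witt_exponent_bound_for_antihermitian_forms
    (F : Type) [Field F] (hF : ringChar F ≠ 2)
    (R : Type) [CommRing R] [StarRing R] [Algebra F R]
    (hstar : ∀ a : F, star (algebraMap F R a) = algebraMap F R a)
    (n : ℕ) (hn : Even n) (hpos : 0 < n)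
    (P : Matrix (Fin n) (Fin n) F) (hP : IsUnit P)
    (hPP : P.transpose * P = hypMat F n) :
    ∀ (m : ℕ) (Ξ : Matrix (Fin m) (Fin m) R),
      Ξ.conjTranspose = -Ξ → IsUnit Ξ →
      ∃ E : Matrix (Fin n × Fin m) (Fin n × Fin m) R, IsUnit E ∧
        E.conjTranspose * ((1 : Matrix (Fin n) (Fin n) R) ⊗ₖ Ξ) * E = lamPair R n m := by
  intro m Ξ hΞ hu
  set σ := evenOddPerm n hn
  set f := algebraMap F R
  set T : Matrix (Fin n) (Fin n) F := P.submatrix id σ with hT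
  have hT_unit : IsUnit T :=
    (isUnit_submatrix_equiv (A := P) (Equiv.refl _) σ).mpr hP
  have hT_gram : Tᵀ * T = upperShift F n + (upperShift F n)ᵀ := by
    rw [← hypMat_submatrix_evenOddPerm F n hn, ← hPP, hT, transpose_submatrix,
      ← submatrix_mul _ _ _ _ _ Function.bijective_id]
  have hQ_star : (T.map f)ᴴ = Tᵀ.map f := by
    ext i j
    simpa using hstar (T j i)
  have h_shift : (upperShift F n).map f = upperShift R n := by
    ext i j
    simp [upperShift, apply_ite f]
  have hQ_gram : (T.map f)ᴴ * T.map f = upperShift R n + (upperShift R n)ᵀ := by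
    rw [hQ_star, ← Matrix.map_mul, hT_gram, Matrix.map_add f (map_add f), transpose_map,
      h_shift]
  have hQ_unit : IsUnit (T.map f) := hT_unit.map f.mapMatrix
  have hQ_kronecker_unit : IsUnit (T.map f ⊗ₖ (1 : Matrix (Fin m) (Fin m) R)) := by
    have hdet := (isUnit_iff_isUnit_det _).mp hQ_unit
    refine IsUnit.of_mul_eq_one ((T.map f)⁻¹ ⊗ₖ 1) ?_
    rw [← mul_kronecker_mul, mul_nonsing_inv _ hdet, one_mul, one_kronecker_one]
  have hΞ_inv_unit : IsUnit Ξ⁻¹ := (isUnit_nonsing_inv_iff).mpr hu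
  refine ⟨(T.map f ⊗ₖ 1) * halfBlock n Ξ⁻¹,
    hQ_kronecker_unit.mul (isUnit_halfBlock n hΞ_inv_unit), ?_⟩
  have h_congr : (T.map f ⊗ₖ (1 : Matrix (Fin m) (Fin m) R))ᴴ *
      ((1 : Matrix (Fin n) (Fin n) R) ⊗ₖ Ξ) * (T.map f ⊗ₖ 1) =
      (upperShift R n + (upperShift R n)ᵀ) ⊗ₖ Ξ := by
    rw [conjTranspose_kronecker, conjTranspose_one, ← mul_kronecker_mul, ← mul_kronecker_mul,
      mul_one, one_mul, mul_one, hQ_gram]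
  rw [← halfBlock_congr_swap_kronecker hn hpos hΞ hu, ← h_congr, conjTranspose_mul]
  simp only [Matrix.mul_assoc]
end
end

section
/- Let n ≥ 0 and let p₁, …, p_n be distinct odd primes. For each j let m_j ≥ 0 and let q_j be a quadratic form on the 𝔽_{p_j}-vector space (Fin m_j → ZMod p_j) with values in ZMod p_j that is anisotropic, i.e., q_j(v) = 0 implies v = 0. Let ε ∈ {0, 1}, let x, y ∈ ℤ, and let z_j ∈ (Fin m_j → ZMod p_j) for each j. If the rational number ε·(x² + x·y + y²)/2 + Σ_{j=1}^n (q_j(z_j)).val / p_j is an integer (where (·).val ∈ {0,…,p_j−1} is the canonical lift from ZMod p_j to ℤ), then z_j = 0 for every j, and if ε = 1 then x and y are both even. -/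
/-! Statement 13: a boson in a finite tensor product of dyon theories over distinct odd
primes (possibly together with the three-fermion theory) is trivial: if
`ε·(x² + xy + y²)/2 + Σ_j q_j(z_j)/p_j ∈ ℤ` with each `q_j` anisotropic over `𝔽_{p_j}`,
then all `z_j = 0`, and if `ε = 1` then `x` and `y` are even. -/

/-- If a sum of fractions with pairwise coprime denominators is an integer, then each of the
fractions is an integer. -/
theorem dvd_of_sum_div_eq_intCast {ι : Type*} [Fintype ι] (d a : ι → ℤ)
    (hd : ∀ i, d i ≠ 0) (hcop : Pairwise fun i j => IsCoprime (d i) (d j)) (k : ℤ)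
    (h : ∑ i, (a i : ℚ) / (d i : ℚ) = (k : ℚ)) (j : ι) : d j ∣ a j := by
  classical
  have hmul : ∑ i, a i * ∏ l ∈ Finset.univ.erase i, d l = k * ∏ l, d l := by
    have hQ : ∑ i, (a i : ℚ) * ∏ l ∈ Finset.univ.erase i, (d l : ℚ) = k * ∏ l, (d l : ℚ) := by
      rw [← h, Finset.sum_mul]
      refine Finset.sum_congr rfl fun i _ => ?_
      rw [← Finset.mul_prod_erase Finset.univ (fun l => (d l : ℚ)) (Finset.mem_univ i)]
      have : (d i : ℚ) ≠ 0 := by exact_mod_cast hd i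
      field_simp
    exact_mod_cast hQ
  have hprod : d j ∣ ∏ l, d l := Finset.dvd_prod_of_mem d (Finset.mem_univ j)
  have hrest : d j ∣ ∑ i ∈ Finset.univ.erase j, a i * ∏ l ∈ Finset.univ.erase i, d l := by
    refine Finset.dvd_sum fun i hi => Dvd.dvd.mul_left (Finset.dvd_prod_of_mem d ?_) _
    exact Finset.mem_erase.2 ⟨(Finset.ne_of_mem_erase hi).symm, Finset.mem_univ j⟩
  rw [← Finset.add_sum_erase Finset.univ _ (Finset.mem_univ j)] at hmul
  have hj : d j ∣ a j * ∏ l ∈ Finset.univ.erase j, d l :=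
    (dvd_add_left hrest).1 (hmul ▸ hprod.mul_left k)
  exact (IsCoprime.prod_right fun l hl => hcop (Finset.ne_of_mem_erase hl).symm).dvd_of_dvd_mul_right
    hj

/-- The norm form `x² + xy + y²` is even only at pairs of even integers. -/
theorem Int.even_and_even_of_even_sq_add_mul_add_sq {x y : ℤ}
    (h : Even (x ^ 2 + x * y + y ^ 2)) : Even x ∧ Even y := by
  simp only [Int.even_add, Int.even_mul, Int.even_pow] at h
  tauto

theorem no_nontrivial_boson_in_product_of_dyon_theories
    (n : ℕ) (p : Fin n → ℕ)
    (hp : ∀ j, (p j).Prime ∧ p j ≠ 2)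
    (hinj : Function.Injective p)
    (m : Fin n → ℕ)
    (q : ∀ j, QuadraticForm (ZMod (p j)) (Fin (m j) → ZMod (p j)))
    (hq : ∀ j, (q j).Anisotropic)
    (ε : ℕ) (hε : ε = 0 ∨ ε = 1)
    (x y : ℤ) (z : ∀ j, Fin (m j) → ZMod (p j))
    (hint : ∃ k : ℤ, (ε : ℚ) * ((x : ℚ) ^ 2 + (x : ℚ) * (y : ℚ) + (y : ℚ) ^ 2) / 2 +
        ∑ j, (((q j) (z j)).val : ℚ) / (p j : ℚ) = (k : ℚ)) :
    (∀ j, z j = 0) ∧ (ε = 1 → Even x ∧ Even y) := by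
  obtain ⟨k, hk⟩ := hint
  have hodd (j : Fin n) : IsCoprime (2 : ℤ) (p j : ℤ) :=
    Nat.isCoprime_iff_coprime.2 ((Nat.coprime_primes Nat.prime_two (hp j).1).2 (hp j).2.symm)
  have hdvd := dvd_of_sum_div_eq_intCast (ι := Option (Fin n))
    (fun i => i.elim 2 fun j => (p j : ℤ))
    (fun i => i.elim (ε * (x ^ 2 + x * y + y ^ 2)) fun j => ((q j (z j)).val : ℤ))
    (by
      rintro (_ | j)
      · exact two_ne_zero
      · exact Int.natCast_ne_zero.2 (hp j).1.ne_zero)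
    (by
      rintro (_ | i) (_ | j) hij
      · exact absurd rfl hij
      · exact hodd j
      · exact (hodd i).symm
      · refine Nat.isCoprime_iff_coprime.2 ((Nat.coprime_primes (hp i).1 (hp j).1).2 fun h => ?_)
        exact hij (congrArg some (hinj h)))
    k (by
      rw [Fintype.sum_option, ← hk]
      simp)
  refine ⟨fun j => hq j _ ?_, ?_⟩
  · have := Fact.mk (hp j).1
    have hj : (p j : ℤ) ∣ ((q j (z j)).val : ℤ) := hdvd (some j)
    exact (ZMod.val_eq_zero _).1
      (Nat.eq_zero_of_dvd_of_lt (Int.natCast_dvd_natCast.1 hj) (ZMod.val_lt _))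
  · rintro rfl
    refine Int.even_and_even_of_even_sq_add_mul_add_sq (even_iff_two_dvd.2 ?_)
    simpa using hdvd none
end

section
/- Let p be an odd prime, let f be a nonzero element of 𝔽_p = ZMod p, and let R = 𝔽_p[x^{±1}, y^{±1}, z^{±1}] with the involution star determined by inverting each variable. Define the 4 × 4 matrix Q over R whose rows are: row 1: ( (x·y·z − x·z + z·y^{−1} + 1)/4 , (x·z·y² + z·y − x·z·y + z)/4 , f·(y + x·z·y + z − x·z) , f·(−y² + y − z·y + z) ); row 2: ( (−z·x² + z·x·y^{−1} + x + y^{−1})/4 , (−y·z·x² + y·z·x + z·x + 1)/4 , f·(−z·x² − x + z·x + 1) , f·(x·y − y + x·z + 1) ); row 3: ( (−x·z·y − y + x·z − 1)/(4f) , (x·y·z − y·x^{−1})/(4f) , 0 , y·z − y ); row 4: ( (x·y − x·z·y^{−1})/(4f) , (−x·z·y + y − x·z − 1)/(4f) , x − x·z , 0 ). Then Q is symplectic: Q† λ₂ Q = λ₂, where λ₂ is the 4 × 4 block matrix [[0, I₂],[−I₂, 0]] and Q† is the transpose of Q followed by entrywise star. (This matrix Q_{p,f} defines the nontrivial three-dimensional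 translation invariant Clifford QCA of the paper.) -/
/-! Statement 14: the explicit matrix `Q_{p,f}` over `𝔽_p[x^±, y^±, z^±]` defining the
nontrivial 3D translation invariant Clifford QCA is symplectic: `Q† λ₂ Q = λ₂`. -/

noncomputable section

/-- The Laurent polynomial ring `𝔽_p[x^±, y^±, z^±]`. -/
abbrev R3 (p : ℕ) : Type := AddMonoidAlgebra (ZMod p) (Fin 3 →₀ ℤ)

/-- The involution inverting each variable. -/
def st3 (p : ℕ) : R3 p ≃ₐ[ZMod p] R3 p :=
  AddMonoidAlgebra.domCongr (ZMod p) (ZMod p) (AddEquiv.neg (Fin 3 →₀ ℤ))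

/-- Conjugate transpose with respect to `st3`. -/
def dag3 {p : ℕ} {m n : Type} (M : Matrix m n (R3 p)) : Matrix n m (R3 p) :=
  fun i j => st3 p (M j i)

/-- The monomial `x^a y^b z^c`. -/
def mono (p : ℕ) (a b c : ℤ) : R3 p :=
  AddMonoidAlgebra.single
    (Finsupp.single (0 : Fin 3) a + Finsupp.single 1 b + Finsupp.single 2 c) 1

/-- The symplectic form `λ₂ = [[0, I₂],[−I₂, 0]]`. -/
def lam2 (p : ℕ) : Matrix (Fin 4) (Fin 4) (R3 p) :=
  !![0, 0, 1, 0; 0, 0, 0, 1; -1, 0, 0, 0; 0, -1, 0, 0]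

/-- The matrix `Q_{p,f}` of the three-dimensional TI Clifford QCA. -/
def Qpf (p : ℕ) (f : ZMod p) : Matrix (Fin 4) (Fin 4) (R3 p) :=
  let x := mono p 1 0 0
  let y := mono p 0 1 0
  let z := mono p 0 0 1
  let xi := mono p (-1) 0 0
  let yi := mono p 0 (-1) 0
  let C : ZMod p → R3 p := algebraMap (ZMod p) (R3 p)
  let c4 := C (4 : ZMod p)⁻¹
  let cf := C f
  let c4f := C ((4 * f) : ZMod p)⁻¹
  !![c4 * (x*y*z - x*z + z*yi + 1), c4 * (x*z*y^2 + z*y - x*z*y + z),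
      cf * (y + x*z*y + z - x*z), cf * (-y^2 + y - z*y + z);
    c4 * (-z*x^2 + z*x*yi + x + yi), c4 * (-y*z*x^2 + y*z*x + z*x + 1),
      cf * (-z*x^2 - x + z*x + 1), cf * (x*y - y + x*z + 1);
    c4f * (-x*z*y - y + x*z - 1), c4f * (x*y*z - y*xi), 0, y*z - y;
    c4f * (x*y - x*z*yi), c4f * (-x*z*y + y - x*z - 1), x - x*z, 0]

theorem mono_mul_mono (p : ℕ) (a b c a' b' c' : ℤ) :
    mono p a b c * mono p a' b' c' = mono p (a + a') (b + b') (c + c') := by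
  simp only [mono, AddMonoidAlgebra.single_mul_single, mul_one, Finsupp.single_add]
  congr 1
  abel

theorem mono_zero (p : ℕ) : mono p 0 0 0 = 1 := by
  simp [mono, AddMonoidAlgebra.one_def]

theorem st3_mono (p : ℕ) (a b c : ℤ) : st3 p (mono p a b c) = mono p (-a) (-b) (-c) := by
  simp only [st3, mono, AddMonoidAlgebra.domCongr_single, AddEquiv.neg_apply, neg_add,
    Finsupp.single_neg]

theorem Qpf_symplectic (p : ℕ) [Fact p.Prime] (hodd : p ≠ 2)
    (f : ZMod p) (hf : f ≠ 0) :
    dag3 (Qpf p f) * lam2 p * Qpf p f = lam2 p := by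
  have h2 : (2 : ZMod p) ≠ 0 := by
    rw [Ne, show (2 : ZMod p) = ((2 : ℕ) : ZMod p) by norm_num, ZMod.natCast_eq_zero_iff]
    exact fun h => hodd ((Nat.prime_dvd_prime_iff_eq Fact.out Nat.prime_two).1 h)
  have h4 : (4 : ZMod p) ≠ 0 := by
    rw [show (4 : ZMod p) = 2 * 2 by norm_num]
    exact mul_ne_zero h2 h2
  have hc : algebraMap (ZMod p) (R3 p) f * algebraMap (ZMod p) (R3 p) (4 * f)⁻¹ =
      algebraMap (ZMod p) (R3 p) (4 : ZMod p)⁻¹ := by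
    rw [← map_mul]
    congr 1
    field_simp
  have hq : 4 * algebraMap (ZMod p) (R3 p) (4 : ZMod p)⁻¹ = 1 := by
    rw [← map_ofNat (algebraMap (ZMod p) (R3 p)) 4, ← map_mul, mul_inv_cancel₀ h4, map_one]
  have hx : mono p 1 0 0 * mono p (-1) 0 0 = 1 := by simp [mono_mul_mono, mono_zero]
  have hy : mono p 0 1 0 * mono p 0 (-1) 0 = 1 := by simp [mono_mul_mono, mono_zero]
  have hz : mono p 0 0 1 * mono p 0 0 (-1) = 1 := by simp [mono_mul_mono, mono_zero]
  ext1 i j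
  rw [Matrix.mul_assoc]
  fin_cases i <;> fin_cases j <;>
    simp [dag3, lam2, Qpf, Matrix.mul_apply, Fin.sum_univ_four, st3_mono,
      -mul_inv_rev, -AddMonoidAlgebra.coe_algebraMap] <;>
    generalize algebraMap (ZMod p) (R3 p) (4 * f)⁻¹ = c4f at * <;>
    generalize algebraMap (ZMod p) (R3 p) (4 : ZMod p)⁻¹ = c4 at * <;>
    generalize algebraMap (ZMod p) (R3 p) f = cf at * <;>
    generalize mono p 1 0 0 = x at * <;>
    generalize mono p 0 1 0 = y at * <;>
    generalize mono p 0 0 1 = z at * <;>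
    generalize mono p (-1) 0 0 = xi at * <;>
    generalize mono p 0 (-1) 0 = yi at * <;>
    generalize mono p 0 0 (-1) = zi at * <;>
    clear hodd hf h2 h4
  all_goals grind
end
end

section
/- Let p be an odd prime, f a nonzero element of 𝔽_p = ZMod p, and R = 𝔽_p[x^{±1}, y^{±1}] with the involution star determined by x ↦ x^{−1}, y ↦ y^{−1}. Define the 4 × 2 matrix B_top over R with columns ( −x·f + x·y·f + f , f·x − f·x² , 0 , −x ) and ( f − f·y , f·x , y , 0 ), and the column vector σ_bd = ( f·x·(y−1)·y , −f·(x−1)·x·y , (x−1)·y , x·(y−1) ) ∈ R⁴. Let N be the 4 × 3 matrix whose first two columns are those of B_top and whose third column is σ_bd. Then the kernel of the R-linear map R⁴ → R³ given by the 3 × 4 matrix N† λ₂ equals the image of the R-linear map R → R⁴ given by σ_bd, where λ₂ = [[0, I₂],[−I₂, 0]]. (This is the exactness computation establishing local topological order of the boundary Hamiltonian of the QCA α_{p,f}: every local operator commuting with all bulk and surface terms near the boundary is a product of surface terms.) -/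
/-! Statement 15: the exactness computation establishing local topological order at the
boundary of the QCA `α_{p,f}`: the kernel of `N† λ₂` equals the image of `σ_bd`. -/

noncomputable section

/-- The Laurent polynomial ring `𝔽_p[x^±, y^±]`. -/
abbrev R2 (p : ℕ) : Type := AddMonoidAlgebra (ZMod p) (Fin 2 →₀ ℤ)

/-- The involution inverting both variables. -/
def st2 (p : ℕ) : R2 p ≃ₐ[ZMod p] R2 p :=
  AddMonoidAlgebra.domCongr (ZMod p) (ZMod p) (AddEquiv.neg (Fin 2 →₀ ℤ))

/-- Conjugate transpose with respect to `st2`. -/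
def dag2 {p : ℕ} {m n : Type} (M : Matrix m n (R2 p)) : Matrix n m (R2 p) :=
  fun i j => st2 p (M j i)

/-- The monomial `x^a y^b`. -/
def mono2 (p : ℕ) (a b : ℤ) : R2 p :=
  AddMonoidAlgebra.single (Finsupp.single (0 : Fin 2) a + Finsupp.single 1 b) 1

/-- The symplectic form `λ₂ = [[0, I₂],[−I₂, 0]]`. -/
def lam2' (p : ℕ) : Matrix (Fin 4) (Fin 4) (R2 p) :=
  !![0, 0, 1, 0; 0, 0, 0, 1; -1, 0, 0, 0; 0, -1, 0, 0]

/-- The surface term `σ_bd`. -/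
def sbd (p : ℕ) (f : ZMod p) : Fin 4 → R2 p :=
  let x := mono2 p 1 0
  let y := mono2 p 0 1
  let cf := algebraMap (ZMod p) (R2 p) f
  ![cf * x * (y - 1) * y, -(cf * (x - 1) * x * y), (x - 1) * y, x * (y - 1)]

/-- The `4 × 3` matrix `N` whose first two columns are the boundary parts `B^top` of the
bulk terms and whose third column is the surface term `σ_bd`. -/
def Ntop (p : ℕ) (f : ZMod p) : Matrix (Fin 4) (Fin 3) (R2 p) :=
  let x := mono2 p 1 0
  let y := mono2 p 0 1
  let cf := algebraMap (ZMod p) (R2 p) f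
  !![-(x * cf) + x * y * cf + cf, cf - cf * y, sbd p f 0;
     cf * x - cf * x ^ 2,         cf * x,     sbd p f 1;
     0,                           y,          sbd p f 2;
     -x,                          0,          sbd p f 3]

lemma mono2_mul_mono2 (p : ℕ) (a b c d : ℤ) :
    mono2 p a b * mono2 p c d = mono2 p (a + c) (b + d) := by
  simp only [mono2, AddMonoidAlgebra.single_mul_single, Finsupp.single_add, mul_one]
  congr 1
  abel

lemma mono2_zero_zero (p : ℕ) : mono2 p 0 0 = 1 := by
  simp [mono2, AddMonoidAlgebra.one_def]

lemma st2_mono2 (p : ℕ) (a b : ℤ) : st2 p (mono2 p a b) = mono2 p (-a) (-b) := by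
  rw [mono2, st2, AddMonoidAlgebra.domCongr_single, mono2]
  congr 1
  simp [add_comm]

lemma mono2_natCast_zero (p n : ℕ) : mono2 p n 0 = mono2 p 1 0 ^ n := by
  induction n with
  | zero => simp [mono2_zero_zero]
  | succ n ih => rw [pow_succ, ← ih, mono2_mul_mono2]; simp

lemma sub_one_dvd_mono2_sub_one (p : ℕ) (n : ℤ) :
    mono2 p 1 0 - 1 ∣ mono2 p n 0 - 1 := by
  obtain ⟨m, rfl | rfl⟩ := n.eq_nat_or_neg
  · rw [mono2_natCast_zero]
    exact sub_one_dvd_pow_sub_one _ _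
  · have h : mono2 p (-m) 0 - 1 = -mono2 p (-m) 0 * (mono2 p m 0 - 1) := by
      have := mono2_mul_mono2 p (-m) 0 m 0
      simp only [neg_add_cancel, add_zero, mono2_zero_zero] at this
      linear_combination this
    rw [h, mono2_natCast_zero]
    exact (sub_one_dvd_pow_sub_one _ _).mul_left _

/-- The specialization `x ↦ 1`, as an endomorphism of the Laurent polynomial ring. -/
def specializeX (p : ℕ) : R2 p →+* R2 p :=
  AddMonoidAlgebra.mapDomainRingHom (ZMod p)
    ((Finsupp.singleAddHom (1 : Fin 2)).comp (Finsupp.applyAddHom (1 : Fin 2)))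

lemma specializeX_single (p : ℕ) (m : Fin 2 →₀ ℤ) (r : ZMod p) :
    specializeX p (AddMonoidAlgebra.single m r) =
      AddMonoidAlgebra.single (Finsupp.single 1 (m 1)) r := by
  rw [specializeX, AddMonoidAlgebra.mapDomainRingHom_apply, AddMonoidAlgebra.mapDomain_single]
  rfl

lemma specializeX_mono2 (p : ℕ) (a b : ℤ) : specializeX p (mono2 p a b) = mono2 p 0 b := by
  simp [mono2, specializeX_single]

lemma sub_one_dvd_sub_specializeX (p : ℕ) (g : R2 p) :
    mono2 p 1 0 - 1 ∣ g - specializeX p g := by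
  induction g using AddMonoidAlgebra.induction_linear with
  | zero => simp
  | add g h hg hh =>
    rw [map_add, add_sub_add_comm]
    exact dvd_add hg hh
  | single m r =>
    have h : (AddMonoidAlgebra.single m r : R2 p) - specializeX p (AddMonoidAlgebra.single m r) =
        AddMonoidAlgebra.single (Finsupp.single 1 (m 1)) r * (mono2 p (m 0) 0 - 1) := by
      rw [specializeX_single, mul_sub, mono2, AddMonoidAlgebra.single_mul_single, mul_one, mul_one]
      congr 2
      ext i
      fin_cases i <;> simp
    rw [h]
    exact (sub_one_dvd_mono2_sub_one p _).mul_left _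

lemma mono2_ne_one (p : ℕ) [Fact p.Prime] {a b : ℤ} (h : a ≠ 0 ∨ b ≠ 0) : mono2 p a b ≠ 1 := by
  rw [mono2, AddMonoidAlgebra.one_def]
  intro e
  have e' := (AddMonoidAlgebra.single_left_injective (one_ne_zero' (ZMod p))) e
  have h0 := DFunLike.congr_fun e' 0
  have h1 := DFunLike.congr_fun e' 1
  simp at h0 h1
  omega

/-- The elements `x - 1` and `y - 1` are relatively prime. -/
lemma sub_one_dvd_of_dvd_mul (p : ℕ) [Fact p.Prime] {c : R2 p}
    (h : mono2 p 1 0 - 1 ∣ (mono2 p 0 1 - 1) * c) : mono2 p 1 0 - 1 ∣ c := by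
  obtain ⟨d, hd⟩ := h
  have hs := congrArg (specializeX p) hd
  simp only [map_mul, map_sub, map_one, specializeX_mono2, mono2_zero_zero, sub_self,
    zero_mul] at hs
  have hc : specializeX p c = 0 :=
    (mul_eq_zero.mp hs).resolve_left (sub_ne_zero.mpr (mono2_ne_one p (by simp)))
  simpa [hc] using sub_one_dvd_sub_specializeX p c

lemma mul_sub_one_eq_of_commutes {A : Type*} [CommRing A] [NoZeroDivisors A]
    {x X y Y f a b c d : A} (hx : x * X = 1) (hy : y * Y = 1) (hf : 2 * f ≠ 0)
    (h₁ : (-(X * f) + X * Y * f + f) * c + (f * X - f * X ^ 2) * d + X * b = 0)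
    (h₂ : (f - f * Y) * c + f * X * d - Y * a = 0)
    (h₃ : f * X * (Y - 1) * Y * c - f * (X - 1) * X * Y * d - (X - 1) * Y * a
      - X * (Y - 1) * b = 0) :
    a = f * ((y - 1) * c + X * y * d) ∧ b = -(f * ((Y + x - 1) * c + (1 - X) * d)) ∧
      x * (y - 1) * c = y * (x - 1) * d := by
  have ha : a = f * ((y - 1) * c + X * y * d) := by
    linear_combination -y * h₂ - (f * c + a) * hy
  have hb : b = -(f * ((Y + x - 1) * c + (1 - X) * d)) := by
    linear_combination x * h₁ - ((-f + Y * f) * c + (f - f * X) * d + b) * hx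
  refine ⟨ha, hb, ?_⟩
  have key : 2 * f * (x * (y - 1) * c - y * (x - 1) * d) = 0 := by
    subst ha hb
    grind
  exact sub_eq_zero.mp ((mul_eq_zero.mp key).resolve_left hf)

lemma two_mul_algebraMap_ne_zero {p : ℕ} [Fact p.Prime] (hodd : p ≠ 2) {f : ZMod p}
    (hf : f ≠ 0) : 2 * algebraMap (ZMod p) (R2 p) f ≠ 0 := by
  have h2 : (2 : ZMod p) ≠ 0 := Ring.two_ne_zero (by rwa [ZMod.ringChar_zmod_n])
  have h := (map_ne_zero_iff _ (FaithfulSMul.algebraMap_injective (ZMod p) (R2 p))).mpr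
    (mul_ne_zero h2 hf)
  rwa [map_mul, map_ofNat] at h

theorem surface_local_topological_order
    (p : ℕ) [Fact p.Prime] (hodd : p ≠ 2) (f : ZMod p) (hf : f ≠ 0) :
    LinearMap.ker ((dag2 (Ntop p f) * lam2' p).mulVecLin) =
      LinearMap.range ((Matrix.of fun (i : Fin 4) (_ : Fin 1) => sbd p f i).mulVecLin) := by
  have hx : mono2 p 1 0 * mono2 p (-1) 0 = 1 := by simp [mono2_mul_mono2, mono2_zero_zero]
  have hy : mono2 p 0 1 * mono2 p 0 (-1) = 1 := by simp [mono2_mul_mono2, mono2_zero_zero]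
  ext v
  simp only [LinearMap.mem_ker, LinearMap.mem_range, Matrix.mulVecLin_apply, funext_iff,
    Fin.forall_fin_succ, Matrix.mulVec, dotProduct, Matrix.mul_apply, Fin.sum_univ_succ]
  simp [dag2, Ntop, lam2', sbd, st2_mono2, -AddMonoidAlgebra.coe_algebraMap]
  have hcf := two_mul_algebraMap_ne_zero hodd hf
  have hx1 : mono2 p 1 0 - 1 ≠ 0 := sub_ne_zero.mpr (mono2_ne_one p (by simp))
  have hdvd := fun c => sub_one_dvd_of_dvd_mul p (c := c)
  generalize algebraMap (ZMod p) (R2 p) f = F at *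
  generalize mono2 p 1 0 = x at *
  generalize mono2 p 0 1 = y at *
  generalize mono2 p (-1) 0 = X at *
  generalize mono2 p 0 (-1) = Y at *
  constructor
  · rintro ⟨h₁, h₂, h₃⟩
    obtain ⟨ha, hb, hcd⟩ := mul_sub_one_eq_of_commutes (a := v 0) (b := v 1) (c := v 2) (d := v 3)
      hx hy hcf (by linear_combination h₁) (by linear_combination h₂) (by linear_combination h₃)
    obtain ⟨e, he⟩ := hdvd (v 2) ⟨X * y * v 3, by
      linear_combination X * hcd - (y - 1) * v 2 * hx⟩
    have hd : v 3 = x * (y - 1) * Y * e := by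
      have h : x * (y - 1) * e = y * v 3 := by
        refine mul_left_cancel₀ hx1 ?_
        linear_combination hcd - x * (y - 1) * he
      linear_combination -Y * h - v 3 * hy
    refine ⟨fun _ => Y * e, ?_, ?_, ?_, ?_⟩
    · rw [ha, he, hd]
      grind
    · rw [hb, he, hd]
      grind
    · rw [he]
      linear_combination (x - 1) * e * hy
    · rw [hd]
      ring
  · rintro ⟨s, h0, h1, h2, h3⟩
    rw [← h0, ← h1, ← h2, ← h3]
    refine ⟨?_, ?_, ?_⟩ <;> grind
end
end
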